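/- Let k be an uncountable algebraically closed field, let N and c be positive integers with c ≤ N−1, and let d_1,…,d_c be positive integers. Let V = ∏_{i=1}^c V_{d_i}, where V_d denotes the finite-dimensional k-vector space of homogeneous polynomials of degree d in k[X_0,…,X_N]. Then there exists a countable family (Z_j)_{j∈ℕ} of proper Zariski-closed subsets of V (each Z_j the common zero locus of a set of polynomial functions on V, with Z_j ≠ V) such that for every tuple (f_1,…,f_c) ∈ V ∖ ⋃_j Z_j, the closed subscheme X = V(f_1,…,f_c) ⊆ ℙ^N_k is integral of dimension N−c, and the covering gonality of its function field satisfies cvg_k(K(X)) ≥ (d_1+⋯+d_c − N + 2)/2. -/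

import Mathlib

universe u v

/-- `K` is an algebraic function field over `k`, i.e. a finitely generated field extension. -/
def IsAlgFunctionField (k : Type u) (K : Type v) [Field k] [Field K] [Algebra k K] : Prop :=
  (⊤ : IntermediateField k K).FG

/-- There is a covering diagram for `K/k` of degree `e`. -/
def HasCvgDiagram (k : Type u) (K : Type v) [Field k] [Field K] [Algebra k K] (e : ℕ) : Prop :=
  ∃ (K_B K_C : Type (max u v)) (_ : Field K_B) (_ : Field K_C)
    (_ : Algebra k K_B) (_ : Algebra k K_C),
    IsAlgFunctionField k K_B ∧ IsAlgFunctionField k K_C ∧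
    ∃ (f : K →ₐ[k] K_C) (π : RatFunc K_B →ₐ[k] K_C),
      f.toRingHom.Finite ∧
      (letI := π.toRingHom.toAlgebra
       Module.finrank (RatFunc K_B) K_C = e)

/-- The covering gonality of `K` over `k`. -/
noncomputable def cvg (k : Type u) (K : Type v) [Field k] [Field K] [Algebra k K] : ℕ :=
  sInf {e : ℕ | 0 < e ∧ HasCvgDiagram k K e}

/-- The function field `K(X)` of `X = Proj (k[X_0,…,X_N] ⧸ I)` for a prime `I`. -/
noncomputable def projFunctionField (k : Type u) [Field k] (n : ℕ)
    (I : Ideal (MvPolynomial (Fin n) k)) [I.IsPrime] :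
    IntermediateField k (FractionRing (MvPolynomial (Fin n) k ⧸ I)) :=
  IntermediateField.adjoin k
    { x | ∃ (p q : MvPolynomial (Fin n) k) (m : ℕ), p.IsHomogeneous m ∧ q.IsHomogeneous m ∧
        algebraMap (MvPolynomial (Fin n) k ⧸ I) (FractionRing (MvPolynomial (Fin n) k ⧸ I))
          (Ideal.Quotient.mk I q) ≠ 0 ∧
        x = algebraMap (MvPolynomial (Fin n) k ⧸ I) (FractionRing (MvPolynomial (Fin n) k ⧸ I))
              (Ideal.Quotient.mk I p) /
            algebraMap (MvPolynomial (Fin n) k ⧸ I) (FractionRing (MvPolynomial (Fin n) k ⧸ I))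
              (Ideal.Quotient.mk I q) }

/-- The algebra of polynomial functions on a `k`-vector space `V`: the subalgebra of `V → k`
generated by the linear functionals. -/
def polyFun (k : Type u) (V : Type v) [CommSemiring k] [AddCommMonoid V] [Module k V] :
    Subalgebra k (V → k) :=
  Algebra.adjoin k (Set.range fun φ : V →ₗ[k] k => (φ : V → k))

/-- `Z` is a proper Zariski-closed subset of the `k`-vector space `V`: the common zero locus of
a set of polynomial functions on `V`, and not all of `V`. -/
def IsProperZariskiClosed (k : Type u) (V : Type v) [CommSemiring k] [AddCommMonoid V]
    [Module k V] (Z : Set V) : Prop :=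
  Z ≠ Set.univ ∧ ∃ S : Set (V → k), ↑S ⊆ (polyFun k V : Set (V → k)) ∧
    Z = {v | ∀ g ∈ S, g v = 0}

section PartR
section Recip
open Finset

variable {ι M F Γ : Type*} [Fintype ι] [DecidableEq ι] [AddCommGroup M] [Module ℚ M]

/-- If all rows are multiples and two are proportional to a common vector, the value is 0. -/
lemma alt_prop_zero (Ψ : M [⋀^ι]→ₗ[ℚ] ℚ) (x : ι → M) {i j : ι} (hij : i ≠ j) (w : M) (p q : ℚ)
    (hi : x i = p • w) (hj : x j = q • w) : Ψ x = 0 := by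
  have h1 : x = Function.update (Function.update x i (p • w)) j (q • w) := by
    funext a
    by_cases ha : a = j
    · subst ha; simp [hj]
    · by_cases hb : a = i
      · subst hb; simp [ha, hi]
      · simp [ha, hb]
  rw [h1, Ψ.map_update_smul, Function.update_comm hij, Ψ.map_update_smul]
  rw [Ψ.map_eq_zero_of_eq (i := i) (j := j) _ _ hij]
  · simp
  · simp [hij.symm]

/-- expansion of `Ψ (κ + m δ)` -/
lemma alt_expand (Ψ : M [⋀^ι]→ₗ[ℚ] ℚ) (H : Submodule ℚ M) (hH : ∀ x : ι → M, (∀ i, x i ∈ H) → Ψ x = 0)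
    (δ : M) (κ : ι → M) (hκ : ∀ i, κ i ∈ H) (m : ι → ℚ) :
    Ψ (fun i => κ i + m i • δ) = ∑ i, m i * Ψ (Function.update κ i δ) := by
  classical
  have h0 : Ψ (fun i => κ i + m i • δ) = Ψ.toMultilinearMap ((fun i => m i • δ) + κ) := by
    simp only [AlternatingMap.coe_multilinearMap]
    congr 1; funext i; simp [add_comm]
  rw [h0, MultilinearMap.map_add_univ]
  have h1 : ∀ i, m i * Ψ (Function.update κ i δ) =
      Ψ.toMultilinearMap (({i} : Finset ι).piecewise (fun i => m i • δ) κ) := by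
    intro i
    rw [Finset.piecewise_singleton]
    simp
  simp_rw [h1]
  rw [← Finset.sum_image (f := fun s : Finset ι => Ψ.toMultilinearMap (s.piecewise (fun i => m i • δ) κ))
    (g := fun i => ({i} : Finset ι)) (s := Finset.univ) (by intro a _ b _ h; simpa using h)]
  symm
  apply Finset.sum_subset (Finset.subset_univ _)
  intro s _ hs
  simp only [Finset.mem_image, Finset.mem_univ, true_and, not_exists] at hs
  rcases s.eq_empty_or_nonempty with rfl | ⟨a, ha⟩
  · simpa using hH κ hκ
  · have : ∃ b ∈ s, b ≠ a := by
      by_contra hcon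
      push Not at hcon
      exact hs a (by ext x; simp; constructor; · rintro rfl; exact ha
                     · exact hcon x)
    obtain ⟨b, hb, hba⟩ := this
    exact alt_prop_zero Ψ _ hba δ (m b) (m a) (by simp [hb]) (by simp [ha])

variable [Field F] [DecidableEq F] [LinearOrderedCommGroupWithZero Γ]

/-- Reciprocity on the projective line, with finitely many points `P`. -/
lemma reciprocity (Ψ : M [⋀^ι]→ₗ[ℚ] ℚ) (H : Submodule ℚ M)
    (hH : ∀ x : ι → M, (∀ i, x i ∈ H) → Ψ x = 0)
    (δ : M) (κ : ι → M) (hκ : ∀ i, κ i ∈ H) (V : Valuation F Γ) (W : F → M) (P : Finset F)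
    (hWH : ∀ a ∈ P, ∀ b ∈ P, a ≠ b → W (a - b) ∈ H)
    (hVW : ∀ a b, V a = V b → W a = W b) (m : ι → F → ℚ) :
    ∑ a ∈ P, Ψ (fun j => κ j + ∑ b ∈ P, m j b • (if a = b then δ else W (a - b)))
      + Ψ (fun j => κ j + ∑ b ∈ P, m j b • (-δ)) = 0 := by
  classical
  -- D : points × points
  let D : Option P → P → M := fun a b => match a with
    | none => -δ
    | some a => if a = b then δ else W (a - b)
  let c : Option P → ι → Option P → M := fun a j s => match s with
    | none => κ j
    | some b => m j b • D a b
  have hD1 : ∀ a : P, Ψ (fun j => κ j + ∑ b ∈ P, m j b • (if (a:F) = b then δ else W (a - b)))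
      = Ψ (fun j => ∑ s, c (some a) j s) := by
    intro a
    congr 1; funext j
    rw [Fintype.sum_option]
    congr 1
    rw [← Finset.sum_coe_sort P]
    simp only [c, D, Subtype.ext_iff]
  have hD2 : Ψ (fun j => κ j + ∑ b ∈ P, m j b • (-δ)) = Ψ (fun j => ∑ s, c none j s) := by
    congr 1; funext j
    rw [Fintype.sum_option]
    congr 1
    rw [← Finset.sum_coe_sort P]
  rw [← Finset.sum_coe_sort P, hD2]
  simp_rw [hD1]
  rw [add_comm, ← Fintype.sum_option (fun a : Option P => Ψ (fun j => ∑ s, c a j s))]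
  have hexp : ∀ a, Ψ (fun j => ∑ s, c a j s) = ∑ r : ι → Option P, Ψ (fun j => c a j (r j)) := by
    intro a
    exact MultilinearMap.map_sum Ψ.toMultilinearMap (fun j s => c a j s)
  simp_rw [hexp]
  rw [Finset.sum_comm]
  apply Finset.sum_eq_zero
  intro r _
  have hDH : ∀ a b : P, a ≠ b → D (some a) b ∈ H := by
    intro a b hab
    simp only [D, if_neg hab]
    exact hWH _ a.2 _ b.2 (fun h => hab (Subtype.ext h))
  -- non injective
  by_cases hinj : ∃ j1 j2 b, j1 ≠ j2 ∧ r j1 = some b ∧ r j2 = some b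
  · obtain ⟨j1, j2, b, hne, h1, h2⟩ := hinj
    apply Finset.sum_eq_zero
    intro a _
    exact alt_prop_zero Ψ _ hne (D a b) (m j1 b) (m j2 b) (by simp [h1, c]) (by simp [h2, c])
  push Not at hinj
  -- points not hit
  have hnot : ∀ a : P, (∀ j, r j ≠ some a) → Ψ (fun j => c (some a) j (r j)) = 0 := by
    intro a ha
    apply hH
    intro j
    rcases hr : r j with _ | b
    · exact hκ j
    · exact H.smul_mem _ (hDH a b (by rintro rfl; exact ha j hr))
  by_cases h2 : ∃ j1 j2 : ι, ∃ a1 a2 : P, j1 ≠ j2 ∧ r j1 = some a1 ∧ r j2 = some a2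
  · -- closest pair
    let S : Finset (P × P) := Finset.univ.filter fun p => p.1 ≠ p.2 ∧ (∃ j, r j = some p.1) ∧ ∃ j, r j = some p.2
    have hS : S.Nonempty := by
      obtain ⟨j1, j2, a1, a2, hne, h1, h2⟩ := h2
      refine ⟨(a1, a2), ?_⟩
      simp only [S, Finset.mem_filter, Finset.mem_univ, true_and]
      refine ⟨?_, ⟨j1, h1⟩, ⟨j2, h2⟩⟩
      rintro rfl
      exact hinj j1 j2 a1 hne h1 h2
    obtain ⟨⟨a1, a2⟩, hmem, hmin⟩ := Finset.exists_min_image S (fun p => V ((p.1:F) - p.2)) hS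
    simp only [S, Finset.mem_filter, Finset.mem_univ, true_and] at hmem hmin
    obtain ⟨hne, ⟨j1, h1⟩, ⟨j2, h2⟩⟩ := hmem
    have hjne : j1 ≠ j2 := by
      rintro rfl; rw [h1] at h2; exact hne (Option.some.inj h2)
    have hclose : ∀ a : P, a ≠ a1 → a ≠ a2 → (∃ j, r j = some a) → W (a - a1) = W ((a:F) - a2) := by
      intro a ha1 ha2 hj
      apply hVW
      have m1 := hmin (a, a1) ⟨ha1, hj, ⟨j1, h1⟩⟩
      have m2 := hmin (a, a2) ⟨ha2, hj, ⟨j2, h2⟩⟩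
      simp only at m1 m2
      apply le_antisymm
      · have : (a:F) - a1 = (a - a2) - (a1 - a2) := by ring
        rw [this]
        exact (V.map_sub _ _).trans (max_le le_rfl m2)
      · have : (a:F) - a2 = (a - a1) + (a1 - a2) := by ring
        rw [this]
        exact (V.map_add _ _).trans (max_le le_rfl m1)
    have hWs : ∀ a b : P, W ((a:F) - b) = W ((b:F) - a) := fun a b => hVW _ _ (V.map_sub_swap _ _)
    rw [Fintype.sum_option]
    have hnone : Ψ (fun j => c none j (r j)) = 0 :=
      alt_prop_zero Ψ _ hjne (-δ) (m j1 a1) (m j2 a2) (by simp [h1, c, D]) (by simp [h2, c, D])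
    rw [hnone, zero_add]
    rw [← Finset.sum_subset (Finset.subset_univ ({a1, a2} : Finset P)), Finset.sum_pair hne]
    · -- swap
      have key : (fun j => c (some a1) j (r j)) =
          Function.update (Function.update (fun j => c (some a1) j (r j)) j1 (m j1 a1 • δ)) j2 (m j2 a2 • W ((a1:F) - a2)) := by
        funext j
        by_cases e2 : j = j2
        · subst e2; simp [h2, c, D, hne]
        · by_cases e1 : j = j1
          · subst e1; simp [h1, c, D, e2]
          · simp [e1, e2]
      have key2 : (fun j => c (some a2) j (r j)) =
          Function.update (Function.update (fun j => c (some a1) j (r j)) j1 (m j1 a1 • W ((a1:F) - a2))) j2 (m j2 a2 • δ) := by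
        funext j
        by_cases e2 : j = j2
        · subst e2; simp [h2, c, D]
        · by_cases e1 : j = j1
          · subst e1; simp only [h1, c, D, if_neg hne.symm]; simp [e2, hWs a2 a1]
          · simp only [e1, e2, ne_eq, not_false_eq_true, Function.update_of_ne]
            rcases hr : r j with _ | b
            · rfl
            · have b1 : b ≠ a1 := by rintro rfl; exact hinj j j1 b e1 hr h1
              have b2 : b ≠ a2 := by rintro rfl; exact hinj j j2 b e2 hr h2
              simp only [c, D, if_neg b1.symm, if_neg b2.symm]
              rw [hWs a2 b, hWs a1 b, hclose b b1 b2 ⟨j, hr⟩]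
      rw [key, key2]
      set g := (fun j => c (some a1) j (r j))
      rw [Ψ.map_update_smul, Function.update_comm hjne, Ψ.map_update_smul]
      rw [Ψ.map_update_smul, Function.update_comm hjne, Ψ.map_update_smul]
      have hsw := Ψ.map_swap (Function.update (Function.update g j2 (W ((a1:F) - a2))) j1 δ) hjne
      have : (Function.update (Function.update g j2 (W ((a1:F) - a2))) j1 δ) ∘ (Equiv.swap j1 j2)
          = (Function.update (Function.update g j2 δ) j1 (W ((a1:F) - a2))) := by
        funext j
        by_cases e2 : j = j2
        · subst e2; simp [hjne.symm]
        · by_cases e1 : j = j1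
          · subst e1; simp [hjne.symm]
          · simp [Equiv.swap_apply_of_ne_of_ne e1 e2, e1, e2]
      rw [this] at hsw
      rw [hsw]
      simp only [smul_eq_mul]; ring
    · intro a _ ha
      simp only [Finset.mem_insert, Finset.mem_singleton, not_or] at ha
      by_cases hj : ∃ j, r j = some a
      · have := hclose a ha.1 ha.2 hj
        refine alt_prop_zero Ψ _ hjne (W ((a:F) - a1)) (m j1 a1) (m j2 a2) ?_ ?_
        · simp [h1, c, D, ha.1]
        · simp [h2, c, D, ha.2, this]
      · push Not at hj
        exact hnot a hj
  · push Not at h2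
    by_cases h1 : ∃ j1 a1, r j1 = some a1
    · obtain ⟨j1, a1, h1⟩ := h1
      have hoth : ∀ j, j ≠ j1 → r j = none := by
        intro j hj
        rcases hr : r j with _ | b
        · rfl
        · exact absurd hr (fun h => h2 j1 j a1 b hj.symm h1 h)
      rw [Fintype.sum_option]
      rw [Finset.sum_eq_single a1]
      · have k1 : (fun j => c none j (r j)) = Function.update κ j1 (m j1 a1 • (-δ)) := by
          funext j
          by_cases e : j = j1
          · subst e; simp [h1, c, D]
          · simp [e, hoth j e, c]
        have k2 : (fun j => c (some a1) j (r j)) = Function.update κ j1 (m j1 a1 • δ) := by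
          funext j
          by_cases e : j = j1
          · subst e; simp [h1, c, D]
          · simp [e, hoth j e, c]
        rw [k1, k2, Ψ.map_update_smul, Ψ.map_update_smul, Ψ.map_update_neg]
        simp
      · intro a _ ha
        apply hnot
        intro j hj
        by_cases e : j = j1
        · subst e; rw [h1] at hj; exact ha (Option.some.inj hj).symm
        · rw [hoth j e] at hj; cases hj
      · simp
    · push Not at h1
      apply Finset.sum_eq_zero
      intro a _
      apply hH
      intro j
      rcases hr : r j with _ | b
      · exact hκ j
      · exact absurd hr (h1 j b)

end Recip
end PartR

section PartNP
section NP
open Finset Polynomial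

/-- A function has eventually zero sums. -/
def EvZero {I : Type*} (f : I → ℚ) : Prop := ∃ P0 : Finset I, ∀ P : Finset I, P0 ⊆ P → ∑ s ∈ P, f s = 0

lemma EvZero.add {I : Type*} {f g : I → ℚ} (hf : EvZero f) (hg : EvZero g) :
    EvZero (fun s => f s + g s) := by
  classical
  obtain ⟨P, hP⟩ := hf
  obtain ⟨R, hR⟩ := hg
  refine ⟨P ∪ R, fun S hS => ?_⟩
  rw [Finset.sum_add_distrib, hP S (Finset.union_subset_left hS), hR S (Finset.union_subset_right hS), add_zero]

lemma EvZero.smul {I : Type*} {f : I → ℚ} (hf : EvZero f) (c : ℚ) : EvZero (fun s => c * f s) := by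
  obtain ⟨P, hP⟩ := hf
  refine ⟨P, fun S hS => ?_⟩
  rw [← Finset.mul_sum, hP S hS, mul_zero]

lemma EvZero.zero {I : Type*} : EvZero (fun _ : I => (0:ℚ)) := ⟨∅, fun S _ => by simp⟩

lemma EvZero.sum {I J : Type*} (s : Finset J) (f : J → I → ℚ) (hf : ∀ j ∈ s, EvZero (f j)) :
    EvZero (fun x => ∑ j ∈ s, f j x) := by
  classical
  induction s using Finset.induction_on with
  | empty => simpa using EvZero.zero
  | insert a s ha ih =>
    simp_rw [Finset.sum_insert ha]
    exact (hf a (by simp)).add (ih (fun j hj => hf j (by simp [hj])))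

/-- rows: `none ↦ h`, `some j ↦ x j` -/
def vecO {ρ M : Type*} (h : M) (x : ρ → M) : Option ρ → M := fun o => o.elim h x

structure NPData (K₀ Ω I ρ M Γ : Type*) [Field K₀] [Field Ω] [AddCommGroup M] [Module ℚ M]
    [LinearOrderedCommGroupWithZero Γ] where
  Ψ : M [⋀^(Option ρ)]→ₗ[ℚ] ℚ
  H : Submodule ℚ M
  hH : ∀ x : Option ρ → M, (∀ i, x i ∈ H) → Ψ x = 0
  δ : M
  V : Valuation Ω Γ
  W : Ω → M
  W_mul : ∀ a b, a ≠ 0 → b ≠ 0 → W (a * b) = W a + W b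
  W_mem : ∀ a, W a ∈ H
  VW : ∀ a b, V a = V b → W a = W b
  σ : I → K₀ →+* Ω
  h : I → M
  h_mem : ∀ s, h s ∈ H

variable {K₀ Ω I ρ M Γ : Type*} [Field K₀] [Field Ω] [AddCommGroup M] [Module ℚ M]
    [LinearOrderedCommGroupWithZero Γ] [DecidableEq ρ]

lemma W_prod_aux (W : Ω → M) (W_mul : ∀ a b, a ≠ 0 → b ≠ 0 → W (a * b) = W a + W b) (s : Multiset Ω)
    (c : Ω) (hc : c ≠ 0) (hs : ∀ a ∈ s, a ≠ 0) : W (c * s.prod) = W c + (s.map W).sum := by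
  induction s using Multiset.induction_on with
  | empty => simp
  | cons a s ih =>
    have h1 : s.prod ≠ 0 := Multiset.prod_ne_zero (fun h0 => hs 0 (by simp [h0]) rfl)
    have := ih (fun b hb => hs b (by simp [hb]))
    have ha := hs a (by simp)
    rw [Multiset.prod_cons, Multiset.map_cons, Multiset.sum_cons, show c * (a * s.prod) = a * (c * s.prod) by ring,
      W_mul _ _ ha (mul_ne_zero hc h1), this]
    abel

lemma W_eval [DecidableEq Ω] (W : Ω → M) (W_mul : ∀ a b, a ≠ 0 → b ≠ 0 → W (a * b) = W a + W b) (p : Polynomial Ω)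
    [IsAlgClosed Ω] (hp : p ≠ 0) (a : Ω) (ha : p.eval a ≠ 0) (P : Finset Ω) (hP : p.roots.toFinset ⊆ P) :
    W (p.eval a) = W p.leadingCoeff + ∑ b ∈ P.erase a, (p.rootMultiplicity b : ℚ) • W (a - b) := by
  have h0 := (IsAlgClosed.splits p).eval_eq_prod_roots a
  rw [h0, W_prod_aux W W_mul]
  · rw [Multiset.map_map, Finset.sum_multiset_map_count]
    congr 1
    have hsub : p.roots.toFinset ⊆ P.erase a := by
      intro x hx
      rw [Finset.mem_erase]
      refine ⟨?_, hP hx⟩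
      rintro rfl
      simp at hx
      exact ha hx.2
    rw [← Finset.sum_subset hsub]
    · apply Finset.sum_congr rfl
      intro x _
      simp [Nat.cast_smul_eq_nsmul]
    · intro x _ hx
      rw [Multiset.mem_toFinset, ← Multiset.count_eq_zero, count_roots] at hx
      simp [hx]
  · simpa using hp
  · intro b hb
    simp only [Multiset.mem_map] at hb
    obtain ⟨x, hx, rfl⟩ := hb
    intro h1
    rw [sub_eq_zero] at h1
    subst h1
    simp at hx
    exact ha hx.2

namespace NPData

variable (D : NPData K₀ Ω I ρ M Γ)

/-- the term at a root -/
noncomputable def term (i : ρ) (G : ρ → K₀[X]) (s : I) (r : Ω) : ℚ :=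
  D.Ψ (vecO (D.h s) (Function.update (fun j => D.W (((G j).map (D.σ s)).eval r)) i D.δ))

noncomputable def T (i : ρ) (G : ρ → K₀[X]) (s : I) : ℚ :=
  (((G i).map (D.σ s)).roots.map (fun r => D.term i G s r)).sum

noncomputable def base (i : ρ) (b : ρ → K₀) (s : I) : ℚ :=
  D.Ψ (vecO (D.h s) (Function.update (fun j => D.W (D.σ s (b j))) i D.δ))

lemma eval_ne {f g : K₀[X]} (h : IsCoprime f g) (s : I) (r : Ω)
    (hr : r ∈ (f.map (D.σ s)).roots) : (g.map (D.σ s)).eval r ≠ 0 := by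
  intro h0
  obtain ⟨u, v, huv⟩ := h
  have := congrArg (fun p => (p.map (D.σ s)).eval r) huv
  simp only [Polynomial.map_add, Polynomial.map_mul, eval_add, eval_mul, h0] at this
  have h1 : (f.map (D.σ s)).eval r = 0 := by
    rw [mem_roots'] at hr; exact hr.2
  simp [h1] at this

lemma T_congr (i : ρ) (G G' : ρ → K₀[X]) (s : I) (hi : G i = G' i)
    (h : ∀ j, G i ∣ G j - G' j) : D.T i G s = D.T i G' s := by
  unfold T
  rw [← hi]
  congr 1
  apply Multiset.map_congr rfl
  intro r hr
  have h1 : ((G i).map (D.σ s)).eval r = 0 := by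
    rw [mem_roots'] at hr; exact hr.2
  unfold term
  congr 4
  funext j
  obtain ⟨q, hq⟩ := h j
  have : G j = G' j + G i * q := by rw [← hq]; ring
  rw [this]
  simp [h1]

lemma T_mul (i j : ρ) (hij : j ≠ i) (G : ρ → K₀[X]) (a b : K₀[X]) (s : I)
    (ha : IsCoprime (G i) a) (hb : IsCoprime (G i) b) :
    D.T i (Function.update G j (a * b)) s =
      D.T i (Function.update G j a) s + D.T i (Function.update G j b) s := by
  unfold T
  simp only [Function.update_of_ne hij.symm]
  rw [← Multiset.sum_map_add]
  congr 1
  apply Multiset.map_congr rfl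
  intro r hr
  have key : ∀ c : K₀[X], D.term i (Function.update G j c) s r =
      D.Ψ (Function.update (vecO (D.h s) (Function.update (fun j => D.W (((G j).map (D.σ s)).eval r)) i D.δ))
        (some j) (D.W ((c.map (D.σ s)).eval r))) := by
    intro c
    unfold term
    congr 1
    funext o
    rcases o with _ | l
    · simp [vecO]
    · by_cases h1 : l = j
      · subst h1; simp [vecO, hij]
      · by_cases h2 : l = i
        · subst h2; simp [vecO, h1]
        · simp [vecO, h1, h2]
  rw [key, key, key, Polynomial.map_mul, eval_mul, D.W_mul _ _ (D.eval_ne ha s r hr) (D.eval_ne hb s r hr),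
    D.Ψ.map_update_add]

lemma T_alt (i j k : ρ) (hij : j ≠ i) (hik : k ≠ i) (hjk : j ≠ k) (G : ρ → K₀[X]) (s : I)
    (h : G j = G k) : D.T i G s = 0 := by
  unfold T
  apply Multiset.sum_eq_zero
  intro x hx
  rw [Multiset.mem_map] at hx
  obtain ⟨r, -, rfl⟩ := hx
  unfold term
  apply D.Ψ.map_eq_zero_of_eq (i := some j) (j := some k)
  · simp [vecO, hij, hik, h]
  · simpa using hjk

variable [Fintype ρ]

lemma T_recip [IsAlgClosed Ω] (G : ρ → K₀[X]) (hG : ∀ j, G j ≠ 0)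
    (hc : ∀ i j, i ≠ j → IsCoprime (G i) (G j)) (s : I) :
    ∑ i, D.T i G s = ∑ i, ((G i).natDegree : ℚ) * D.base i (fun j => (G j).leadingCoeff) s := by
  classical
  let g : ρ → Polynomial Ω := fun j => (G j).map (D.σ s)
  have hg : ∀ j, g j ≠ 0 := fun j => (Polynomial.map_ne_zero_iff (D.σ s).injective).2 (hG j)
  let P : Finset Ω := Finset.univ.biUnion fun j => (g j).roots.toFinset
  have hP : ∀ j, (g j).roots.toFinset ⊆ P := fun j => Finset.subset_biUnion_of_mem (fun j => (g j).roots.toFinset) (Finset.mem_univ j)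
  let κ : Option ρ → M := vecO (D.h s) (fun j => D.W (D.σ s (G j).leadingCoeff))
  let m : Option ρ → Ω → ℚ := fun o b => o.elim 0 (fun j => ((g j).rootMultiplicity b : ℚ))
  have hκ : ∀ o, κ o ∈ D.H := by
    rintro (_ | j)
    · exact D.h_mem s
    · exact D.W_mem _
  have R := reciprocity D.Ψ D.H D.hH D.δ κ hκ D.V D.W P (fun a _ b _ _ => D.W_mem _) D.VW m
  have e1 : ∀ a ∈ P, D.Ψ (fun j => κ j + ∑ b ∈ P, m j b • (if a = b then D.δ else D.W (a - b))) =
      ∑ i, ((g i).rootMultiplicity a : ℚ) * D.term i G s a := by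
    intro a ha
    have : (fun j => κ j + ∑ b ∈ P, m j b • (if a = b then D.δ else D.W (a - b))) =
      (fun j => (κ j + ∑ b ∈ P.erase a, m j b • D.W (a - b)) + m j a • D.δ) := by
      funext j
      rw [← Finset.add_sum_erase _ _ ha]
      simp only [if_true]
      rw [Finset.sum_congr rfl (g := fun b => m j b • D.W (a - b))]
      · abel
      · intro b hb
        rw [if_neg (Finset.ne_of_mem_erase hb).symm]
    rw [this, alt_expand D.Ψ D.H D.hH, Fintype.sum_option]
    · simp only [m, Option.elim_none, zero_mul, zero_add, Option.elim_some]
      apply Finset.sum_congr rfl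
      intro i _
      by_cases hi : (g i).rootMultiplicity a = 0
      · simp [hi]
      congr 1
      have hroot : a ∈ (g i).roots := by
        rw [← count_roots] at hi
        exact Multiset.count_ne_zero.1 hi
      unfold term
      congr 1
      funext o
      rcases o with _ | l
      · simp [vecO, κ]
      · by_cases h1 : l = i
        · subst h1; simp [vecO]
        · have h2 := D.eval_ne (hc i l (Ne.symm h1)) s a hroot
          have h3 := W_eval D.W D.W_mul (g l) (hg l) a h2 P (hP l)
          simp [vecO, h1, κ]
          simp only [g] at h3
          rw [h3]; simp [g]
    · intro o
      exact D.H.add_mem (hκ o) (D.H.sum_mem fun b _ => D.H.smul_mem _ (D.W_mem _))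
  rw [Finset.sum_congr rfl e1, Finset.sum_comm] at R
  have e2 : ∀ i, ∑ a ∈ P, ((g i).rootMultiplicity a : ℚ) * D.term i G s a = D.T i G s := by
    intro i
    unfold T
    rw [Finset.sum_multiset_map_count]
    rw [← Finset.sum_subset (hP i)]
    · apply Finset.sum_congr rfl
      intro a _
      simp [g]
    · intro x _ hx
      rw [Multiset.mem_toFinset, ← Multiset.count_eq_zero, count_roots] at hx
      simp [hx]
  simp_rw [e2] at R
  have e3 : D.Ψ (fun j => κ j + ∑ b ∈ P, m j b • (-D.δ)) = - ∑ i, ((G i).natDegree : ℚ) * D.base i (fun j => (G j).leadingCoeff) s := by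
    have : (fun j => κ j + ∑ b ∈ P, m j b • (-D.δ)) = fun j => κ j + (- ∑ b ∈ P, m j b) • D.δ := by
      funext j
      rw [← Finset.sum_smul]
      simp
    rw [this, alt_expand D.Ψ D.H D.hH _ _ hκ, Fintype.sum_option]
    simp only [m, Option.elim_none, Option.elim_some, Finset.sum_const_zero, neg_zero, zero_mul, zero_add]
    rw [← Finset.sum_neg_distrib]
    apply Finset.sum_congr rfl
    intro i _
    rw [neg_mul]
    congr 2
    · rw [← Polynomial.natDegree_map (D.σ s), (IsAlgClosed.splits ((G i).map (D.σ s))).natDegree_eq_card_roots,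
        ← Multiset.toFinset_sum_count_eq, Nat.cast_sum]
      symm
      rw [← Finset.sum_subset (hP i)]
      · simp [g]
      · intro x _ hx
        rw [Multiset.mem_toFinset, ← Multiset.count_eq_zero, count_roots] at hx
        simp [hx]
    · unfold base
      congr 1
      funext o
      rcases o with _ | l
      · simp [vecO, κ]
      · by_cases h1 : l = i
        · subst h1; simp [vecO]
        · simp [vecO, κ, h1]
  rw [e3] at R
  linarith

theorem main [IsAlgClosed Ω] (hbase : ∀ i (b : ρ → K₀), (∀ j, b j ≠ 0) → EvZero (D.base i b))
    (i : ρ) (G : ρ → K₀[X]) (hG : ∀ j, G j ≠ 0) (hc : ∀ j, j ≠ i → IsCoprime (G i) (G j)) :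
    EvZero (D.T i G) := by
  induction hm : (G i).natDegree using Nat.strong_induction_on generalizing i G with
  | _ m IH =>
  by_cases hm0 : (G i).natDegree = 0
  · have : D.T i G = fun _ => 0 := by
      funext s
      unfold T
      rw [eq_C_of_natDegree_eq_zero hm0]
      simp
    rw [this]; exact EvZero.zero
  -- claim for small degrees
  have claim : ∀ (n : ℕ) (G' : ρ → K₀[X]), G' i = G i → (∀ j, G' j ≠ 0) →
      (∀ j, j ≠ i → IsCoprime (G i) (G' j)) → (∀ j, j ≠ i → (G' j).natDegree < m) →
      (∑ j, (G' j).natDegree = n) → EvZero (D.T i G') := by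
    intro n
    induction n using Nat.strong_induction_on with
    | _ n ih =>
    intro G' hGi hG0 hcop hdeg hn
    by_cases hpair : ∃ j k, j ≠ i ∧ k ≠ i ∧ j ≠ k ∧ ¬ IsCoprime (G' j) (G' k)
    · obtain ⟨j, k, hji, hki, hjk, hnc⟩ := hpair
      obtain ⟨g, hgu, ⟨a, ha⟩, ⟨b, hb⟩⟩ : ∃ g, ¬ IsUnit g ∧ g ∣ G' j ∧ g ∣ G' k := by
        by_contra hcon
        push Not at hcon
        apply hnc
        apply isCoprime_of_dvd
        · intro h; exact hG0 j h.1
        · intro z hz hz0 hzj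
          exact hcon z hz hzj
      have hg0 : g ≠ 0 := by rintro rfl; exact hG0 j (by simpa using ha)
      have ha0 : a ≠ 0 := by rintro rfl; exact hG0 j (by simpa using ha)
      have hb0 : b ≠ 0 := by rintro rfl; exact hG0 k (by simpa using hb)
      have hgd : 0 < g.natDegree := by
        rw [Nat.pos_iff_ne_zero]
        intro h0
        apply hgu
        rw [eq_C_of_natDegree_eq_zero h0] at hg0 ⊢
        exact isUnit_C.2 (isUnit_iff_ne_zero.2 (by simpa using hg0))
      have dj : (G' j).natDegree = g.natDegree + a.natDegree := by rw [ha, natDegree_mul hg0 ha0]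
      have dk : (G' k).natDegree = g.natDegree + b.natDegree := by rw [hb, natDegree_mul hg0 hb0]
      have cg : IsCoprime (G i) g := (ha ▸ hcop j hji).of_mul_right_left
      have ca : IsCoprime (G i) a := (ha ▸ hcop j hji).of_mul_right_right
      have cb : IsCoprime (G i) b := (hb ▸ hcop k hki).of_mul_right_right
      -- general smaller claim
      have small : ∀ p q : K₀[X], p ≠ 0 → q ≠ 0 → IsCoprime (G i) p → IsCoprime (G i) q →
          p.natDegree ≤ (G' j).natDegree → q.natDegree ≤ (G' k).natDegree →
          p.natDegree + q.natDegree < (G' j).natDegree + (G' k).natDegree →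
          EvZero (D.T i (Function.update (Function.update G' j p) k q)) := by
        intro p q hp hq hcp hcq hdp hdq hlt
        refine ih (∑ l, (Function.update (Function.update G' j p) k q l).natDegree) ?_ _ ?_ ?_ ?_ ?_ rfl
        · rw [← hn]
          apply lt_of_lt_of_le (b := ∑ l, (G' l).natDegree) _ le_rfl
          have hk' : k ∈ Finset.univ.erase j := by simp [hjk.symm]
          rw [← Finset.add_sum_erase _ _ (Finset.mem_univ j), ← Finset.add_sum_erase _ _ hk',
            ← Finset.add_sum_erase (Finset.univ) (fun l => (G' l).natDegree) (Finset.mem_univ j),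
            ← Finset.add_sum_erase _ (fun l => (G' l).natDegree) hk']
          have : ∑ x ∈ (Finset.univ.erase j).erase k, (Function.update (Function.update G' j p) k q x).natDegree
              = ∑ x ∈ (Finset.univ.erase j).erase k, (G' x).natDegree := by
            apply Finset.sum_congr rfl
            intro x hx
            simp at hx
            simp [hx]
          rw [this]
          simp only [Function.update_self, Function.update_of_ne hjk]
          omega
        · simp [hji.symm, hki.symm, hGi]
        · intro l
          by_cases h1 : l = k
          · subst h1; simpa
          · by_cases h2 : l = j
            · subst h2; simpa [h1]
            · simpa [h1, h2] using hG0 l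
        · intro l hl
          by_cases h1 : l = k
          · subst h1; simpa
          · by_cases h2 : l = j
            · subst h2; simpa [h1]
            · simpa [h1, h2] using hcop l hl
        · intro l hl
          by_cases h1 : l = k
          · subst h1; simpa using hdq.trans_lt (hdeg l hl)
          · by_cases h2 : l = j
            · subst h2; simpa [h1] using hdp.trans_lt (hdeg l hl)
            · simpa [h1, h2] using hdeg l hl
      have e : D.T i G' = fun s => D.T i (Function.update (Function.update G' j g) k b) s +
          (D.T i (Function.update (Function.update G' j a) k g) s +
          D.T i (Function.update (Function.update G' j a) k b) s) := by
        funext s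
        have h1 : D.T i G' s = D.T i (Function.update (Function.update G' j (g * a)) k (g * b)) s := by
          congr 1
          rw [← ha, ← hb]; simp
        rw [h1, D.T_mul i k hki]
        rotate_left
        · rw [Function.update_of_ne hji.symm, hGi]; exact cg
        · rw [Function.update_of_ne hji.symm, hGi]; exact cb
        simp_rw [Function.update_comm hjk]
        rw [D.T_mul i j hji, D.T_mul i j hji]
        rotate_left
        · rw [Function.update_of_ne hki.symm, hGi]; exact cg
        · rw [Function.update_of_ne hki.symm, hGi]; exact ca
        · rw [Function.update_of_ne hki.symm, hGi]; exact cg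
        · rw [Function.update_of_ne hki.symm, hGi]; exact ca
        rw [D.T_alt i j k hji hki hjk (Function.update (Function.update G' k g) j g) s (by simp [hjk.symm])]
        ring
      rw [e]
      refine (small g b hg0 hb0 cg cb (by omega) (by omega) (by omega)).add
        ((small a g ha0 hg0 ca cg (by omega) (by omega) (by omega)).add
        (small a b ha0 hb0 ca cb (by omega) (by omega) (by omega)))
    · push Not at hpair
      have hcop2 : ∀ j k, j ≠ k → IsCoprime (G' j) (G' k) := by
        intro j k hjk
        by_cases h1 : j = i
        · subst h1; rw [hGi]; exact hcop k hjk.symm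
        · by_cases h2 : k = i
          · subst h2; rw [hGi]; exact (hcop j h1).symm
          · exact hpair j k h1 h2 hjk
      have hr := D.T_recip G' hG0 hcop2
      have e : D.T i G' = fun s => (∑ l, ((G' l).natDegree : ℚ) * D.base l (fun j => (G' j).leadingCoeff) s) +
          (-1) * ∑ l ∈ Finset.univ.erase i, D.T l G' s := by
        funext s
        rw [← hr s, ← Finset.add_sum_erase _ _ (Finset.mem_univ i)]
        ring
      rw [e]
      refine (EvZero.sum _ _ fun l _ => (hbase l _ ?_).smul _).add ((EvZero.sum _ _ fun l hl => ?_).smul _)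
      · intro j; simpa using hG0 j
      · have hl' := Finset.ne_of_mem_erase hl
        exact IH _ (hdeg l hl') l G' hG0 (fun j hj => hcop2 l j hj.symm) rfl
  -- reduce
  let G' : ρ → K₀[X] := fun j => if j = i then G i else G j % G i
  have hGi0 := hG i
  have hcop' : ∀ j, j ≠ i → IsCoprime (G i) (G' j) := by
    intro j hj
    simp only [G', if_neg hj]
    have h1 := hc j hj
    rw [← EuclideanDomain.mod_add_div (G j) (G i)] at h1
    exact IsCoprime.of_add_mul_left_right h1
  have hne : ∀ j, G' j ≠ 0 := by
    intro j
    by_cases hj : j = i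
    · subst hj; simpa [G'] using hGi0
    · intro h0
      have := hcop' j hj
      rw [h0, isCoprime_zero_right] at this
      exact hm0 (natDegree_eq_zero_of_isUnit this)
  have e : D.T i G = D.T i G' := by
    funext s
    apply T_congr
    · simp [G']
    · intro j
      by_cases hj : j = i
      · subst hj; simp [G']
      · simp only [G', if_neg hj]
        rw [EuclideanDomain.mod_eq_sub_mul_div]; simp
  rw [e]
  refine claim _ G' (by simp [G']) hne hcop' ?_ rfl
  intro j hj
  rw [← hm]
  simp only [G', if_neg hj]
  exact natDegree_mod_lt _ hm0

end NPData
end NP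
end PartNP

section PartVal
section ValPart
open Polynomial

/-- Chevalley's extension theorem. -/
lemma chevalley {R L : Type*} [CommRing R] [Field L] (f : R →+* L) (I : Ideal R) (hI : I ≠ ⊤)
    (hf : RingHom.ker f ≤ I) :
    ∃ B : ValuationSubring L, (∀ r, f r ∈ B) ∧ ∀ r ∈ I, B.valuation (f r) < 1 := by
  have hne : I.map f.rangeRestrict ≠ ⊤ := by
    intro h
    apply hI
    have h1 := Ideal.comap_map_of_surjective f.rangeRestrict f.rangeRestrict_surjective I
    rw [h, Ideal.comap_top] at h1
    have h2 : Ideal.comap f.rangeRestrict ⊥ ≤ I := by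
      intro x hx
      apply hf
      rw [Ideal.mem_comap, Ideal.mem_bot] at hx
      rw [RingHom.mem_ker]
      exact congrArg Subtype.val hx
    rw [h1]
    exact (sup_eq_left.2 h2).symm
  obtain ⟨B, hB1, hB2⟩ := Ideal.image_subset_nonunits_valuationSubring (A := f.range) _ hne
  refine ⟨B, fun r => hB1 ⟨r, rfl⟩, fun r hr => ?_⟩
  rw [← ValuationSubring.mem_nonunits_iff]
  exact hB2 ⟨f.rangeRestrict r, Ideal.mem_map_of_mem _ hr, rfl⟩

lemma val_step {F L : Type*} [Field F] [Field L] [Algebra F L] (O : ValuationSubring F) (y : L)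
    (hy : Transcendental F y) :
    ∃ B : ValuationSubring L, (∀ x ∈ O, algebraMap F L x ∈ B) ∧
      (∀ x, O.valuation x < 1 → B.valuation (algebraMap F L x) < 1) ∧
      ∀ a : F, B.valuation (algebraMap F L a * y) < 1 := by
  let R : Subring F[X] := O.toSubring.comap (constantCoeff : F[X] →+* F)
  let g : R →+* O := (constantCoeff.comp R.subtype).codRestrict O.toSubring (fun r => r.2)
  let f : R →+* L := (aeval y : F[X] →ₐ[F] L).toRingHom.comp R.subtype
  have hfinj : Function.Injective f := by
    intro a b hab
    apply Subtype.ext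
    exact (transcendental_iff_injective.1 hy) hab
  obtain ⟨B, hB1, hB2⟩ := chevalley f ((IsLocalRing.maximalIdeal O).comap g)
    (Ideal.comap_ne_top _ (IsLocalRing.maximalIdeal.isMaximal O).ne_top)
    (by rw [(RingHom.injective_iff_ker_eq_bot f).1 hfinj]; exact bot_le)
  refine ⟨B, ?_, ?_, ?_⟩
  · intro x hx
    have := hB1 ⟨C x, by simpa [R, Subring.mem_comap] using hx⟩
    simpa [f] using this
  · intro x hx
    have hx' : x ∈ O := (O.valuation_le_one_iff x).1 hx.le
    have := hB2 ⟨C x, by simpa [R, Subring.mem_comap] using hx'⟩ (by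
      rw [Ideal.mem_comap, ValuationSubring.valuation_lt_one_iff]
      change O.valuation (constantCoeff (C x)) < 1
      simpa using hx)
    simpa [f] using this
  · intro a
    have := hB2 ⟨C a * X, by simp [R, Subring.mem_comap, O.zero_mem]⟩ (by
      rw [Ideal.mem_comap, ValuationSubring.valuation_lt_one_iff]
      change O.valuation (constantCoeff (C a * X)) < 1
      simp)
    simpa [f] using this

/-- values are unchanged on the base -/
lemma val_base {F L : Type*} [Field F] [Field L] [Algebra F L] (O : ValuationSubring F)
    (B : ValuationSubring L) (h1 : ∀ x ∈ O, algebraMap F L x ∈ B)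
    (h2 : ∀ x, O.valuation x < 1 → B.valuation (algebraMap F L x) < 1) (x : F) :
    B.valuation (algebraMap F L x) = 1 ↔ O.valuation x = 1 := by
  constructor
  · intro h
    rcases lt_trichotomy (O.valuation x) 1 with h3 | h3 | h3
    · exact absurd h (h2 x h3).ne
    · exact h3
    · have h4 : O.valuation x⁻¹ < 1 := by rw [map_inv₀]; exact inv_lt_one_of_one_lt₀ h3
      have := h2 _ h4
      rw [map_inv₀, map_inv₀, h] at this
      simp at this
  · intro h
    have hx0 : x ≠ 0 := by rintro rfl; simp at h
    have a1 : B.valuation (algebraMap F L x) ≤ 1 :=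
      (B.valuation_le_one_iff _).2 (h1 x ((O.valuation_le_one_iff _).1 h.le))
    have a2 : B.valuation (algebraMap F L x⁻¹) ≤ 1 :=
      (B.valuation_le_one_iff _).2 (h1 _ ((O.valuation_le_one_iff _).1 (by simp [h])))
    rw [map_inv₀, map_inv₀] at a2
    apply le_antisymm a1
    have h0 : B.valuation (algebraMap F L x) ≠ 0 := by simpa using hx0
    exact (inv_le_one₀ (zero_lt_iff.2 h0)).1 a2

open IntermediateField in
lemma val_indep {κ L : Type*} [Field κ] [Field L] [Algebra κ L] (n : ℕ) (Y : Fin n → L)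
    (hY : AlgebraicIndependent κ Y) :
    ∃ B : ValuationSubring L, (∀ c : κ, algebraMap κ L c ∈ B) ∧
      ∀ v : Fin n → ℤ, B.valuation (∏ i, Y i ^ v i) = 1 → v = 0 := by
  induction n with
  | zero => exact ⟨⊤, fun c => ValuationSubring.mem_top _, fun v _ => Subsingleton.elim _ _⟩
  | succ n ih =>
    obtain ⟨A, hA1, hA2⟩ := ih (fun i => Y i.castSucc) (hY.comp _ (Fin.castSucc_injective n))
    let F : IntermediateField κ L := IntermediateField.adjoin κ (Set.range fun i : Fin n => Y i.castSucc)
    have hy : Transcendental F (Y (Fin.last n)) := by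
      have := hY.transcendental_adjoin (s := Set.range Fin.castSucc) (i := Fin.last n) (by simp)
      rw [← Set.range_comp] at this
      intro h
      exact this (IntermediateField.isAlgebraic_adjoin_iff.1 h)
    let O : ValuationSubring F := A.comap (algebraMap F L)
    have hOv : ∀ x : F, O.valuation x = 1 → A.valuation (x : L) = 1 := by
      intro x hx
      have hx0 : x ≠ 0 := by rintro rfl; simp at hx
      have a1 : x ∈ O := (O.valuation_le_one_iff _).1 hx.le
      have a2 : x⁻¹ ∈ O := (O.valuation_le_one_iff _).1 (by simp [hx])
      have b1 : A.valuation (x : L) ≤ 1 := (A.valuation_le_one_iff _).2 a1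
      have b2 : A.valuation ((x⁻¹ : F) : L) ≤ 1 := (A.valuation_le_one_iff _).2 a2
      apply le_antisymm b1
      simp only [IntermediateField.coe_inv, map_inv₀] at b2
      exact (inv_le_one₀ (zero_lt_iff.2 (by simpa using hx0))).1 b2
    obtain ⟨B, hB1, hB2, hB3⟩ := val_step O (Y (Fin.last n)) hy
    refine ⟨B, ?_, ?_⟩
    · intro c
      have := hB1 (algebraMap κ F c) (hA1 c)
      exact this
    · intro v hv
      have hYF : ∀ i : Fin n, Y i.castSucc ∈ F := fun i => IntermediateField.subset_adjoin _ _ ⟨i, rfl⟩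
      let f : F := ∏ i : Fin n, (⟨Y i.castSucc, hYF i⟩ : F) ^ v i.castSucc
      have hf : (f : L) = ∏ i : Fin n, Y i.castSucc ^ v i.castSucc := by
        change algebraMap F L f = _
        simp only [f, map_prod, map_zpow₀]
        rfl
      rw [Fin.prod_univ_castSucc, ← hf] at hv
      have hmul : ∀ (m : ℕ) (a : F), B.valuation (algebraMap F L a * Y (Fin.last n) ^ (m+1)) < 1 := by
        intro m
        induction m with
        | zero => intro a; simpa using hB3 a
        | succ m ihm =>
          intro a
          have h1 := ihm a
          have h2 := hB3 1
          rw [pow_succ, ← mul_assoc, map_mul]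
          rw [map_one, one_mul] at h2
          exact mul_lt_one_of_nonneg_of_lt_one_left zero_le h1 h2.le
      have hlast : v (Fin.last n) = 0 := by
        rcases lt_trichotomy (v (Fin.last n)) 0 with h | h | h
        · obtain ⟨m, hm⟩ : ∃ m : ℕ, v (Fin.last n) = -((m:ℤ)+1) := ⟨(-v (Fin.last n) - 1).toNat, by omega⟩
          have := hmul m f⁻¹
          have h3 : (algebraMap F L f⁻¹ * Y (Fin.last n) ^ (m+1)) = ((f : L) * Y (Fin.last n) ^ v (Fin.last n))⁻¹ := by
            rw [hm, mul_inv, zpow_neg, inv_inv]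
            rw [map_inv₀, ← Nat.cast_succ, zpow_natCast]
            rfl
          rw [h3, map_inv₀, hv] at this
          simp at this
        · exact h
        · obtain ⟨m, hm⟩ : ∃ m : ℕ, v (Fin.last n) = ((m:ℤ)+1) := ⟨(v (Fin.last n) - 1).toNat, by omega⟩
          have := hmul m f
          have h3 : (algebraMap F L f * Y (Fin.last n) ^ (m+1)) = ((f : L) * Y (Fin.last n) ^ v (Fin.last n)) := by
            rw [hm, ← Nat.cast_succ, zpow_natCast]; rfl
          rw [h3, hv] at this
          simp at this
      rw [hlast, zpow_zero, mul_one] at hv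
      have h5 := hOv f ((val_base O B hB1 hB2 f).1 hv)
      rw [hf] at h5
      have h6 := hA2 (fun i => v i.castSucc) h5
      funext i
      refine Fin.lastCases ?_ (fun i => ?_) i
      · exact hlast
      · exact congrFun h6 i

end ValPart
end PartVal

section PartVW
section VWPart
open Polynomial

lemma val_sum_zero {ι L Γ : Type*} [Field L] [LinearOrderedCommGroupWithZero Γ] (V : Valuation L Γ)
    (s : Finset ι) (f : ι → L) (hs : ∑ i ∈ s, f i = 0) (i : ι) (hi : i ∈ s) (hfi : f i ≠ 0) :
    ∃ a ∈ s, ∃ b ∈ s, a ≠ b ∧ f a ≠ 0 ∧ V (f a) = V (f b) ∧ ∀ c ∈ s, V (f c) ≤ V (f a) := by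
  classical
  obtain ⟨a, ha, hmax⟩ := Finset.exists_max_image s (fun i => V (f i)) ⟨i, hi⟩
  have hfa : f a ≠ 0 := by
    intro h
    have := hmax i hi
    rw [h, map_zero] at this
    exact hfi (V.zero_iff.1 (le_antisymm this zero_le))
  by_contra hcon
  push Not at hcon
  have h1 : ∀ b ∈ s.erase a, V (f b) < V (f a) := by
    intro b hb
    rw [Finset.mem_erase] at hb
    refine lt_of_le_of_ne (hmax b hb.2) (fun h => ?_)
    obtain ⟨c, hc, hc2⟩ := hcon a ha b hb.2 hb.1.symm hfa h.symm
    exact absurd (hmax c hc) (not_le.2 hc2)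
  have h2 := V.map_sum_lt (V.ne_zero_iff.2 hfa) h1
  rw [← Finset.add_sum_erase _ _ ha] at hs
  rw [eq_neg_of_add_eq_zero_right hs, V.map_neg] at h2
  exact lt_irrefl _ h2

lemma hom_extend {ι G : Type*} [AddCommGroup G] (g : ι → G) (hg : LinearIndependent ℤ g) (c : ι → ℚ) :
    ∃ φ : G →+ ℚ, ∀ i, φ (g i) = c i := by
  have hB : Module.Baer ℤ (ULift.{0} ℚ) := Module.Baer.of_divisible _
  obtain ⟨h, hh⟩ := Module.Baer.extension_property hB (Finsupp.linearCombination ℤ g) hg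
    (Finsupp.linearCombination ℤ (fun i => ULift.up (c i)))
  refine ⟨(AddEquiv.ulift.toAddMonoidHom).comp h.toAddMonoidHom, fun i => ?_⟩
  have := congrArg (fun f => f (Finsupp.single i 1)) hh
  simp at this
  simp [this]
  rfl

/-- valuations of elements algebraic over `Ω(ε)` -/
lemma val_alg {Ω L : Type*} [Field Ω] [Field L] [Algebra Ω L] {Γ : Type*} [LinearOrderedCommGroupWithZero Γ]
    (V : Valuation L Γ) (ε : L) (hε0 : ε ≠ 0)
    (hε : ∀ a : Ω, V (algebraMap Ω L a * ε) < 1) (halg : ∀ x : L, IsAlgebraic (IntermediateField.adjoin Ω {ε}) x)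
    (x : L) (hx : x ≠ 0) :
    ∃ (n : ℕ) (m : ℤ) (a : Ω), 0 < n ∧ a ≠ 0 ∧ V x ^ n = V ε ^ m * V (algebraMap Ω L a) := by
  have hVε : V ε ≠ 0 := V.ne_zero_iff.2 hε0
  have hVa : ∀ a : Ω, a ≠ 0 → V (algebraMap Ω L a) ≠ 0 := fun a ha => V.ne_zero_iff.2 (by simpa using ha)
  have hε1 : V ε < 1 := by simpa using hε 1
  have hlt : ∀ a b : Ω, a ≠ 0 → V (algebraMap Ω L b * ε) < V (algebraMap Ω L a) := by
    intro a b ha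
    have := hε (a⁻¹ * b)
    rw [map_mul (algebraMap Ω L), map_inv₀, mul_assoc, map_mul, map_inv₀] at this
    rwa [inv_mul_lt_iff₀ (zero_lt_iff.2 (hVa a ha)), mul_one] at this
  have hpow : ∀ (k : ℕ) (a b : Ω), a ≠ 0 → V (algebraMap Ω L b * ε ^ (k+1)) < V (algebraMap Ω L a) := by
    intro k
    induction k with
    | zero => intro a b ha; simpa using hlt a b ha
    | succ k ih =>
      intro a b ha
      rw [pow_succ, ← mul_assoc, map_mul]
      calc _ ≤ V (algebraMap Ω L b * ε ^ (k + 1)) * 1 := by gcongr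
        _ < _ := by rw [mul_one]; exact ih a b ha
  have hpoly : ∀ p : Polynomial Ω, p ≠ 0 → ∃ (m : ℕ) (a : Ω), a ≠ 0 ∧ V (aeval ε p) = V ε ^ m * V (algebraMap Ω L a) := by
    intro p hp
    obtain ⟨q, hq, hq0⟩ := Polynomial.exists_eq_pow_rootMultiplicity_mul_and_not_dvd p hp 0
    refine ⟨p.rootMultiplicity 0, q.coeff 0, ?_, ?_⟩
    · rw [C_0, sub_zero, X_dvd_iff] at hq0; exact hq0
    rw [C_0, sub_zero] at hq hq0
    rw [X_dvd_iff] at hq0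
    have hq2 : aeval ε p = ε ^ p.rootMultiplicity 0 * aeval ε q := by
      conv_lhs => rw [hq]
      simp only [map_mul, map_pow, aeval_X]
    rw [hq2, map_mul, map_pow]
    congr 1
    rw [aeval_eq_sum_range, Finset.sum_range_succ']
    rw [add_comm]
    simp only [pow_zero, Algebra.smul_def, mul_one]
    apply Valuation.map_add_eq_of_lt_left
    apply V.map_sum_lt (hVa _ hq0)
    intro i _
    exact hpow i _ _ hq0
  have hfrac : ∀ z ∈ IntermediateField.adjoin Ω {ε}, z ≠ 0 →
      ∃ (m : ℤ) (a : Ω), a ≠ 0 ∧ V z = V ε ^ m * V (algebraMap Ω L a) := by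
    intro z hz hz0
    rw [IntermediateField.mem_adjoin_simple_iff] at hz
    obtain ⟨r, s, rfl⟩ := hz
    have hr : r ≠ 0 := by rintro rfl; simp at hz0
    have hs : s ≠ 0 := by rintro rfl; simp at hz0
    obtain ⟨m, a, ha, h1⟩ := hpoly r hr
    obtain ⟨m', a', ha', h2⟩ := hpoly s hs
    refine ⟨(m:ℤ) - m', a / a', div_ne_zero ha ha', ?_⟩
    rw [map_div₀, h1, h2, zpow_sub₀ hVε, zpow_natCast, zpow_natCast, map_div₀, map_div₀]
    field_simp
  obtain ⟨p, hp, hpx⟩ := halg x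
  rw [aeval_eq_sum_range] at hpx
  have hterm : ∀ i, p.coeff i • x ^ i = (p.coeff i : L) * x ^ i := fun i => rfl
  simp_rw [hterm] at hpx
  obtain ⟨i, hi, j, hj, hij, h0, heq, -⟩ := val_sum_zero V _ _ hpx p.natDegree (by simp) (by
    refine mul_ne_zero ?_ (pow_ne_zero _ hx)
    simpa using hp)
  have key : ∀ i j : ℕ, i < j → (p.coeff i : L) * x ^ i ≠ 0 → V ((p.coeff i : L) * x ^ i) = V ((p.coeff j : L) * x ^ j) →
      ∃ (n : ℕ) (m : ℤ) (a : Ω), 0 < n ∧ a ≠ 0 ∧ V x ^ n = V ε ^ m * V (algebraMap Ω L a) := by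
    intro i j hij h0 heq
    have hj0 : (p.coeff j : L) * x ^ j ≠ 0 := by rw [← V.ne_zero_iff, ← heq, V.ne_zero_iff]; exact h0
    have hci := left_ne_zero_of_mul h0
    have hcj := left_ne_zero_of_mul hj0
    obtain ⟨m, a, ha, h⟩ := hfrac (p.coeff i / p.coeff j : L) (div_mem (p.coeff i).2 (p.coeff j).2) (div_ne_zero hci hcj)
    refine ⟨j - i, m, a, by omega, ha, ?_⟩
    rw [← h, map_div₀, eq_div_iff (V.ne_zero_iff.2 hcj)]
    rw [map_mul, map_mul, map_pow, map_pow] at heq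
    have hxi : V x ^ i ≠ 0 := pow_ne_zero _ (V.ne_zero_iff.2 hx)
    apply mul_right_cancel₀ hxi
    rw [heq]
    have : V x ^ j = V x ^ (j - i) * V x ^ i := by rw [← pow_add]; congr 1; omega
    rw [this, ← mul_assoc, mul_comm (V (p.coeff j : L)), mul_assoc]
  rcases lt_or_gt_of_ne hij with h | h
  · exact key i j h h0 heq
  · exact key j i h (by rw [← V.ne_zero_iff, ← heq, V.ne_zero_iff]; exact h0) heq.symm


/-- additive version of the value group -/
abbrev VG (Γ : Type*) [LinearOrderedCommGroupWithZero Γ] := Additive Γˣ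

/-- the value -/
def vgval {Γ : Type*} [LinearOrderedCommGroupWithZero Γ] (g : VG Γ) : Γ := ((Additive.toMul g : Γˣ) : Γ)

section
variable {Γ : Type*} [LinearOrderedCommGroupWithZero Γ]
lemma vgval_add (g h : VG Γ) : vgval (g + h) = vgval g * vgval h := by simp [vgval]
lemma vgval_zero : vgval (0 : VG Γ) = 1 := by simp [vgval]
lemma vgval_neg (g : VG Γ) : vgval (-g) = (vgval g)⁻¹ := by simp [vgval]
lemma vgval_zsmul (m : ℤ) (g : VG Γ) : vgval (m • g) = vgval g ^ m := by simp [vgval]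
lemma vgval_sum {ι : Type*} (s : Finset ι) (g : ι → VG Γ) : vgval (∑ i ∈ s, g i) = ∏ i ∈ s, vgval (g i) := by
  simp [vgval]
lemma vgval_inj {g h : VG Γ} (hgh : vgval g = vgval h) : g = h :=
  Additive.toMul.injective (Units.ext hgh)
end

theorem exists_VW {κ Ω L : Type*} [Field κ] [Field Ω] [Field L] [Algebra κ Ω] [Algebra Ω L] (n : ℕ) (Y : Fin n → Ω)
    (hY : AlgebraicIndependent κ Y) (ε : L) (hε : Transcendental Ω ε)
    (halg : ∀ x : L, IsAlgebraic (IntermediateField.adjoin Ω {ε}) x) :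
    ∃ (B : ValuationSubring L) (Wy : L → Fin n → ℚ) (Wd : L → ℚ),
      (∀ c : κ, c ≠ 0 → B.valuation (algebraMap Ω L (algebraMap κ Ω c)) = 1) ∧
      (∀ a b, B.valuation a = B.valuation b → Wy a = Wy b) ∧
      (∀ a b, B.valuation a = B.valuation b → Wd a = Wd b) ∧
      (∀ a b, a ≠ 0 → b ≠ 0 → Wy (a * b) = Wy a + Wy b) ∧
      (∀ a b, a ≠ 0 → b ≠ 0 → Wd (a * b) = Wd a + Wd b) ∧
      (∀ i, Wy (algebraMap Ω L (Y i)) = Pi.single i 1) ∧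
      (∀ a : Ω, Wd (algebraMap Ω L a) = 0) ∧ Wd ε = 1 ∧
      (∀ a b, a ≠ 0 → b ≠ 0 → B.valuation a ≤ B.valuation b → Wd b ≤ Wd a) ∧
      (∀ a : Ω, B.valuation (algebraMap Ω L a * ε) < 1) := by
  classical
  obtain ⟨O, hO1, hO2⟩ := val_indep n Y hY
  obtain ⟨B, hB1, hB2, hB3⟩ := val_step O ε hε
  have hε0 : ε ≠ 0 := by rintro rfl; exact hε isAlgebraic_zero
  set V := B.valuation with hV
  have hVε : V ε ≠ 0 := V.ne_zero_iff.2 hε0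
  have hVa : ∀ a : Ω, a ≠ 0 → V (algebraMap Ω L a) ≠ 0 := fun a ha => V.ne_zero_iff.2 (by simpa using ha)
  have hε1 : V ε < 1 := by simpa using hB3 1
  have hnat : ∀ (m : ℕ) (a : Ω), V ε ^ (m+1) * V (algebraMap Ω L a) < 1 := by
    intro m a
    have h1 := hB3 a
    rw [map_mul] at h1
    rw [pow_succ, mul_assoc, mul_comm (V ε)]
    calc _ ≤ 1 * (V (algebraMap Ω L a) * V ε) := by gcongr; exact pow_le_one' hε1.le m
      _ < 1 := by rw [one_mul]; exact h1
  have hpos : ∀ (m : ℤ) (a : Ω), 0 < m → V ε ^ m * V (algebraMap Ω L a) < 1 := by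
    intro m a hm
    obtain ⟨k, rfl⟩ : ∃ k : ℕ, m = ((k + 1 : ℕ) : ℤ) := ⟨(m-1).toNat, by omega⟩
    rw [zpow_natCast]
    exact hnat k a
  have hneg : ∀ (m : ℤ) (a : Ω), a ≠ 0 → m < 0 → 1 < V ε ^ m * V (algebraMap Ω L a) := by
    intro m a ha hm
    have := hpos (-m) a⁻¹ (by omega)
    rw [map_inv₀, map_inv₀, zpow_neg, ← mul_inv] at this
    exact (inv_lt_one₀ (zero_lt_iff.2 (mul_ne_zero (zpow_ne_zero _ hVε) (hVa a ha)))).1 this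
  have hzero : ∀ (m : ℤ) (a : Ω), a ≠ 0 → V ε ^ m * V (algebraMap Ω L a) = 1 → m = 0 := by
    intro m a ha h
    rcases lt_trichotomy m 0 with h1 | h1 | h1
    · exact absurd h (hneg m a ha h1).ne'
    · exact h1
    · exact absurd h (hpos m a h1).ne
  let u : ∀ x : L, x ≠ 0 → VG B.ValueGroup := fun x hx => Additive.ofMul (Units.mk0 (V x) (V.ne_zero_iff.2 hx))
  have hu : ∀ x hx, vgval (u x hx) = V x := fun x hx => rfl
  have hYi : ∀ i, algebraMap Ω L (Y i) ≠ 0 := by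
    intro i
    have := hY.ne_zero i
    simpa using this
  have hinj : ∀ g h : VG B.ValueGroup, vgval g = vgval h → g = h := by
    intro g h hgh
    exact vgval_inj hgh
  -- independence of Y
  have hind : LinearIndependent ℤ (fun i : Fin n => u (algebraMap Ω L (Y i)) (hYi i)) := by
    rw [Fintype.linearIndependent_iff]
    intro g hg i
    have h1 : V (algebraMap Ω L (∏ i, Y i ^ g i)) = 1 := by
      have := congrArg (fun x : VG B.ValueGroup => vgval x) hg
      simp only [vgval_sum, vgval_zsmul, hu, vgval_zero] at this
      rw [← this]
      simp only [map_prod, map_zpow₀]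
    rw [hV, val_base O B hB1 hB2] at h1
    exact congrFun (hO2 g h1) i
  have hφ : ∀ j : Fin n, ∃ φ : VG B.ValueGroup →+ ℚ, ∀ i, φ (u (algebraMap Ω L (Y i)) (hYi i)) = (Pi.single i 1 : Fin n → ℚ) j :=
    fun j => hom_extend _ hind _
  choose φ hφ using hφ
  let S : AddSubgroup (VG B.ValueGroup) :=
    { carrier := {g | ∃ a : Ω, a ≠ 0 ∧ vgval g = V (algebraMap Ω L a)}
      zero_mem' := ⟨1, one_ne_zero, by simp [vgval_zero]⟩
      add_mem' := by
        rintro x y ⟨a, ha, h1⟩ ⟨b, hb, h2⟩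
        exact ⟨a * b, mul_ne_zero ha hb, by simp [h1, h2, vgval_add]⟩
      neg_mem' := by
        rintro x ⟨a, ha, h1⟩
        exact ⟨a⁻¹, inv_ne_zero ha, by simp [h1, vgval_neg]⟩ }
  have hindε : LinearIndependent ℤ (fun _ : Unit => (QuotientAddGroup.mk (u ε hε0) : VG B.ValueGroup ⧸ S)) := by
    rw [Fintype.linearIndependent_iff]
    intro g hg i
    simp only [Finset.univ_unique, Finset.sum_singleton] at hg
    rw [← QuotientAddGroup.mk_zsmul, QuotientAddGroup.eq_zero_iff] at hg
    obtain ⟨a, ha, h⟩ := hg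
    rw [vgval_zsmul, hu ε hε0] at h
    exact hzero (g i) a⁻¹ (inv_ne_zero ha) (by rw [map_inv₀, map_inv₀, ← h]; exact mul_inv_cancel₀ (zpow_ne_zero _ hVε))
  obtain ⟨ψ0, hψ0⟩ := hom_extend _ hindε (fun _ => 1)
  let ψ : VG B.ValueGroup →+ ℚ := ψ0.comp (QuotientAddGroup.mk' S)
  have hψε : ψ (u ε hε0) = 1 := hψ0 ()
  have hψS : ∀ g ∈ S, ψ g = 0 := by
    intro g hg
    change ψ0 (QuotientAddGroup.mk g) = 0
    rw [(QuotientAddGroup.eq_zero_iff g).2 hg, map_zero]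
  have umul : ∀ a b (ha : a ≠ 0) (hb : b ≠ 0), u (a * b) (mul_ne_zero ha hb) = u a ha + u b hb := by
    intro a b ha hb
    apply hinj
    rw [vgval_add, hu a ha, hu b hb, hu (a * b) (mul_ne_zero ha hb), map_mul]
  have ucongr : ∀ a b (ha : a ≠ 0) (hb : b ≠ 0), V a = V b → u a ha = u b hb := by
    intro a b ha hb h
    apply hinj
    simpa [hu] using h
  have hVz : ∀ a b, V a = V b → (a = 0 ↔ b = 0) := by
    intro a b h
    rw [← V.zero_iff, ← V.zero_iff (K := L) (x := b), h]
  have ψmono : ∀ x (hx : x ≠ 0), V x ≤ 1 → 0 ≤ ψ (u x hx) := by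
    intro x hx hx1
    obtain ⟨k, m, a, hk, ha, h⟩ := val_alg V ε hε0 hB3 halg x hx
    have h1 : (k : ℤ) • u x hx = m • u ε hε0 + u (algebraMap Ω L a) (by simpa using ha) := by
      apply hinj
      rw [vgval_add, vgval_zsmul, vgval_zsmul, hu x hx, hu ε hε0, hu (algebraMap Ω L a) (by simpa using ha), zpow_natCast, h]
    have h2 : (k : ℚ) * ψ (u x hx) = m := by
      have := congrArg ψ h1
      rw [map_add, map_zsmul, map_zsmul, hψε, hψS (u (algebraMap Ω L a) (by simpa using ha)) ⟨a, ha, rfl⟩] at this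
      simpa using this
    have h3 : 0 ≤ m := by
      by_contra hm
      push Not at hm
      have := hneg m a ha hm
      rw [← h] at this
      exact absurd (pow_le_one' hx1 k) (not_le.2 this)
    have hk' : (0:ℚ) < k := by exact_mod_cast hk
    have h4 : (0:ℚ) ≤ m := by exact_mod_cast h3
    rw [← h2] at h4
    exact nonneg_of_mul_nonneg_right h4 hk'
  refine ⟨B, fun x j => if hx : x = 0 then 0 else φ j (u x hx), fun x => if hx : x = 0 then 0 else ψ (u x hx),
    ?_, ?_, ?_, ?_, ?_, ?_, ?_, ?_, ?_, hB3⟩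
  · intro c hc
    have h1 : ∀ c : κ, V (algebraMap Ω L (algebraMap κ Ω c)) ≤ 1 := fun c =>
      (B.valuation_le_one_iff _).2 (hB1 _ (hO1 c))
    apply le_antisymm (h1 c)
    have := h1 c⁻¹
    rw [map_inv₀, map_inv₀, map_inv₀] at this
    exact (inv_le_one₀ (zero_lt_iff.2 (by simpa using hc))).1 this
  · intro a b hab
    funext j
    by_cases ha : a = 0
    · have hb := (hVz a b hab).1 ha
      simp [ha, hb]
    · have hb : b ≠ 0 := fun h => ha ((hVz a b hab).2 h)
      simp only [dif_neg ha, dif_neg hb, ucongr a b ha hb hab]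
  · intro a b hab
    by_cases ha : a = 0
    · have hb := (hVz a b hab).1 ha
      simp [ha, hb]
    · have hb : b ≠ 0 := fun h => ha ((hVz a b hab).2 h)
      simp only [dif_neg ha, dif_neg hb, ucongr a b ha hb hab]
  · intro a b ha hb
    funext j
    simp only [dif_neg ha, dif_neg hb, dif_neg (mul_ne_zero ha hb), umul a b ha hb, map_add, Pi.add_apply]
  · intro a b ha hb
    simp only [dif_neg ha, dif_neg hb, dif_neg (mul_ne_zero ha hb), umul a b ha hb, map_add]
  · intro i
    funext j
    simp only [dif_neg (hYi i), hφ]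
  · intro a
    by_cases ha : algebraMap Ω L a = 0
    · simp [ha]
    · simp only [dif_neg ha]
      exact hψS _ ⟨a, by simpa using ha, rfl⟩
  · simp only [dif_neg hε0, hψε]
  · intro a b ha hb hab
    simp only [dif_neg ha, dif_neg hb]
    have h1 : a / b ≠ 0 := div_ne_zero ha hb
    have h2 := ψmono (a / b) h1 (by
      rw [map_div₀, div_le_one₀ (zero_lt_iff.2 (V.ne_zero_iff.2 hb))]; exact hab)
    have h3 := umul (a / b) b h1 hb
    have h4 : u (a / b * b) (mul_ne_zero h1 hb) = u a ha := ucongr (a / b * b) a (mul_ne_zero h1 hb) ha (by rw [div_mul_cancel₀ _ hb])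
    rw [h4] at h3
    rw [h3, map_add]
    linarith

end VWPart
end PartVW

section PartBase
section BasePart
open Finset

lemma ratfunc_factor {E : Type*} [Field E] [IsAlgClosed E] (b : RatFunc E) (hb : b ≠ 0) :
    ∃ (c : E) (m : E →₀ ℤ), c ≠ 0 ∧
      b = RatFunc.C c * m.prod (fun τ k => (RatFunc.X - RatFunc.C τ) ^ k) := by
  classical
  have hX : ∀ τ : E, (RatFunc.X - RatFunc.C τ : RatFunc E) ≠ 0 := by
    intro τ h
    have h1 : (algebraMap (Polynomial E) (RatFunc E)) (Polynomial.X - Polynomial.C τ) = 0 := by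
      simpa using h
    rw [map_eq_zero_iff _ (RatFunc.algebraMap_injective E)] at h1
    exact Polynomial.X_sub_C_ne_zero τ h1
  have hpoly : ∀ p : Polynomial E, p ≠ 0 → ∃ (c : E) (m : E →₀ ℤ), c ≠ 0 ∧
      algebraMap (Polynomial E) (RatFunc E) p = RatFunc.C c * m.prod (fun τ k => (RatFunc.X - RatFunc.C τ) ^ k) := by
    intro p hp
    refine ⟨p.leadingCoeff, Finsupp.onFinset p.roots.toFinset (fun τ => (p.roots.count τ : ℤ)) ?_, by simpa using hp, ?_⟩
    · intro a ha
      rw [Multiset.mem_toFinset]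
      by_contra h
      exact ha (by rw [Multiset.count_eq_zero_of_notMem h]; rfl)
    · have h1 := (IsAlgClosed.splits p).eq_prod_roots
      conv_lhs => rw [h1]
      rw [map_mul, RatFunc.algebraMap_C, map_multiset_prod, Multiset.map_map, Finset.prod_multiset_map_count]
      congr 1
      rw [Finsupp.onFinset_prod _ (fun a => zpow_zero _)]
      apply Finset.prod_congr rfl
      intro a _
      simp
  have hp := (algebraMap (Polynomial E) (RatFunc E))
  obtain ⟨c1, m1, hc1, h1⟩ := hpoly b.num (RatFunc.num_ne_zero hb)
  obtain ⟨c2, m2, hc2, h2⟩ := hpoly b.denom b.denom_ne_zero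
  refine ⟨c1 / c2, m1 - m2, div_ne_zero hc1 hc2, ?_⟩
  have h3 : (m1 - m2).prod (fun τ k => (RatFunc.X - RatFunc.C τ : RatFunc E) ^ k) =
      m1.prod (fun τ k => (RatFunc.X - RatFunc.C τ) ^ k) * (m2.prod (fun τ k => (RatFunc.X - RatFunc.C τ) ^ k))⁻¹ := by
    rw [sub_eq_add_neg, Finsupp.prod_add_index' (fun a => zpow_zero _) (fun a k l => zpow_add₀ (hX a) k l)]
    congr 1
    rw [Finsupp.prod_neg_index (fun a => zpow_zero _)]
    simp only [Finsupp.prod, zpow_neg, Finset.prod_inv_distrib]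
  rw [h3, ← RatFunc.num_div_denom b, h1, h2, map_div₀]
  simp only [div_eq_mul_inv, mul_inv]
  ring

lemma W_zprod {E L M : Type*} [Field L] [AddCommGroup M] [Module ℚ M] (W : L → M)
    (W_mul : ∀ a b, a ≠ 0 → b ≠ 0 → W (a * b) = W a + W b) (c : L) (hc : c ≠ 0) (s : Finset E) (m : E → ℤ) (f : E → L)
    (hf : ∀ τ ∈ s, f τ ≠ 0) : W (c * ∏ τ ∈ s, f τ ^ m τ) = W c + ∑ τ ∈ s, (m τ : ℚ) • W (f τ) := by
  classical
  have h1 : W 1 = 0 := by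
    have := W_mul 1 1 one_ne_zero one_ne_zero
    simpa using this
  have hinv : ∀ a, a ≠ 0 → W a⁻¹ = - W a := by
    intro a ha
    have := W_mul a a⁻¹ ha (inv_ne_zero ha)
    rw [mul_inv_cancel₀ ha, h1] at this
    exact (neg_eq_of_add_eq_zero_right this.symm).symm
  have hpow : ∀ (k : ℕ) a, a ≠ 0 → W (a ^ k) = (k : ℚ) • W a := by
    intro k a ha
    induction k with
    | zero => simp [h1]
    | succ k ih => rw [pow_succ, W_mul _ _ (pow_ne_zero _ ha) ha, ih]; push_cast; rw [add_smul, one_smul]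
  have hz : ∀ (k : ℤ) a, a ≠ 0 → W (a ^ k) = (k : ℚ) • W a := by
    intro k a ha
    rcases Int.eq_nat_or_neg k with ⟨n, rfl | rfl⟩
    · simpa using hpow n a ha
    · rw [zpow_neg, zpow_natCast, hinv _ (pow_ne_zero _ ha), hpow n a ha]; simp
  induction s using Finset.induction_on with
  | empty => simp
  | insert a s ha ih =>
    have h2 : ∏ τ ∈ s, f τ ^ m τ ≠ 0 := Finset.prod_ne_zero_iff.2 fun τ hτ => zpow_ne_zero _ (hf τ (by simp [hτ]))
    have h3 := hf a (by simp)
    rw [Finset.prod_insert ha, Finset.sum_insert ha, mul_left_comm, W_mul _ _ (zpow_ne_zero _ h3) (mul_ne_zero hc h2),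
      ih (fun τ hτ => hf τ (by simp [hτ])), hz _ _ h3]
    abel

/-- the points -/
def ptO {E L : Type*} [Field E] [Field L] [Algebra E L] (t t' : L) : Option (Option E) → L
  | none => t
  | some none => t'
  | some (some τ) => algebraMap E L τ

/-- the first row -/
def rowO {E L M : Type*} [Field E] [Field L] [Algebra E L] [AddCommGroup M] (W : L → M) (t t' ε : L) :
    Option (Option E) → M
  | none => W ε - W (t - t')
  | some none => W (t' - t) - W ε
  | some (some τ) => W (algebraMap E L τ - t) - W (algebraMap E L τ - t')

lemma base_ev {E L M Γ ρ : Type*} [Field E] [IsAlgClosed E] [Field L] [Algebra E L] [AddCommGroup M] [Module ℚ M]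
    [LinearOrderedCommGroupWithZero Γ] [Fintype ρ] [DecidableEq ρ]
    (Ψ : M [⋀^(Option ρ)]→ₗ[ℚ] ℚ) (H : Submodule ℚ M) (hH : ∀ x : Option ρ → M, (∀ i, x i ∈ H) → Ψ x = 0)
    (δ2 : M) (hδ2 : δ2 ∈ H) (V : Valuation L Γ) (W : L → M)
    (W_mul : ∀ a b, a ≠ 0 → b ≠ 0 → W (a * b) = W a + W b) (VW : ∀ a b, V a = V b → W a = W b)
    (t t' ε : L) (σ : Option (Option E) → RatFunc E →+* L)
    (hσC : ∀ s c, σ s (RatFunc.C c) = algebraMap E L c)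
    (hσt : σ none RatFunc.X = t) (hσt' : σ (some none) RatFunc.X = t')
    (hστ : ∀ τ, σ (some (some τ)) RatFunc.X = algebraMap E L τ + ε)
    (hinj : Function.Injective (ptO (E := E) t t'))
    (hWH : ∀ a b : Option (Option E), W (ptO t t' a - ptO t t' b) ∈ H)
    (hWC : ∀ c : E, W (algebraMap E L c) ∈ H)
    (hε : ∀ τ τ' : E, τ ≠ τ' → V (algebraMap E L τ + ε - algebraMap E L τ') = V (algebraMap E L τ - algebraMap E L τ'))
    (i : ρ) (b : ρ → RatFunc E) (hb : ∀ j, b j ≠ 0) :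
    EvZero (fun s => Ψ (vecO (rowO W t t' ε s) (Function.update (fun j => W (σ s (b j))) i δ2))) := by
  classical
  choose c m hc hm using fun j => ratfunc_factor (b j) (hb j)
  let S : Finset E := univ.biUnion fun j => (m j).support
  refine ⟨{none, some none} ∪ S.image (fun τ => some (some τ)), fun P hP => ?_⟩
  have hnone : none ∈ P := hP (by simp)
  have hsnone : some none ∈ P := hP (by simp)
  have hS : ∀ τ ∈ S, some (some τ) ∈ P := fun τ hτ => hP (by simp [hτ])
  have hσX : ∀ s, ∀ τ : E, s ≠ some (some τ) → V (σ s RatFunc.X - algebraMap E L τ) = V (ptO t t' s - algebraMap E L τ) := by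
    intro s τ hs
    rcases s with _ | _ | τ'
    · rw [hσt]; rfl
    · rw [hσt']; rfl
    · rw [hστ]; exact hε _ _ (by rintro rfl; exact hs rfl)
  let κ : Option ρ → M := fun o => o.elim 0 (fun j => if j = i then δ2 else W (algebraMap E L (c j)))
  let mm : Option ρ → Option (Option E) → ℚ := fun o s => match o, s with
    | none, none => 1
    | none, some none => -1
    | none, some (some _) => 0
    | some _, none => 0
    | some _, some none => 0
    | some j, some (some τ) => if j = i then 0 else (m j τ : ℚ)
  let pt := ptO (E := E) t t'
  have hκ : ∀ o, κ o ∈ H := by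
    rintro (_ | j)
    · exact H.zero_mem
    · simp only [κ, Option.elim_some]
      split_ifs
      · exact hδ2
      · exact hWC _
  have R := reciprocity Ψ H hH (W ε) κ hκ V W (P.image pt)
    (by
      intro a ha b hb _
      rw [mem_image] at ha hb
      obtain ⟨a, -, rfl⟩ := ha
      obtain ⟨b, -, rfl⟩ := hb
      exact hWH a b) VW (fun o x => mm o (Function.invFun pt x))
  have hinv : ∀ s, Function.invFun pt (pt s) = s := Function.leftInverse_invFun hinj
  rw [Finset.sum_image (fun a _ b _ h => hinj h)] at R
  have hsum : ∀ g : L → M, ∑ x ∈ P.image pt, g x = ∑ s ∈ P, g (pt s) := fun g =>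
    Finset.sum_image (fun a _ b _ h => hinj h)
  simp_rw [hsum, hinv] at R
  have e0 : Ψ (fun j => κ j + ∑ s ∈ P, mm j s • (-W ε)) = 0 := by
    apply Ψ.map_coord_zero none
    simp only [κ, Option.elim_none, zero_add]
    rw [← Finset.sum_smul]
    have : ∑ s ∈ P, mm none s = 0 := by
      rw [← Finset.sum_subset (s₁ := ({none, some none} : Finset (Option (Option E))))]
      · rw [Finset.sum_pair (by simp)]; simp [mm]
      · intro x hx; simp at hx; rcases hx with rfl | rfl <;> assumption
      · rintro (_ | _ | τ) _ hx <;> simp [mm] at hx ⊢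
    rw [this, zero_smul]
  rw [e0, add_zero] at R
  rw [← R]
  apply Finset.sum_congr rfl
  intro s hs
  refine congrArg Ψ ?_
  funext o
  rcases o with _ | j
  · simp only [vecO, Option.elim_none, κ, zero_add]
    rw [← Finset.sum_subset (s₁ := ({none, some none} : Finset (Option (Option E))))]
    · rw [Finset.sum_pair (by simp)]
      rcases s with _ | _ | τ
      · have h1 : t ≠ t' := fun h => by simpa using hinj (show ptO t t' none = ptO t t' (some none) from h)
        simp only [mm, rowO]
        simp [pt, ptO, sub_eq_add_neg, h1]
      · have h1 : t' ≠ t := fun h => by simpa using hinj (show ptO t t' (some none) = ptO t t' none from h)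
        simp only [mm, rowO]
        simp [pt, ptO, sub_eq_add_neg, h1]
      · have h1 : algebraMap E L τ ≠ t := fun h => by simpa using hinj (show ptO t t' (some (some τ)) = ptO t t' none from h)
        have h2 : algebraMap E L τ ≠ t' := fun h => by simpa using hinj (show ptO t t' (some (some τ)) = ptO t t' (some none) from h)
        simp only [mm, rowO]
        simp [pt, ptO, sub_eq_add_neg, h1, h2]
    · intro x hx; simp at hx; rcases hx with rfl | rfl <;> assumption
    · rintro (_ | _ | τ) _ hx <;> simp [mm] at hx ⊢
  · simp only [vecO, Option.elim_some, κ]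
    by_cases hj : j = i
    · subst hj
      simp only [Function.update_self, if_true]
      rw [Finset.sum_eq_zero]
      · simp
      · rintro (_ | _ | τ) _ <;> simp [mm]
    · simp only [Function.update_of_ne hj, if_neg hj]
      have h1 : σ s (b j) = algebraMap E L (c j) * ∏ τ ∈ S, (σ s RatFunc.X - algebraMap E L τ) ^ (m j τ) := by
        conv_lhs => rw [hm j]
        rw [map_mul, hσC, Finsupp.prod, map_prod]
        congr 1
        rw [← Finset.prod_subset (Finset.subset_biUnion_of_mem (fun j => (m j).support) (mem_univ j))]
        · apply Finset.prod_congr rfl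
          intro τ _
          rw [map_zpow₀, map_sub, hσC]
        · intro τ _ hτ
          have : m j τ = 0 := by simpa using hτ
          rw [this, zpow_zero]
      have hne : ∀ τ : E, σ s RatFunc.X - algebraMap E L τ ≠ 0 := by
        intro τ
        rw [← hσC s, ← map_sub, map_ne_zero]
        intro h
        have h1 : (algebraMap (Polynomial E) (RatFunc E)) (Polynomial.X - Polynomial.C τ) = 0 := by
          simpa using h
        rw [map_eq_zero_iff _ (RatFunc.algebraMap_injective E)] at h1
        exact Polynomial.X_sub_C_ne_zero τ h1
      rw [h1, W_zprod W W_mul _ (by simpa using hc j) _ _ _ (fun τ _ => hne τ)]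
      congr 1
      rw [← Finset.sum_subset (s₁ := S.image (fun τ => some (some τ)))]
      · rw [Finset.sum_image (by intro a _ b _ h; simpa using h)]
        apply Finset.sum_congr rfl
        intro τ _
        simp only [mm, if_neg hj]
        congr 1
        by_cases hsτ : s = some (some τ)
        · subst hsτ
          rw [if_pos rfl, hστ]; simp
        · rw [if_neg (fun h => hsτ (hinj h))]
          exact VW _ _ (hσX s τ hsτ)
      · intro x hx
        rw [mem_image] at hx
        obtain ⟨τ, hτ, rfl⟩ := hx
        exact hS τ hτ
      · rintro (_ | _ | τ) _ hx
        · simp [mm]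
        · simp [mm]
        · have : m j τ = 0 := by
            by_contra h0
            apply hx
            rw [mem_image]
            exact ⟨τ, by simp only [S, mem_biUnion, mem_univ, true_and]; exact ⟨j, by simpa using h0⟩, rfl⟩
          simp [mm, this]

end BasePart
end PartBase

section PartReg
section RegPart
open Finset

lemma W_npow {L M ι : Type*} [Field L] [AddCommGroup M] [Module ℚ M] [Fintype ι] (W : L → M)
    (W_mul : ∀ a b, a ≠ 0 → b ≠ 0 → W (a * b) = W a + W b) (c : L) (hc : c ≠ 0) (m : ι → ℕ) (f : ι → L)
    (hf : ∀ τ, f τ ≠ 0) : W (c * ∏ τ, f τ ^ m τ) = W c + ∑ τ, (m τ : ℚ) • W (f τ) := by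
  have := W_zprod W W_mul c hc Finset.univ (fun τ => (m τ : ℤ)) f (fun τ _ => hf τ)
  simpa using this

lemma reg_lemma {n : ℕ} {κ L Γ : Type*} [Field κ] [Field L] [Algebra κ L] [LinearOrderedCommGroupWithZero Γ]
    (V : Valuation L Γ) (Wy : L → Fin n → ℚ) (Wd : L → ℚ)
    (hκ : ∀ c : κ, c ≠ 0 → V (algebraMap κ L c) = 1)
    (hVy : ∀ a b, V a = V b → Wy a = Wy b) (hVd : ∀ a b, V a = V b → Wd a = Wd b)
    (hmy : ∀ a b, a ≠ 0 → b ≠ 0 → Wy (a * b) = Wy a + Wy b)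
    (hmd : ∀ a b, a ≠ 0 → b ≠ 0 → Wd (a * b) = Wd a + Wd b)
    (hanti : ∀ a b, a ≠ 0 → b ≠ 0 → V a ≤ V b → Wd b ≤ Wd a)
    (y : Fin (n + 1) → L) (hy0 : y 0 = 1) (hy : ∀ i, y i ≠ 0)
    (heq : ∀ i, ∃ (d : ℕ) (μ : Fin (n + 1) →₀ ℕ) (g : MvPolynomial (Fin (n + 1)) κ) (s : L),
      μ.degree = d ∧ μ i ≠ 0 ∧ g.IsHomogeneous d ∧ (∀ l, g.coeff (Finsupp.single l d) ≠ 0) ∧ s ≠ 0 ∧ Wd s = 0 ∧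
      ∏ l, y l ^ μ l + s * MvPolynomial.aeval y g = 0) :
    (∀ i, Wd (y i) = 0) ∨ ∃ c : Fin n → ℚ, c ≠ 0 ∧ ∑ i, c i • Wy (y i.succ) = 0 ∧ ∑ i, c i * Wd (y i.succ) = 0 := by
  classical
  by_cases hall : ∀ i, Wd (y i) = 0
  · exact Or.inl hall
  right
  have hd1 : Wd 1 = 0 := by
    have := hmd 1 1 one_ne_zero one_ne_zero
    simpa using this
  have hy1 : Wy 1 = 0 := by
    have := hmy 1 1 one_ne_zero one_ne_zero
    simpa using this
  obtain ⟨l0, -, hl0⟩ := Finset.exists_min_image Finset.univ (fun i => Wd (y i)) ⟨0, mem_univ _⟩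
  have hmin : ∀ i, Wd (y l0) ≤ Wd (y i) := fun i => hl0 i (mem_univ i)
  obtain ⟨i, hi⟩ : ∃ i, Wd (y i) ≠ Wd (y l0) := by
    by_contra hcon
    push Not at hcon
    apply hall
    intro i
    rw [hcon i, ← hcon 0, hy0, hd1]
  have hi' : Wd (y l0) < Wd (y i) := lt_of_le_of_ne (hmin i) (Ne.symm hi)
  obtain ⟨d, μ, g, s, hμ, hμi, hg, hpure, hs0, hs, he⟩ := heq i
  have hmu0 : ∏ l, y l ^ μ l ≠ 0 := Finset.prod_ne_zero_iff.2 fun l _ => pow_ne_zero _ (hy l)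
  have hg0 : MvPolynomial.aeval y g ≠ 0 := by
    intro h
    rw [h, mul_zero, add_zero] at he
    exact hmu0 he
  have hneg : ∀ a, Wd (-a) = Wd a := fun a => hVd _ _ (V.map_neg a)
  have hWg : (d : ℚ) * Wd (y l0) < Wd (MvPolynomial.aeval y g) := by
    have h1 : Wd (∏ l, y l ^ μ l) = ∑ l, (μ l : ℚ) * Wd (y l) := by
      have := W_npow Wd hmd 1 one_ne_zero μ y hy
      simpa [hd1] using this
    have h2 : Wd (MvPolynomial.aeval y g) = Wd (∏ l, y l ^ μ l) := by
      rw [eq_neg_of_add_eq_zero_left he, hneg, hmd _ _ hs0 hg0, hs, zero_add]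
    rw [h2, h1, ← hμ, Finsupp.degree_eq_sum, Nat.cast_sum, Finset.sum_mul]
    apply Finset.sum_lt_sum
    · intro l _
      exact mul_le_mul_of_nonneg_left (hmin l) (by positivity)
    · exact ⟨i, mem_univ _, mul_lt_mul_of_pos_left hi' (by positivity)⟩
  let f : Option (Fin (n + 1) →₀ ℕ) → L := fun o => o.elim (-MvPolynomial.aeval y g)
    (fun m => algebraMap κ L (g.coeff m) * ∏ l, y l ^ m l)
  have hf : ∑ o ∈ insertNone g.support, f o = 0 := by
    rw [Finset.sum_insertNone]
    simp only [f, Option.elim_none, Option.elim_some]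
    rw [MvPolynomial.aeval_def, MvPolynomial.eval₂_eq']
    simp
  have hpm : Finsupp.single l0 d ∈ g.support := by rw [MvPolynomial.mem_support_iff]; exact hpure l0
  have hcoef : ∀ m ∈ g.support, algebraMap κ L (g.coeff m) ≠ 0 := by
    intro m hm
    rw [MvPolynomial.mem_support_iff] at hm
    simpa using hm
  have hcd : ∀ m ∈ g.support, Wd (algebraMap κ L (g.coeff m)) = 0 := by
    intro m hm
    rw [MvPolynomial.mem_support_iff] at hm
    rw [← hd1]
    exact hVd _ _ (by rw [hκ _ hm, map_one])
  have hcy : ∀ m ∈ g.support, Wy (algebraMap κ L (g.coeff m)) = 0 := by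
    intro m hm
    rw [MvPolynomial.mem_support_iff] at hm
    rw [← hy1]
    exact hVy _ _ (by rw [hκ _ hm, map_one])
  have hfm : ∀ m ∈ g.support, f (some m) ≠ 0 := fun m hm =>
    mul_ne_zero (hcoef m hm) (Finset.prod_ne_zero_iff.2 fun l _ => pow_ne_zero _ (hy l))
  have hfd : ∀ m ∈ g.support, Wd (f (some m)) = ∑ l, (m l : ℚ) * Wd (y l) := by
    intro m hm
    have := W_npow Wd hmd _ (hcoef m hm) m y hy
    rw [hcd m hm, zero_add] at this
    exact this
  have hfy : ∀ m ∈ g.support, Wy (f (some m)) = ∑ l, (m l : ℚ) • Wy (y l) := by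
    intro m hm
    have := W_npow Wy hmy _ (hcoef m hm) m y hy
    rw [hcy m hm, zero_add] at this
    exact this
  have hpd : Wd (f (some (Finsupp.single l0 d))) = d * Wd (y l0) := by
    rw [hfd _ hpm, Finset.sum_eq_single l0]
    · simp
    · intro b _ hb
      simp [Finsupp.single_apply, hb.symm]
    · simp
  obtain ⟨a, ha, b, hb, hab, hfa, hVab, hmax⟩ := val_sum_zero V _ f hf (some (Finsupp.single l0 d))
    (by simpa using hpure l0) (hfm _ hpm)
  have hfb : f b ≠ 0 := by rw [← V.ne_zero_iff, ← hVab, V.ne_zero_iff]; exact hfa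
  have hnotnone : ∀ o, f o ≠ 0 → V (f o) = V (f a) → o ≠ none := by
    rintro o ho0 ho rfl
    have h1 := hanti _ _ (hfm _ hpm) ho0 (by rw [ho]; exact hmax _ (by simpa using hpure l0))
    rw [hpd] at h1
    have h2 : Wd (f none) = Wd (MvPolynomial.aeval y g) := hneg _
    linarith
  rcases a with _ | m
  · exact absurd rfl (hnotnone _ hfa rfl)
  rcases b with _ | m'
  · exact absurd rfl (hnotnone _ hfb hVab.symm)
  have hm : m ∈ g.support := by simpa using ha
  have hm' : m' ∈ g.support := by simpa using hb
  have e1 := hVd _ _ hVab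
  have e2 := hVy _ _ hVab
  rw [hfd m hm, hfd m' hm', Fin.sum_univ_succ, Fin.sum_univ_succ, hy0, hd1] at e1
  rw [hfy m hm, hfy m' hm', Fin.sum_univ_succ, Fin.sum_univ_succ, hy0, hy1] at e2
  refine ⟨fun i => (m i.succ : ℚ) - m' i.succ, ?_, ?_, ?_⟩
  · intro hc
    apply hab
    have hs : ∀ i : Fin n, m i.succ = m' i.succ := by
      intro i
      have := congrFun hc i
      simp only [Pi.zero_apply, sub_eq_zero] at this
      exact_mod_cast this
    have d1 : m.degree = d := by
      have := hg (MvPolynomial.mem_support_iff.1 hm)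
      rw [Finsupp.degree_eq_weight_one]; exact this
    have d2 : m'.degree = d := by
      have := hg (MvPolynomial.mem_support_iff.1 hm')
      rw [Finsupp.degree_eq_weight_one]; exact this
    rw [← d2, Finsupp.degree_eq_sum, Finsupp.degree_eq_sum, Fin.sum_univ_succ, Fin.sum_univ_succ] at d1
    simp_rw [hs] at d1
    congr 1
    ext j
    refine Fin.cases ?_ (fun i => ?_) j
    · omega
    · exact hs i
  · simp only [sub_smul, Finset.sum_sub_distrib]
    simp only [smul_zero, zero_add] at e2
    rw [e2, sub_self]
  · simp only [sub_mul, Finset.sum_sub_distrib]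
    simp only [mul_zero, zero_add] at e1
    rw [e1, sub_self]

end RegPart
end PartReg

section PartCore
section CorePart
open Finset

/-- evaluation homomorphism of rational functions at a transcendental element -/
lemma ratfunc_hom {E L : Type*} [Field E] [Field L] (j : E →+* L) (x : L)
    (hx : ∀ p : Polynomial E, p ≠ 0 → p.eval₂ j x ≠ 0) :
    ∃ σ : RatFunc E →+* L, (∀ c, σ (RatFunc.C c) = j c) ∧ σ RatFunc.X = x := by
  have hφ : nonZeroDivisors (Polynomial E) ≤ Submonoid.comap (Polynomial.eval₂RingHom j x) (nonZeroDivisors L) := by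
    intro p hp
    rw [Submonoid.mem_comap, mem_nonZeroDivisors_iff_ne_zero]
    exact hx p (nonZeroDivisors.ne_zero hp)
  refine ⟨RatFunc.liftRingHom (Polynomial.eval₂RingHom j x) hφ, fun c => ?_, ?_⟩
  · rw [← RatFunc.algebraMap_C, RatFunc.liftRingHom_algebraMap]; simp
  · rw [← RatFunc.algebraMap_X, RatFunc.liftRingHom_algebraMap]; simp

lemma exists_root_hom {K₀ Q L : Type*} [Field K₀] [Field Q] [Field L] [IsAlgClosed L] [Algebra K₀ Q]
    [Algebra.IsAlgebraic K₀ Q] (σ : K₀ →+* L) (α : Q) (p : Polynomial K₀) (hp : Irreducible p)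
    (hα : Polynomial.aeval α p = 0) (r : L) (hr : (p.map σ).eval r = 0) :
    ∃ φ : Q →+* L, (∀ c, φ (algebraMap K₀ Q c) = σ c) ∧ φ α = r := by
  letI := σ.toAlgebra
  have hmin := minpoly.eq_of_irreducible hp hα
  have h1 : Polynomial.aeval r (minpoly K₀ α) = 0 := by
    rw [← hmin, map_mul, Polynomial.aeval_def, Polynomial.eval₂_eq_eval_map]
    have : algebraMap K₀ L = σ := rfl
    rw [this, hr, zero_mul]
  obtain ⟨φ, hφ⟩ := IntermediateField.exists_algHom_of_splits_of_aeval (F := K₀) (E := Q) (K := L)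
    (fun s => ⟨(Algebra.IsAlgebraic.isAlgebraic s).isIntegral, IsAlgClosed.splits _⟩) h1
  exact ⟨φ.toRingHom, fun c => φ.commutes c, hφ⟩

theorem core {n : ℕ} {κ₀ κ E Q Ω L : Type*} [Field κ₀] [Field κ] [Field E] [Field Q] [Field Ω] [Field L]
    [IsAlgClosed E] [IsAlgClosed Ω] [IsAlgClosed L] [Algebra κ₀ E] [Algebra E Ω] [Algebra κ Ω] [Algebra Ω L]
    [Algebra (RatFunc E) Q] [Algebra.IsAlgebraic (RatFunc E) Q]
    (hκ : ∀ c : κ₀, ∃ c' : κ, algebraMap κ Ω c' = algebraMap E Ω (algebraMap κ₀ E c))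
    (ε : L) (hε : Transcendental Ω ε) (halg : ∀ x : L, IsAlgebraic (IntermediateField.adjoin Ω {ε}) x)
    (α : Q) (p : Polynomial (RatFunc E)) (hp : Irreducible p) (hpα : Polynomial.aeval α p = 0)
    (y : Fin (n + 1) → Q) (hy0 : y 0 = 1) (hy : ∀ i, y i ≠ 0)
    (q : ℕ) (hq : 0 < q) (G : Fin n → Polynomial (RatFunc E)) (hG : ∀ a, Polynomial.aeval α (G a) = y a.succ ^ q)
    (heq : ∀ i, ∃ (d : ℕ) (μ : Fin (n + 1) →₀ ℕ) (g : MvPolynomial (Fin (n + 1)) κ₀) (s : E),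
      μ.degree = d ∧ μ i ≠ 0 ∧ g.IsHomogeneous d ∧ (∀ l, g.coeff (Finsupp.single l d) ≠ 0) ∧ s ≠ 0 ∧
      ∏ l, y l ^ μ l + algebraMap (RatFunc E) Q (RatFunc.C s) *
        g.eval₂ ((algebraMap (RatFunc E) Q).comp (RatFunc.C.comp (algebraMap κ₀ E))) y = 0)
    (σt σt' : RatFunc E →+* Ω) (hσt : ∀ c, σt (RatFunc.C c) = algebraMap E Ω c)
    (hσt' : ∀ c, σt' (RatFunc.C c) = algebraMap E Ω c) (htt' : σt RatFunc.X ≠ σt' RatFunc.X)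
    (α₀ : Ω) (hα₀ : (p.map σt).eval α₀ = 0) (Y : Fin n → Ω) (hY : AlgebraicIndependent κ Y)
    (hYα : ∀ a, ((G a).map σt).eval α₀ = Y a ^ q)
    (h1 : ∀ r, (p.map σt).eval r = 0 → r ≠ α₀ → ∃ a, ∃ c : κ, c ≠ 0 ∧ ((G a).map σt).eval r = algebraMap κ Ω c)
    (h2 : ∀ r, (p.map σt').eval r = 0 → ∃ a, ∃ c : κ, c ≠ 0 ∧ ((G a).map σt').eval r = algebraMap κ Ω c) :
    False := by
  classical
  obtain ⟨B, Wy, Wd, hVκ, hVy, hVd, hmy, hmd, hWY, hWdΩ, hWdε, hanti, hsmall⟩ := exists_VW n Y hY ε hε halg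
  letI : Algebra E L := ((algebraMap Ω L).comp (algebraMap E Ω)).toAlgebra
  have hEL : ∀ c : E, algebraMap E L c = algebraMap Ω L (algebraMap E Ω c) := fun _ => rfl
  letI : Algebra κ₀ L := ((algebraMap E L).comp (algebraMap κ₀ E)).toAlgebra
  have hκL : ∀ c : κ₀, algebraMap κ₀ L c = algebraMap E L (algebraMap κ₀ E c) := fun _ => rfl
  set V := B.valuation with hV
  -- the weight vector
  let W : L → (Option (Option (Fin n)) → ℚ) := fun a o => o.elim (Wd a) (fun o' => o'.elim 0 (Wy a))
  have W_none : ∀ a, W a none = Wd a := fun _ => rfl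
  have W_sn : ∀ a, W a (some none) = 0 := fun _ => rfl
  have W_ss : ∀ a i, W a (some (some i)) = Wy a i := fun _ _ => rfl
  have W_mul : ∀ a b, a ≠ 0 → b ≠ 0 → W (a * b) = W a + W b := by
    intro a b ha hb
    funext o
    rcases o with _ | _ | i
    · simp [W_none, hmd a b ha hb]
    · simp [W_sn]
    · simp [W_ss, hmy a b ha hb]
  have VW : ∀ a b, V a = V b → W a = W b := by
    intro a b hab
    funext o
    rcases o with _ | _ | i
    · simp [W_none, hVd a b hab]
    · simp [W_sn]
    · simp [W_ss, hVy a b hab]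
  have W_one : W 1 = 0 := by
    have := W_mul 1 1 one_ne_zero one_ne_zero
    simpa using this
  have W_pow : ∀ a, a ≠ 0 → ∀ m : ℕ, W (a ^ m) = (m : ℚ) • W a := by
    intro a ha m
    induction m with
    | zero => simp [W_one]
    | succ m ih => rw [pow_succ, W_mul _ _ (pow_ne_zero _ ha) ha, ih]; push_cast; rw [add_smul, one_smul]
  have htr : ∀ τ : E, ∀ P : Polynomial E, P ≠ 0 → P.eval₂ (algebraMap E L) (algebraMap E L τ + ε) ≠ 0 := by
    intro τ P hP h0
    apply hε
    refine ⟨(P.map (algebraMap E Ω)).comp (Polynomial.X + Polynomial.C (algebraMap E Ω τ)), ?_, ?_⟩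
    · intro h
      rw [Polynomial.comp_eq_zero_iff] at h
      rcases h with h | ⟨-, h⟩
      · exact hP ((Polynomial.map_eq_zero _).1 h)
      · have := congrArg (fun P => Polynomial.coeff P 1) h
        simp at this
    · rw [Polynomial.aeval_def, Polynomial.eval₂_comp, Polynomial.eval₂_map]
      simp only [Polynomial.eval₂_add, Polynomial.eval₂_X, Polynomial.eval₂_C]
      rw [add_comm]
      exact h0
  choose στ hστC hστX using fun τ : E => ratfunc_hom (algebraMap E L) _ (htr τ)
  let σ : Option (Option E) → RatFunc E →+* L := fun s => s.elim ((algebraMap Ω L).comp σt)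
    (fun s' => s'.elim ((algebraMap Ω L).comp σt') στ)
  have hσC : ∀ s c, σ s (RatFunc.C c) = algebraMap E L c := by
    rintro (_ | _ | τ) c
    · simp [σ, hσt, hEL]
    · simp [σ, hσt', hEL]
    · simp [σ, hστC]
  have hΩinj : Function.Injective (algebraMap Ω L) := (algebraMap Ω L).injective
  have htE : ∀ (s : RatFunc E →+* Ω), (∀ c, s (RatFunc.C c) = algebraMap E Ω c) → ∀ τ : E, s RatFunc.X ≠ algebraMap E Ω τ := by
    intro s hs τ h
    rw [← hs τ] at h
    have h3 := s.injective h
    rw [← RatFunc.algebraMap_X, ← RatFunc.algebraMap_C] at h3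
    exact Polynomial.X_ne_C _ (RatFunc.algebraMap_injective E h3)
  let t := algebraMap Ω L (σt RatFunc.X)
  let t' := algebraMap Ω L (σt' RatFunc.X)
  let pt : Option (Option E) → Ω := ptO (σt RatFunc.X) (σt' RatFunc.X)
  have hpt : ∀ s, ptO (E := E) t t' s = algebraMap Ω L (pt s) := by rintro (_ | _ | τ) <;> rfl
  have hinj : Function.Injective (ptO (E := E) t t') := by
    intro a b hab
    rw [hpt, hpt] at hab
    have hab := hΩinj hab
    rcases a with _ | _ | a <;> rcases b with _ | _ | b
    · rfl
    · exact absurd hab htt'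
    · exact absurd hab (htE _ hσt _)
    · exact absurd hab.symm htt'
    · rfl
    · exact absurd hab (htE _ hσt' _)
    · exact absurd hab.symm (htE _ hσt _)
    · exact absurd hab.symm (htE _ hσt' _)
    · have := (algebraMap E Ω).injective hab
      rw [this]
  let δ2 : Option (Option (Fin n)) → ℚ := Pi.single (some none) 1
  let Ψ : (Option (Option (Fin n)) → ℚ) [⋀^(Option (Option (Fin n)))]→ₗ[ℚ] ℚ := Matrix.detRowAlternating
  have hΨcol : ∀ (x : Option (Option (Fin n)) → (Option (Option (Fin n)) → ℚ)) (o), (∀ i, x i o = 0) → Ψ x = 0 := by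
    intro x o hx
    exact Matrix.det_eq_zero_of_column_eq_zero o hx
  have hΨrow : ∀ (x : Option (Option (Fin n)) → (Option (Option (Fin n)) → ℚ)) (o), x o = 0 → Ψ x = 0 := by
    intro x o hx
    exact Ψ.map_coord_zero o hx
  let D : NPData (RatFunc E) L (Option (Option E)) (Option (Fin n)) (Option (Option (Fin n)) → ℚ) B.ValueGroup :=
    { Ψ := Ψ
      H := LinearMap.ker (LinearMap.proj (R := ℚ) (φ := fun _ => ℚ) (some none))
      hH := fun x hx => hΨcol x (some none) (fun i => by simpa using hx i)
      δ := δ2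
      V := V
      W := W
      W_mul := W_mul
      W_mem := fun a => by simp [W_sn]
      VW := VW
      σ := σ
      h := rowO W t t' ε
      h_mem := by rintro (_ | _ | τ) <;> simp [rowO, W_sn] }
  have hεV : ∀ τ τ' : E, τ ≠ τ' →
      V (algebraMap E L τ + ε - algebraMap E L τ') = V (algebraMap E L τ - algebraMap E L τ') := by
    intro τ τ' hne
    rw [show algebraMap E L τ + ε - algebraMap E L τ' = (algebraMap E L τ - algebraMap E L τ') + ε by ring]
    apply Valuation.map_add_eq_of_lt_left
    have hs := hsmall (algebraMap E Ω (τ - τ')⁻¹)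
    rw [← hEL, map_inv₀, map_mul, map_inv₀, map_sub] at hs
    have h0 : algebraMap E L τ - algebraMap E L τ' ≠ 0 := by
      rw [sub_ne_zero]; exact fun h => hne ((algebraMap E L).injective h)
    have h0' : V (algebraMap E L τ - algebraMap E L τ') ≠ 0 := V.ne_zero_iff.2 h0
    rwa [inv_mul_lt_one₀ (zero_lt_iff.2 h0')] at hs
  have hbase : ∀ i (b : Option (Fin n) → RatFunc E), (∀ j, b j ≠ 0) → EvZero (D.base i b) := by
    intro i b hb
    refine base_ev (ρ := Option (Fin n)) Ψ (LinearMap.ker (LinearMap.proj (R := ℚ) (φ := fun _ => ℚ) none))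
      (fun x hx => hΨcol x none (fun i => by simpa using hx i)) δ2 (by simp [δ2]) V W W_mul VW t t' ε σ hσC rfl rfl
      (fun τ => hστX τ) hinj ?_ ?_ hεV i b hb
    · intro a b
      rw [hpt, hpt, ← map_sub]
      exact hWdΩ _
    · intro c
      simp [hEL, W_none, hWdΩ]
  let G' : Option (Fin n) → Polynomial (RatFunc E) := fun o => o.elim p G
  have hGne : ∀ a, Polynomial.aeval α (G a) ≠ 0 := fun a => by rw [hG]; exact pow_ne_zero _ (hy _)
  have hmain := D.main hbase none G' (by
      rintro (_ | a)
      · exact hp.ne_zero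
      · intro h
        apply hGne a
        have : G a = 0 := h
        rw [this, map_zero]) (by
      rintro (_ | a) h
      · exact absurd rfl h
      · refine (hp.coprime_iff_not_dvd).2 ?_
        rintro ⟨c, hc⟩
        apply hGne a
        have : G a = p * c := hc
        rw [this, map_mul, hpα, zero_mul])
  have hterm : ∀ s r, D.term none G' s r = Ψ (vecO (rowO W t t' ε s)
      (Function.update (fun j => W (((G' j).map (σ s)).eval r)) none δ2)) := fun _ _ => rfl
  have hWκ : ∀ c : κ, c ≠ 0 → W (algebraMap Ω L (algebraMap κ Ω c)) = 0 := by
    intro c hc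
    rw [VW _ 1 (by rw [hVκ c hc, map_one]), W_one]
  -- roots for embeddings through Ω
  have hroots : ∀ s : RatFunc E →+* Ω, (p.map ((algebraMap Ω L).comp s)).roots = (p.map s).roots.map (algebraMap Ω L) := by
    intro s
    rw [← Polynomial.map_map]
    exact (IsAlgClosed.splits _).roots_map _
  have hevalΩ : ∀ (s : RatFunc E →+* Ω) (P : Polynomial (RatFunc E)) (r : Ω),
      (P.map ((algebraMap Ω L).comp s)).eval (algebraMap Ω L r) = algebraMap Ω L ((P.map s).eval r) := by
    intro s P r
    rw [← Polynomial.map_map, Polynomial.eval_map_apply]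
  have hT' : D.T none G' (some none) = 0 := by
    unfold NPData.T
    apply Multiset.sum_eq_zero
    intro x hx
    obtain ⟨r, hr, rfl⟩ := Multiset.mem_map.1 hx
    have hr' : r ∈ (p.map ((algebraMap Ω L).comp σt')).roots := hr
    rw [hroots] at hr'
    obtain ⟨r0, hr0, rfl⟩ := Multiset.mem_map.1 hr'
    obtain ⟨a, c, hc, hac⟩ := h2 r0 (Polynomial.isRoot_of_mem_roots hr0)
    rw [hterm]
    apply hΨrow _ (some (some a))
    change W (((G a).map ((algebraMap Ω L).comp σt')).eval _) = 0
    rw [hevalΩ, hac, hWκ c hc]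
  have hTτ : ∀ τ, D.T none G' (some (some τ)) = 0 := by
    intro τ
    unfold NPData.T
    apply Multiset.sum_eq_zero
    intro x hx
    obtain ⟨r, hr, rfl⟩ := Multiset.mem_map.1 hx
    have hr0 : (p.map (στ τ)).eval r = 0 := Polynomial.isRoot_of_mem_roots hr
    obtain ⟨φ, hφ1, hφ2⟩ := exists_root_hom (στ τ) α p hp hpα r hr0
    have hφG : ∀ a, ((G a).map (στ τ)).eval r = φ (y a.succ) ^ q := by
      intro a
      rw [← map_pow, ← hG, Polynomial.aeval_def, Polynomial.hom_eval₂, hφ2, Polynomial.eval_map]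
      congr 1
      ext c
      exact (hφ1 c).symm
    have hφ0 : ∀ i, φ (y i) ≠ 0 := fun i => (map_ne_zero φ).2 (hy i)
    have hrow : ∀ a, W (((G' (some a)).map (σ (some (some τ)))).eval r) = (q : ℚ) • W (φ (y a.succ)) := by
      intro a
      change W (((G a).map (στ τ)).eval r) = _
      rw [hφG, W_pow _ (hφ0 _)]
    rw [hterm]
    rcases reg_lemma (κ := κ₀) V Wy Wd (by
        intro c hc
        obtain ⟨c', hc'⟩ := hκ c
        have hc0 : c' ≠ 0 := by
          rintro rfl
          rw [map_zero] at hc'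
          have := hc'.symm
          simp [hc] at this
        rw [hκL, hEL, ← hc', hVκ c' hc0]) hVy hVd hmy hmd hanti (fun i => φ (y i)) (by simp [hy0]) hφ0 (by
        intro i
        obtain ⟨d, μ, g, s, e1, e2, e3, e4, e5, e6⟩ := heq i
        refine ⟨d, μ, g, algebraMap E L s, e1, e2, e3, e4, by simpa using e5, by rw [hEL, hWdΩ], ?_⟩
        have := congrArg φ e6
        rw [map_add, map_mul, map_zero, map_prod, hφ1, hστC, MvPolynomial.hom_eval₂] at this
        rw [MvPolynomial.aeval_def, ← this]
        simp only [map_pow]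
        congr 3
        ext c
        simp [hκL, hφ1, hστC]) with h | ⟨c, hc0, hc1, hc2⟩
    · apply hΨcol _ none
      rintro (_ | _ | a)
      · change (W (algebraMap E L τ - t) - W (algebraMap E L τ - t')) none = 0
        rw [Pi.sub_apply, W_none, W_none, hEL, ← map_sub, ← map_sub, hWdΩ, hWdΩ, sub_zero]
      · change δ2 none = 0
        simp [δ2]
      · change W (((G' (some a)).map (σ (some (some τ)))).eval r) none = 0
        rw [hrow, Pi.smul_apply, W_none, h, smul_zero]
    · apply AlternatingMap.map_linearDependent
      rw [Fintype.not_linearIndependent_iff]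
      obtain ⟨a0, ha0⟩ := Function.ne_iff.1 hc0
      refine ⟨fun o => o.elim 0 (fun o' => o'.elim 0 c), ?_, some (some a0), ha0⟩
      rw [Fintype.sum_option, Fintype.sum_option]
      simp only [Option.elim_none, zero_smul, zero_add, Option.elim_some]
      change ∑ a, c a • W (((G' (some a)).map (σ (some (some τ)))).eval r) = 0
      simp_rw [hrow]
      funext o
      rcases o with _ | _ | i
      · simp only [Finset.sum_apply, Pi.smul_apply, W_none, Pi.zero_apply, smul_eq_mul]
        rw [← mul_zero (q : ℚ), ← hc2, Finset.mul_sum]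
        exact Finset.sum_congr rfl fun _ _ => by ring
      · simp [W_sn]
      · have := congrFun hc1 i
        simp only [Finset.sum_apply, Pi.smul_apply, W_ss, Pi.zero_apply, smul_eq_mul] at this ⊢
        rw [← mul_zero (q : ℚ), ← this, Finset.mul_sum]
        exact Finset.sum_congr rfl fun _ _ => by ring
  have hq0 : (q : ℚ) ≠ 0 := by exact_mod_cast hq.ne'
  have hY0 : ∀ a, Y a ≠ 0 := fun a h => by
    have := hY.transcendental a
    rw [h] at this
    exact this isAlgebraic_zero
  have hdet : D.term none G' none (algebraMap Ω L α₀) ≠ 0 := by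
    rw [hterm]
    intro h0
    obtain ⟨v, hv, hMv⟩ := Matrix.exists_mulVec_eq_zero_iff.2 h0
    apply hv
    have hrow : ∀ a, W (((G' (some a)).map (σ none)).eval (algebraMap Ω L α₀)) = Pi.single (some (some a)) (q : ℚ) := by
      intro a
      change W (((G a).map ((algebraMap Ω L).comp σt)).eval (algebraMap Ω L α₀)) = _
      rw [hevalΩ, hYα, map_pow, W_pow _ (by simpa using hY0 a)]
      funext o
      rcases o with _ | _ | i
      · simp [W_none, hWdΩ]
      · simp [W_sn]
      · simp only [Pi.smul_apply, W_ss, hWY]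
        by_cases h : i = a
        · subst h; simp
        · simp [h]
    have v1 : ∀ a, v (some (some a)) = 0 := by
      intro a
      have := congrFun hMv (some (some a))
      change dotProduct (W (((G' (some a)).map (σ none)).eval (algebraMap Ω L α₀))) v = 0 at this
      rw [hrow, single_dotProduct] at this
      simpa [hq0] using this
    have v2 : v (some none) = 0 := by
      have := congrFun hMv (some none)
      change dotProduct δ2 v = 0 at this
      simpa [δ2] using this
    have v3 : v none = 0 := by
      have := congrFun hMv none
      change dotProduct (W ε - W (t - t')) v = 0 at this
      simp only [dotProduct, Fintype.sum_option, v1, v2, mul_zero, Finset.sum_const_zero, add_zero] at this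
      rw [Pi.sub_apply, W_none, W_none, hWdε, ← map_sub, hWdΩ, sub_zero, one_mul] at this
      exact this
    funext o
    rcases o with _ | _ | i
    · exact v3
    · exact v2
    · exact v1 i
  have hTt : D.T none G' none ≠ 0 := by
    have hmem : algebraMap Ω L α₀ ∈ ((G' none).map (D.σ none)).roots := by
      change _ ∈ (p.map ((algebraMap Ω L).comp σt)).roots
      rw [hroots]
      refine Multiset.mem_map_of_mem _ ?_
      rw [Polynomial.mem_roots (by simpa using hp.ne_zero)]
      exact hα₀
    unfold NPData.T
    rw [Finset.sum_multiset_map_count, Finset.sum_eq_single (algebraMap Ω L α₀)]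
    · rw [nsmul_eq_mul]
      refine mul_ne_zero ?_ hdet
      exact_mod_cast (Multiset.count_pos.2 hmem).ne'
    · intro r hr hne
      have hr' : r ∈ (p.map ((algebraMap Ω L).comp σt)).roots := Multiset.mem_toFinset.1 hr
      rw [hroots] at hr'
      obtain ⟨r0, hr0, rfl⟩ := Multiset.mem_map.1 hr'
      obtain ⟨a, c, hc, hac⟩ := h1 r0 (Polynomial.isRoot_of_mem_roots hr0) (fun h => hne (by rw [h]))
      rw [hterm, hΨrow _ (some (some a)), smul_zero]
      change W (((G a).map ((algebraMap Ω L).comp σt)).eval _) = 0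
      rw [hevalΩ, hac, hWκ c hc]
    · intro h
      exact absurd (Multiset.mem_toFinset.2 hmem) h
  obtain ⟨P0, hP0⟩ := hmain
  have := hP0 (insert none P0) (Finset.subset_insert _ _)
  rw [Finset.sum_eq_single none] at this
  · exact hTt this
  · rintro (_ | _ | τ) _ h
    · exact absurd rfl h
    · exact hT'
    · exact hTτ τ
  · intro h
    exact absurd (Finset.mem_insert_self _ _) h

end CorePart
end PartCore

section PartCL
section CLPart
open Set

/-- the relative algebraic closure of the field generated by a set -/
def clF (F : Type*) {Ω : Type*} [Field F] [Field Ω] [Algebra F Ω] (S : Set Ω) : IntermediateField F Ω where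
  __ := (Subalgebra.algebraicClosure (Algebra.adjoin F S) Ω).restrictScalars F
  inv_mem' x hx := by
    have hx' : IsAlgebraic (Algebra.adjoin F S) x := hx
    exact hx'.inv

variable {F Ω : Type*} [Field F] [Field Ω] [Algebra F Ω]

lemma mem_clF {S : Set Ω} {x : Ω} : x ∈ clF F S ↔ IsAlgebraic (Algebra.adjoin F S) x := Iff.rfl

lemma coe_clF (S : Set Ω) : (clF F S : Set Ω) = (AlgebraicIndependent.matroid F Ω).closure S := by
  rw [AlgebraicIndependent.matroid_closure_eq]; rfl

lemma subset_clF (S : Set Ω) : S ⊆ clF F S := by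
  rw [coe_clF]; exact Matroid.subset_closure _ _ (by simp)

lemma clF_le {S T : Set Ω} (h : S ⊆ clF F T) : clF F S ≤ clF F T := by
  rw [← SetLike.coe_subset_coe, coe_clF, coe_clF]
  rw [coe_clF] at h
  exact Matroid.closure_subset_closure_of_subset_closure h

lemma clF_mono {S T : Set Ω} (h : S ⊆ T) : clF F S ≤ clF F T := clF_le (h.trans (subset_clF T))

lemma CL1 {ι ι' : Type*} [Fintype ι] [Fintype ι'] (a : ι → Ω) (b : ι' → Ω) (ha : AlgebraicIndependent F a)
    (h : ∀ i, a i ∈ clF F (range b)) : Fintype.card ι ≤ Fintype.card ι' := by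
  set M := AlgebraicIndependent.matroid F Ω
  have hI : M.Indep (range a) := ha.to_subtype_range
  have h1 : range a ⊆ M.closure (range b) := by
    rw [← coe_clF]; rintro _ ⟨i, rfl⟩; exact h i
  have h2 := M.eRk_mono h1
  rw [hI.eRk_eq_encard, Matroid.eRk_closure_eq] at h2
  have h3 := h2.trans (M.eRk_le_encard _)
  have e1 : (range a).encard = Fintype.card ι := by
    rw [← image_univ, ha.injective.encard_image, encard_univ, ENat.card_eq_coe_fintype_card]
  have e2 : (range b).encard ≤ Fintype.card ι' := by
    rw [← image_univ, ← ENat.card_eq_coe_fintype_card, ← encard_univ]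
    exact encard_image_le _ _
  rw [e1] at h3
  exact_mod_cast h3.trans e2

lemma CL2 {ι ι' : Type*} [Fintype ι] [Fintype ι'] (a : ι → Ω) (b : ι' → Ω) (ha : AlgebraicIndependent F a)
    (h : ∀ i, a i ∈ clF F (range b)) (hc : Fintype.card ι' ≤ Fintype.card ι) : AlgebraicIndependent F b := by
  classical
  set M := AlgebraicIndependent.matroid F Ω
  obtain ⟨B, hB⟩ := M.exists_isBasis (range b) (by simp [M])
  have hBI : AlgebraicIndependent F (Subtype.val : B → Ω) := hB.indep
  have hBs : B ⊆ range b := hB.subset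
  choose f hf using fun x : B => hBs x.2
  have hfin : Function.Injective f := fun x y hxy => Subtype.ext (by rw [← hf x, hxy, hf y])
  haveI : Fintype B := Fintype.ofInjective f hfin
  have h1 := CL1 a (Subtype.val : B → Ω) ha (fun i => by
    rw [Subtype.range_coe, ← SetLike.mem_coe, coe_clF, hB.closure_eq_closure, ← coe_clF]; exact h i)
  have hbij : Function.Bijective f := (Fintype.bijective_iff_injective_and_card f).2
    ⟨hfin, le_antisymm (Fintype.card_le_of_injective f hfin) (hc.trans h1)⟩
  let e := Equiv.ofBijective f hbij
  have : b = (Subtype.val : B → Ω) ∘ e.symm := by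
    funext i
    have := hf (e.symm i)
    rw [Function.comp, ← this]
    congr 1
    exact (e.apply_symm_apply i).symm
  rw [this]
  exact hBI.comp _ e.symm.injective

end CLPart
end PartCL

section PartCnt
section CntPart
open Set

variable {F Ω : Type*} [Field F] [Field Ω] [Algebra F Ω]

lemma lin_mem {N : ℕ} (T : IntermediateField F Ω) (A x : Fin (N + 1) → Ω) (i : Fin (N + 1))
    (hx : ∀ b, x b ∈ T) (hA : ∀ b, b ≠ i → A b ∈ T) (h : ∑ b, A b * x b ∈ T) : A i * x i ∈ T := by
  classical
  rw [← Finset.add_sum_erase _ _ (Finset.mem_univ i)] at h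
  have h2 : ∑ b ∈ Finset.univ.erase i, A b * x b ∈ T :=
    sum_mem fun b hb => mul_mem (hA b (Finset.ne_of_mem_erase hb)) (hx b)
  have := sub_mem h h2
  simpa using this

lemma lin_mem2 {N : ℕ} (T : IntermediateField F Ω) (A x z : Fin (N + 1) → Ω) (hx0 : x 0 = 1) (hz0 : z 0 = 1)
    (i : Fin (N + 1)) (hi : x i ≠ z i)
    (hx : ∀ b, x b ∈ T) (hz : ∀ b, z b ∈ T) (hA : ∀ b, b ≠ 0 → b ≠ i → A b ∈ T)
    (h : ∑ b, A b * x b ∈ T) (h' : ∑ b, A b * z b ∈ T) : ∀ b, A b ∈ T := by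
  have h1 : ∑ b, A b * (x b - z b) ∈ T := by
    have := sub_mem h h'
    simpa [mul_sub, Finset.sum_sub_distrib] using this
  have h2 : A i * (x i - z i) ∈ T := by
    classical
    rw [← Finset.add_sum_erase _ _ (Finset.mem_univ i)] at h1
    have h2 : ∑ b ∈ Finset.univ.erase i, A b * (x b - z b) ∈ T := by
      refine sum_mem fun b hb => ?_
      by_cases hb0 : b = 0
      · rw [hb0, hx0, hz0]; simp
      · exact mul_mem (hA b hb0 (Finset.ne_of_mem_erase hb)) (sub_mem (hx b) (hz b))
    have := sub_mem h1 h2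
    simpa using this
  have h3 : A i ∈ T := by
    have := div_mem h2 (sub_mem (hx i) (hz i))
    rwa [mul_div_cancel_right₀ _ (sub_ne_zero.2 hi)] at this
  have h4 : ∀ b, b ≠ 0 → A b ∈ T := fun b hb => by
    by_cases h : b = i
    · rw [h]; exact h3
    · exact hA b hb h
  intro b
  by_cases hb : b = 0
  · have := lin_mem T A x 0 hx h4 h
    rw [hx0, mul_one] at this
    rw [hb]; exact this
  · exact h4 b hb

lemma count_base {N j n : ℕ} {ι : Type*} [Fintype ι] (D : ι → Ω) (hD : AlgebraicIndependent F D)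
    (A : Fin j → Fin (N + 1) → Ω) (x : Fin (N + 1) → Ω) (hx0 : x 0 = 1)
    (y : Fin (n + 1) → Ω) (hy0 : y 0 = 1) (hyx : ∀ b, ∃ i, y i = x b) (hyA : ∀ a, ∃ i, y i = ∑ b, A a b * x b)
    (hgen : ∀ T : IntermediateField F Ω, (∀ i, y i ∈ T) → (∀ a b, A a b ∈ T) → ∀ i, D i ∈ T)
    (hn : n + j * N ≤ Fintype.card ι) : AlgebraicIndependent F (fun a : Fin n => y a.succ) := by
  classical
  let B : Fin n ⊕ (Fin j × Fin N) → Ω := Sum.elim (fun a => y a.succ) (fun p => A p.1 p.2.succ)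
  have hBm : ∀ i, B i ∈ clF F (range B) := fun i => subset_clF _ ⟨i, rfl⟩
  have hy : ∀ i, y i ∈ clF F (range B) := by
    intro i
    refine Fin.cases ?_ (fun a => hBm (Sum.inl a)) i
    rw [hy0]; exact one_mem _
  have hx : ∀ b, x b ∈ clF F (range B) := fun b => by
    obtain ⟨i, hi⟩ := hyx b; rw [← hi]; exact hy i
  have hA1 : ∀ a b, b ≠ 0 → A a b ∈ clF F (range B) := by
    intro a b hb
    obtain ⟨b', rfl⟩ := Fin.exists_succ_eq.2 hb
    exact hBm (Sum.inr (a, b'))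
  have hA : ∀ a b, A a b ∈ clF F (range B) := by
    intro a b
    by_cases hb : b = 0
    · obtain ⟨i, hi⟩ := hyA a
      have := lin_mem (clF F (range B)) (A a) x 0 hx (hA1 a) (by rw [← hi]; exact hy i)
      rw [hx0, mul_one] at this
      rw [hb]; exact this
    · exact hA1 a b hb
  have hBI := CL2 D B hD (hgen _ hy hA) (by simpa using hn)
  exact hBI.comp Sum.inl Sum.inl_injective

lemma count_step {N j n : ℕ} {ι ιU : Type*} [Fintype ι] [Fintype ιU] (D : ι → Ω) (hD : AlgebraicIndependent F D)
    (U : ιU → Ω)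
    (A : Fin j → Fin (N + 1) → Ω) (x z : Fin (N + 1) → Ω) (hx0 : x 0 = 1) (hz0 : z 0 = 1)
    (y w : Fin (n + 1) → Ω) (hy0 : y 0 = 1)
    (e1 : Fin (N + 1) → Fin (n + 1)) (e2 : Fin j → Fin (n + 1))
    (hyx : ∀ b, y (e1 b) = x b) (hyA : ∀ a, y (e2 a) = ∑ b, A a b * x b)
    (hwx : ∀ b, w (e1 b) = z b) (hwA : ∀ a, w (e2 a) = ∑ b, A a b * z b)
    (i₀ : Fin (N + 1)) (hi₀ : x i₀ ≠ z i₀)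
    (hgen : ∀ T : IntermediateField F Ω, (∀ i, y i ∈ T) → (∀ a b, A a b ∈ T) → (∀ b, z b ∈ T) → ∀ i, D i ∈ T)
    (hw : ∀ i, w i ∈ clF F (range (Sum.elim U (fun a : Fin n => y a.succ)))) :
    Fintype.card ι + j ≤ Fintype.card ιU + n + j * N := by
  classical
  let B : (ιU ⊕ Fin n) ⊕ (Fin j × {b : Fin (N + 1) // b ∉ ({0, i₀} : Finset (Fin (N + 1)))}) → Ω :=
    Sum.elim (Sum.elim U (fun a => y a.succ)) (fun p => A p.1 p.2.1)
  have hBm : ∀ i, B i ∈ clF F (range B) := fun i => subset_clF _ ⟨i, rfl⟩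
  have hw' : ∀ i, w i ∈ clF F (range B) := fun i => by
    refine clF_mono ?_ (hw i)
    rintro _ ⟨i, rfl⟩
    exact ⟨Sum.inl i, rfl⟩
  have hy : ∀ i, y i ∈ clF F (range B) := by
    intro i
    refine Fin.cases ?_ (fun a => hBm (Sum.inl (Sum.inr a))) i
    rw [hy0]; exact one_mem _
  have hx : ∀ b, x b ∈ clF F (range B) := fun b => by rw [← hyx]; exact hy _
  have hz : ∀ b, z b ∈ clF F (range B) := fun b => by rw [← hwx]; exact hw' _
  have hA : ∀ a b, A a b ∈ clF F (range B) := by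
    intro a
    refine lin_mem2 _ (A a) x z hx0 hz0 i₀ hi₀ hx hz (fun b hb hb' => ?_) (by rw [← hyA]; exact hy _)
      (by rw [← hwA]; exact hw' _)
    exact hBm (Sum.inr (a, ⟨b, by simp [hb, hb']⟩))
  have := CL1 D B hD (hgen _ hy hA hz)
  have hi0 : i₀ ≠ 0 := by rintro rfl; exact hi₀ (by rw [hx0, hz0])
  have hcard : Fintype.card {b : Fin (N + 1) // b ∉ ({0, i₀} : Finset (Fin (N + 1)))} = N - 1 := by
    rw [Fintype.card_subtype, Finset.filter_notMem_eq_sdiff, Finset.card_sdiff_of_subset (Finset.subset_univ _), Finset.card_pair hi0.symm]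
    simp
  have hN : 1 ≤ N := by
    rcases Nat.eq_zero_or_pos N with h | h
    · subst h; exact absurd (Subsingleton.elim (α := Fin 1) _ _) hi0
    · exact h
  simp only [Fintype.card_sum, Fintype.card_prod, hcard, Fintype.card_fin] at this
  have h5 : j * (N - 1) + j = j * N := by
    obtain ⟨m, rfl⟩ := Nat.exists_eq_add_of_le' hN
    simp; ring
  omega

/-- greedy selection -/
lemma greedy {n : ℕ} {R : Type*} (Y : Fin n → Ω) (w : R → Fin (n + 1) → Ω) (l : List R) (m : ℕ)
    (ι₀ : Type) [Fintype ι₀] (hcard : Fintype.card ι₀ ≤ m) (U₀ : ι₀ → Ω) (hU₀ : AlgebraicIndependent F (Sum.elim U₀ Y))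
    (step : ∀ r ∈ l, ∀ (ι : Type) [Fintype ι] (U : ι → Ω), Fintype.card ι < m + l.length → 
      AlgebraicIndependent F (Sum.elim U Y) → ∃ i, w r i ∉ clF F (range (Sum.elim U Y))) :
    ∃ (ι : Type) (_ : Fintype ι) (U : ι → Ω), Fintype.card ι ≤ m + l.length ∧ range U₀ ⊆ range U ∧
      AlgebraicIndependent F (Sum.elim U Y) ∧ ∀ r ∈ l, ∃ i u, w r i = U u := by
  induction l generalizing m ι₀ with
  | nil => exact ⟨ι₀, inferInstance, U₀, by simpa using hcard, subset_rfl, hU₀, by simp⟩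
  | cons r l ih =>
    obtain ⟨i, hi⟩ := step r (by simp) ι₀ U₀ (by simp; omega) hU₀
    let U₁ : Option ι₀ → Ω := fun o => o.elim (w r i) U₀
    have h1 : AlgebraicIndependent F (fun o : Option (ι₀ ⊕ Fin n) => o.elim (w r i) (Sum.elim U₀ Y)) :=
      (hU₀.option_iff_transcendental _).2 hi
    have h2 : AlgebraicIndependent F (Sum.elim U₁ Y) := by
      let f : Option ι₀ ⊕ Fin n → Option (ι₀ ⊕ Fin n) :=
        Sum.elim (fun o => o.elim none (fun a => some (Sum.inl a))) (fun a => some (Sum.inr a))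
      have hf : Function.Injective f := by
        rintro ((_ | a) | a) ((_ | b) | b) h
        · rfl
        · exact absurd h.symm (Option.some_ne_none _)
        · exact absurd h.symm (Option.some_ne_none _)
        · exact absurd h (Option.some_ne_none _)
        · have h3 : a = b := Sum.inl.inj (Option.some.inj h)
          rw [h3]
        · exact absurd (Option.some.inj h) Sum.inl_ne_inr
        · exact absurd h (Option.some_ne_none _)
        · exact absurd (Option.some.inj h) Sum.inr_ne_inl
        · have h3 : a = b := Sum.inr.inj (Option.some.inj h)
          rw [h3]
      convert h1.comp f hf using 1
      funext o
      rcases o with (_ | a) | a <;> rfl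
    obtain ⟨ι, hι, U, hc, hsub, hU, hr⟩ := ih (m + 1) (Option ι₀) (by simpa using hcard) U₁ h2
      (fun r' hr' ι _ U hc hU => step r' (by simp [hr']) ι U (by simp at hc ⊢; omega) hU)
    refine ⟨ι, hι, U, by simp at hc ⊢; omega, fun x hx => hsub ?_, hU, ?_⟩
    · obtain ⟨a, rfl⟩ := hx
      exact ⟨some a, rfl⟩
    · intro r' hr'
      rcases List.mem_cons.1 hr' with rfl | h
      · obtain ⟨u, hu⟩ := hsub ⟨none, rfl⟩
        exact ⟨i, u, hu.symm⟩
      · exact hr r' h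

end CntPart
end PartCnt

section PartPrim
section PrimPart
open Module

lemma prim_elt {K₀ Q ι : Type*} [Field K₀] [Field Q] [Algebra K₀ Q] [Algebra.IsAlgebraic K₀ Q] [Fintype ι]
    (Fx : IntermediateField K₀ Q) [FiniteDimensional K₀ Fx] (x : ι → Q) (hx : ∀ b, x b ∈ Fx) :
    ∃ (p n : ℕ) (_ : ExpChar Q p) (α : Q), (minpoly K₀ α).natDegree ≤ finrank K₀ Fx ∧
      α ∈ IntermediateField.adjoin K₀ (Set.range fun b => x b ^ p ^ n) ∧
      ∀ z ∈ IntermediateField.adjoin K₀ (Set.range fun b => x b ^ p ^ n), ∃ G : Polynomial K₀, Polynomial.aeval α G = z := by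
  classical
  obtain ⟨p, hp⟩ := ExpChar.exists K₀
  haveI : ExpChar Q p := expChar_of_injective_algebraMap (algebraMap K₀ Q).injective p
  haveI : ExpChar (separableClosure K₀ Q) p := expChar_of_injective_algebraMap (algebraMap K₀ (separableClosure K₀ Q)).injective p
  choose m hm using fun b => IsPurelyInseparable.pow_mem (separableClosure K₀ Q) p (x b)
  let n := Finset.univ.sup m
  have hsep : ∀ b, x b ^ p ^ n ∈ separableClosure K₀ Q := by
    intro b
    have h1 : m b ≤ n := Finset.le_sup (Finset.mem_univ b)
    obtain ⟨t, ht⟩ := hm b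
    obtain ⟨l, hl⟩ := Nat.exists_eq_add_of_le h1
    rw [hl, pow_add, pow_mul, ← ht]
    exact pow_mem t.2 _
  let M := IntermediateField.adjoin K₀ (Set.range fun b => x b ^ p ^ n)
  have hMs : M ≤ separableClosure K₀ Q := by
    rw [IntermediateField.adjoin_le_iff]
    rintro _ ⟨b, rfl⟩
    exact hsep b
  have hMF : M ≤ Fx := by
    rw [IntermediateField.adjoin_le_iff]
    rintro _ ⟨b, rfl⟩
    exact pow_mem (hx b) _
  haveI : Algebra.IsSeparable K₀ M := (le_separableClosure_iff _ _ _).1 hMs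
  have hinj : Function.Injective (IntermediateField.inclusion hMF).toLinearMap := (IntermediateField.inclusion hMF).injective
  haveI : FiniteDimensional K₀ M := FiniteDimensional.of_injective (IntermediateField.inclusion hMF).toLinearMap hinj
  have hle : finrank K₀ M ≤ finrank K₀ Fx := LinearMap.finrank_le_finrank_of_injective hinj
  obtain ⟨α, hα⟩ := Field.exists_primitive_element K₀ M
  have h_integ : IsIntegral K₀ (α : Q) := (Algebra.IsAlgebraic.isAlgebraic (α : Q)).isIntegral
  have hM : IntermediateField.adjoin K₀ {(α : Q)} = M := by
    rw [← IntermediateField.lift_adjoin_simple, hα, IntermediateField.lift_top]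
  refine ⟨p, n, inferInstance, α, ?_, α.2, ?_⟩
  · rw [← IntermediateField.adjoin.finrank h_integ, hM]; exact hle
  · intro z hz
    have hz' : z ∈ (IntermediateField.adjoin K₀ {(α : Q)}).toSubalgebra := by rw [hM]; exact hz
    rw [IntermediateField.adjoin_simple_toSubalgebra_of_isAlgebraic h_integ.isAlgebraic] at hz'
    exact Algebra.adjoin_mem_exists_aeval _ _ hz'

end PrimPart
end PartPrim

section PartTr
section TrPart
open Set

lemma alg_trans {K R Ω : Type*} [CommRing K] [IsDomain K] [CommRing R] [Field Ω] [Algebra K Ω] [FaithfulSMul K Ω]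
    (i : R →+* Ω) (h : ∀ r, IsAlgebraic K (i r)) (p : Polynomial R) (hp : p.map i ≠ 0) (x : Ω) (hx : p.eval₂ i x = 0) :
    IsAlgebraic K x := by
  let A := Subalgebra.algebraicClosure K Ω
  let i' : R →+* A := i.codRestrict A (fun r => h r)
  have h1 : IsAlgebraic A x := by
    refine ⟨p.map i', ?_, ?_⟩
    · intro h0
      apply hp
      have : i = (algebraMap A Ω).comp i' := rfl
      rw [this, ← Polynomial.map_map, h0, Polynomial.map_zero]
    · rw [Polynomial.aeval_def, Polynomial.eval₂_map]
      exact hx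
  exact h1.restrictScalars K

lemma mem_clF_map {F Q Ω : Type*} [Field F] [Field Q] [Field Ω] [Algebra F Q] [Algebra F Ω] (φ : Q →ₐ[F] Ω) {S : Set Q} {x : Q}
    (hx : x ∈ clF F S) : φ x ∈ clF F (φ '' S) := by
  obtain ⟨p, hp, hpx⟩ := mem_clF.1 hx
  let i : Algebra.adjoin F S →+* Ω := φ.toRingHom.comp (algebraMap _ Q)
  have hi : Function.Injective i := φ.toRingHom.injective.comp (FaithfulSMul.algebraMap_injective _ _)
  refine mem_clF.2 (alg_trans i ?_ p ?_ _ ?_)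
  · intro r
    have : i r ∈ Algebra.adjoin F (φ '' S) := by
      rw [← AlgHom.map_adjoin]
      exact ⟨r, r.2, rfl⟩
    exact isAlgebraic_algebraMap (⟨_, this⟩ : Algebra.adjoin F (φ '' S))
  · exact (Polynomial.map_ne_zero_iff hi).2 hp
  · have := congrArg φ hpx
    rw [map_zero, Polynomial.aeval_def] at this
    rw [← this]
    exact (Polynomial.hom_eval₂ p _ φ.toRingHom x).symm

lemma clF_to_alg {F Q Ω : Type*} [Field F] [Field Q] [Field Ω] [Algebra F Q] [Algebra F Ω] [Algebra Q Ω] [IsScalarTower F Q Ω]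
    {S : Set Ω} (hS : S ⊆ range (algebraMap Q Ω)) {x : Ω} (hx : x ∈ clF F S) : IsAlgebraic Q x := by
  obtain ⟨p, hp, hpx⟩ := mem_clF.1 hx
  refine alg_trans (algebraMap (Algebra.adjoin F S) Ω) ?_ p
    ((Polynomial.map_ne_zero_iff (FaithfulSMul.algebraMap_injective _ _)).2 hp) x hpx
  intro r
  have h1 : Algebra.adjoin F S ≤ (IsScalarTower.toAlgHom F Q Ω).range := Algebra.adjoin_le (by
    intro s hs
    obtain ⟨w, hw⟩ := hS hs
    exact ⟨w, hw⟩)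
  obtain ⟨w, hw⟩ := h1 r.2
  have hw' : algebraMap Q Ω w = algebraMap (Algebra.adjoin F S) Ω r := hw
  rw [← hw']
  exact isAlgebraic_algebraMap w

/-- images of nonconstant elements under a generic embedding are transcendental -/
lemma generic_image {E Q Ω : Type*} [Field E] [IsAlgClosed E] [Field Q] [Field Ω] [Algebra (RatFunc E) Q]
    [Algebra.IsAlgebraic (RatFunc E) Q] [Algebra Q Ω] (φ : Q →+* Ω)
    (hφ : ∀ c : E, φ (algebraMap _ Q (RatFunc.C c)) = algebraMap Q Ω (algebraMap _ Q (RatFunc.C c)))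
    (hT : Transcendental Q (φ (algebraMap (RatFunc E) Q RatFunc.X))) (x : Q) (hx : ∀ c : E, x ≠ algebraMap _ Q (RatFunc.C c)) :
    Transcendental Q (φ x) := by
  intro hz
  letI : Algebra E Q := ((algebraMap (RatFunc E) Q).comp RatFunc.C).toAlgebra
  have hEQ : ∀ c, algebraMap E Q c = algebraMap _ Q (RatFunc.C c) := fun _ => rfl
  letI : Algebra E Ω := ((algebraMap Q Ω).comp (algebraMap E Q)).toAlgebra
  haveI : IsScalarTower E Q Ω := IsScalarTower.of_algebraMap_eq fun _ => rfl
  let φ' : Q →ₐ[E] Ω := { φ with commutes' := hφ }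
  set T : Q := algebraMap (RatFunc E) Q RatFunc.X with hTdef
  -- x is not algebraic over E
  have h1 : x ∉ clF E (∅ : Set Q) := by
    intro h
    obtain ⟨p, hp, hpx⟩ := mem_clF.1 h
    have h2 : IsAlgebraic E x := by
      refine alg_trans (algebraMap (Algebra.adjoin E (∅ : Set Q)) Q) ?_ p
        ((Polynomial.map_ne_zero_iff (FaithfulSMul.algebraMap_injective _ _)).2 hp) x hpx
      intro r
      have hr : ∀ w ∈ Algebra.adjoin E (∅ : Set Q), ∃ c, algebraMap E Q c = w := by
        intro w hw
        rw [Algebra.adjoin_empty, Algebra.mem_bot] at hw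
        exact hw
      obtain ⟨c, hc⟩ := hr _ r.2
      have : algebraMap (Algebra.adjoin E (∅ : Set Q)) Q r = algebraMap E Q c := hc.symm
      rw [this]
      exact isAlgebraic_algebraMap c
    haveI := IntermediateField.isAlgebraic_adjoin_simple h2.isIntegral
    haveI : Algebra.IsIntegral E (IntermediateField.adjoin E {x}) := Algebra.IsAlgebraic.isIntegral
    obtain ⟨c, hc⟩ := (IsAlgClosed.algebraMap_bijective_of_isIntegral (k := E) (K := IntermediateField.adjoin E {x})).2
      ⟨x, IntermediateField.mem_adjoin_simple_self E x⟩
    exact hx c (congrArg Subtype.val hc).symm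
  have hTm : T ∈ clF E {T} := subset_clF _ (mem_singleton _)
  have h2 : x ∈ clF E {T} := by
    obtain ⟨p, hp, hpx⟩ := Algebra.IsAlgebraic.isAlgebraic (R := RatFunc E) x
    refine mem_clF.2 (alg_trans (algebraMap (RatFunc E) Q) ?_ p
      ((Polynomial.map_ne_zero_iff (algebraMap (RatFunc E) Q).injective).2 hp) x hpx)
    intro r
    rw [← mem_clF, ← RatFunc.num_div_denom r, map_div₀]
    have : ∀ P : Polynomial E, algebraMap (RatFunc E) Q (algebraMap _ _ P) ∈ clF E {T} := by
      intro P
      induction P using Polynomial.induction_on' with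
      | add p q hp hq => rw [map_add, map_add]; exact add_mem hp hq
      | monomial n a =>
        rw [← Polynomial.C_mul_X_pow_eq_monomial, map_mul, map_mul, map_pow, map_pow, RatFunc.algebraMap_X, RatFunc.algebraMap_C]
        exact mul_mem ((clF E {T}).algebraMap_mem a) (pow_mem hTm _)
    exact div_mem (this _) (this _)
  have h3 : T ∈ clF E {x} := by
    rw [← SetLike.mem_coe, coe_clF] at h1 h2 ⊢
    have := Matroid.closure_exchange (M := AlgebraicIndependent.matroid E Q) (X := ∅) (e := x) (f := T)
      ⟨by simpa using h2, h1⟩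
    simpa using this.1
  have h4 := mem_clF_map φ' h3
  rw [image_singleton] at h4
  -- hence the image of T is algebraic over Q
  apply hT
  obtain ⟨p, hp, hpx⟩ := mem_clF.1 h4
  refine alg_trans (algebraMap (Algebra.adjoin E {φ' x}) Ω) ?_ p
    ((Polynomial.map_ne_zero_iff (FaithfulSMul.algebraMap_injective _ _)).2 hp) _ hpx
  intro r
  have h5 : Algebra.adjoin E {φ' x} ≤ (Subalgebra.algebraicClosure Q Ω).restrictScalars E := by
    rw [Algebra.adjoin_le_iff, singleton_subset_iff]
    exact hz
  exact h5 r.2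

end TrPart
end PartTr

section PartAsm
section AsmPart
open Set Module

lemma eval_root_hom {K₀ Q Ω : Type*} [Field K₀] [Field Q] [Field Ω] [Algebra K₀ Q] (σ : K₀ →+* Ω) (φ : Q →+* Ω)
    (h : ∀ c, φ (algebraMap K₀ Q c) = σ c) (α : Q) (P : Polynomial K₀) :
    (P.map σ).eval (φ α) = φ (Polynomial.aeval α P) := by
  rw [Polynomial.eval_map, Polynomial.aeval_def, Polynomial.hom_eval₂]
  congr 1
  ext c; exact (h c).symm

/-- Part IV: the contradiction, in abstract form -/
theorem asm1 {N j n e : ℕ} {F E Q Ω L ι : Type*} [Field F] [Field E] [Field Q] [Field Ω] [Field L] [Fintype ι]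
    [IsAlgClosed E] [IsAlgClosed Ω] [IsAlgClosed L] [Algebra F E] [Algebra F Q] [Algebra (RatFunc E) Q]
    [Algebra.IsAlgebraic (RatFunc E) Q] [Algebra Q Ω] [Algebra F Ω] [IsScalarTower F Q Ω] [Algebra E Ω] [Algebra Ω L]
    (hFQ : ∀ c, algebraMap F Q c = algebraMap (RatFunc E) Q (RatFunc.C (algebraMap F E c)))
    (hEΩ : ∀ c, algebraMap E Ω c = algebraMap Q Ω (algebraMap (RatFunc E) Q (RatFunc.C c)))
    (t' : Ω) (ht' : Transcendental Q t')
    (ε : L) (hε : Transcendental Ω ε) (halg : ∀ x : L, IsAlgebraic (IntermediateField.adjoin Ω {ε}) x)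
    (hn : n = N + j) (hej : 2 * e = j + 2)
    (A : Fin j → Fin (N + 1) → E) (x : Fin (N + 1) → Q) (hx0 : x 0 = 1)
    (y : Fin (n + 1) → Q) (hy0 : y 0 = 1) (hy : ∀ i, y i ≠ 0)
    (e1 : Fin (N + 1) → Fin (n + 1)) (e2 : Fin j → Fin (n + 1)) (he : ∀ i, (∃ b, e1 b = i) ∨ ∃ a, e2 a = i)
    (hyx : ∀ b, y (e1 b) = x b)
    (hyA : ∀ a, y (e2 a) = ∑ b, algebraMap (RatFunc E) Q (RatFunc.C (A a b)) * x b)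
    (D : ι → Q) (hD : AlgebraicIndependent F D) (hcard : Fintype.card ι = n + j * N)
    (hgen : ∀ T : IntermediateField F Q, (∀ i, y i ∈ T) → (∀ a b, algebraMap (RatFunc E) Q (RatFunc.C (A a b)) ∈ T) →
      ∀ i, D i ∈ T)
    (Fx : IntermediateField (RatFunc E) Q) [FiniteDimensional (RatFunc E) Fx] (hFx : finrank (RatFunc E) Fx ≤ e)
    (hxF : ∀ b, x b ∈ Fx) (b₀ : Fin (N + 1)) (hb₀ : ∀ c : E, x b₀ ≠ algebraMap (RatFunc E) Q (RatFunc.C c))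
    (heq : ∀ i, ∃ (d : ℕ) (μ : Fin (n + 1) →₀ ℕ) (g : MvPolynomial (Fin (n + 1)) F) (s : E),
      μ.degree = d ∧ μ i ≠ 0 ∧ g.IsHomogeneous d ∧ (∀ l, g.coeff (Finsupp.single l d) ≠ 0) ∧ s ≠ 0 ∧
      ∏ l, y l ^ μ l + algebraMap (RatFunc E) Q (RatFunc.C s) *
        g.eval₂ ((algebraMap (RatFunc E) Q).comp (RatFunc.C.comp (algebraMap F E))) y = 0) : False := by
  classical
  set jE : E →+* Q := (algebraMap (RatFunc E) Q).comp RatFunc.C with hjE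
  have hjE' : ∀ c, algebraMap (RatFunc E) Q (RatFunc.C c) = jE c := fun _ => rfl
  obtain ⟨p, m, hp, α, hdeg, hα, hadj⟩ := prim_elt Fx x hxF
  set q := p ^ m with hq
  have hq0 : 0 < q := pow_pos (expChar_pos Q p) m
  set π := minpoly (RatFunc E) α with hπ
  have h_integ : IsIntegral (RatFunc E) α := (Algebra.IsAlgebraic.isAlgebraic (R := RatFunc E) α).isIntegral
  have hirr : Irreducible π := minpoly.irreducible h_integ
  have hπα : Polynomial.aeval α π = 0 := minpoly.aeval _ _
  set Aq := IntermediateField.adjoin (RatFunc E) (range fun b => x b ^ q) with hAq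
  have hxq : ∀ b, x b ^ q ∈ Aq := fun b => IntermediateField.subset_adjoin _ _ ⟨b, rfl⟩
  have hyq : ∀ i, y i ^ q ∈ Aq := by
    intro i
    rcases he i with ⟨b, rfl⟩ | ⟨a, rfl⟩
    · rw [hyx]; exact hxq b
    · rw [hyA, hq, sum_pow_char_pow p m]
      refine sum_mem fun b _ => ?_
      rw [mul_pow, ← map_pow]
      exact mul_mem (Aq.algebraMap_mem _) (hxq b)
  choose G' hG' using fun i => hadj _ (hyq i)
  let G : Fin n → Polynomial (RatFunc E) := fun a => G' a.succ
  have hG : ∀ a, Polynomial.aeval α (G a) = y a.succ ^ q := fun a => hG' a.succ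
  -- the two specialisations
  let jQ : Q →+* Ω := algebraMap Q Ω
  let σt : RatFunc E →+* Ω := jQ.comp (algebraMap (RatFunc E) Q)
  have hσt : ∀ c, σt (RatFunc.C c) = algebraMap E Ω c := fun c => (hEΩ c).symm
  obtain ⟨σt', hσt', hσX⟩ := ratfunc_hom (algebraMap E Ω) t' (by
    intro P hP h0
    apply ht'
    refine ⟨P.map jE, (Polynomial.map_ne_zero_iff jE.injective).2 hP, ?_⟩
    rw [Polynomial.aeval_def, Polynomial.eval₂_map, ← h0]
    congr 1
    ext c; exact (hEΩ c).symm)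
  have htt' : σt RatFunc.X ≠ σt' RatFunc.X := by
    rw [hσX]
    intro h
    apply ht'
    rw [← h]
    exact isAlgebraic_algebraMap (algebraMap (RatFunc E) Q RatFunc.X)
  set α₀ : Ω := jQ α with hα₀d
  have hα₀ : (π.map σt).eval α₀ = 0 := by
    rw [eval_root_hom σt jQ (fun _ => rfl), hπα, map_zero]
  -- embeddings attached to roots
  have hex1 : ∀ r, ∃ φ : Q →+* Ω, (π.map σt).eval r = 0 → (∀ c, φ (algebraMap _ Q c) = σt c) ∧ φ α = r := by
    intro r
    by_cases hr : (π.map σt).eval r = 0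
    · obtain ⟨φ, h⟩ := exists_root_hom σt α π hirr hπα r hr
      exact ⟨φ, fun _ => h⟩
    · exact ⟨jQ, fun h => absurd h hr⟩
  have hex2 : ∀ r, ∃ φ : Q →+* Ω, (π.map σt').eval r = 0 → (∀ c, φ (algebraMap _ Q c) = σt' c) ∧ φ α = r := by
    intro r
    by_cases hr : (π.map σt').eval r = 0
    · obtain ⟨φ, h⟩ := exists_root_hom σt' α π hirr hπα r hr
      exact ⟨φ, fun _ => h⟩
    · exact ⟨jQ, fun h => absurd h hr⟩
  choose φ1 hφ1 using hex1
  choose φ2 hφ2 using hex2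
  -- generation in Ω
  let jF : Q →ₐ[F] Ω := IsScalarTower.toAlgHom F Q Ω
  have hjF : ∀ c, jF c = jQ c := fun _ => rfl
  have hgenΩ : ∀ T : IntermediateField F Ω, (∀ i, jQ (y i) ∈ T) → (∀ a b, jQ (jE (A a b)) ∈ T) → ∀ i, jQ (D i) ∈ T := by
    intro T h1 h2 i
    exact hgen (T.comap jF) h1 h2 i
  have hDΩ : AlgebraicIndependent F (fun i => jQ (D i)) := hD.map' (f := jF) jF.toRingHom.injective
  let YY : Fin (n + 1) → Ω := fun i => jQ (y i)
  let Y : Fin n → Ω := fun a => YY a.succ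
  have hYX : ∀ b, YY (e1 b) = jQ (x b) := fun b => congrArg jQ (hyx b)
  have hYA : ∀ a, YY (e2 a) = ∑ b, jQ (jE (A a b)) * jQ (x b) := fun a => by
    change jQ _ = _
    rw [hyA, map_sum]; simp only [map_mul]; rfl
  have hX0 : jQ (x 0) = 1 := by rw [hx0, map_one]
  have hYY0 : YY 0 = 1 := by change jQ _ = _; rw [hy0, map_one]
  have hY : AlgebraicIndependent F Y :=
    count_base (fun i => jQ (D i)) hDΩ (fun a b => jQ (jE (A a b))) (fun b => jQ (x b)) hX0 YY hYY0
      (fun b => ⟨e1 b, hYX b⟩) (fun a => ⟨e2 a, hYA a⟩) hgenΩ hcard.ge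
  have hY' : AlgebraicIndependent F (Sum.elim (Empty.elim : Empty → Ω) Y) := by
    have := (algebraicIndependent_equiv (R := F) (Equiv.emptySum Empty (Fin n)) (f := Y)).2 hY
    convert this using 1
    funext i
    rcases i with i | i
    · exact i.elim
    · rfl
  have hwA : ∀ φ : Q →+* Ω, (∀ c, φ (jE c) = jQ (jE c)) → ∀ a, φ (y (e2 a)) = ∑ b, jQ (jE (A a b)) * φ (x b) := by
    intro φ hφ a
    rw [hyA, map_sum]
    refine Finset.sum_congr rfl fun b _ => ?_
    rw [map_mul, hjE', hφ]
  have he1 : 1 ≤ e := by omega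
  have hdege : π.natDegree ≤ e := hdeg.trans hFx
  -- first list
  let l1 : List Ω := ((π.map σt).roots.toFinset.erase α₀).toList
  have hσπ : π.map σt ≠ 0 := (Polynomial.map_ne_zero_iff σt.injective).2 hirr.ne_zero
  have hσπ' : π.map σt' ≠ 0 := (Polynomial.map_ne_zero_iff σt'.injective).2 hirr.ne_zero
  have hl1 : ∀ r, r ∈ l1 ↔ (π.map σt).eval r = 0 ∧ r ≠ α₀ := by
    intro r
    simp only [l1, Finset.mem_toList, Finset.mem_erase, Multiset.mem_toFinset, Polynomial.mem_roots hσπ,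
      Polynomial.IsRoot.def, and_comm]
  have hl1len : l1.length ≤ e - 1 := by
    simp only [l1, Finset.length_toList]
    rw [Finset.card_erase_of_mem (by
      rw [Multiset.mem_toFinset, Polynomial.mem_roots hσπ]; exact hα₀)]
    have h1 := Multiset.toFinset_card_le (π.map σt).roots
    have h2 := Polynomial.card_roots' (π.map σt)
    rw [Polynomial.natDegree_map] at h2
    omega
  let l2 : List Ω := (π.map σt').roots.toFinset.toList
  have hl2 : ∀ r, r ∈ l2 ↔ (π.map σt').eval r = 0 := by
    intro r
    simp only [l2, Finset.mem_toList, Multiset.mem_toFinset, Polynomial.mem_roots hσπ',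
      Polynomial.IsRoot.def]
  have hl2len : l2.length ≤ e := by
    simp only [l2, Finset.length_toList]
    have h1 := Multiset.toFinset_card_le (π.map σt').roots
    have h2 := Polynomial.card_roots' (π.map σt')
    rw [Polynomial.natDegree_map] at h2
    omega
  obtain ⟨ι1, _, U1, hU1c, -, hU1i, hU1r⟩ := greedy (F := F) Y (fun r i => φ1 r (y i)) l1 0 Empty (by simp)
    Empty.elim hY' (by
      intro r hr ιU _ U hUc hUi
      by_contra hcon
      push Not at hcon
      obtain ⟨hr0, hrα⟩ := (hl1 r).1 hr
      obtain ⟨hφc, hφα⟩ := hφ1 r hr0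
      have hφE : ∀ c, φ1 r (jE c) = jQ (jE c) := fun c => hφc _
      have hne : ∃ i₀, jQ (x i₀) ≠ φ1 r (x i₀) := by
        by_contra h
        push Not at h
        apply hrα
        rw [← hφα]
        -- both embeddings agree on the field generated by the powers
        let a1 : Q →+* Ω := φ1 r
        letI := σt.toAlgebra
        let f1 : Q →ₐ[RatFunc E] Ω := { φ1 r with commutes' := hφc }
        let f2 : Q →ₐ[RatFunc E] Ω := { jQ with commutes' := fun _ => rfl }
        have : Aq ≤ (AlgHom.equalizer f1 f2 : Subalgebra (RatFunc E) Q).toIntermediateField (fun z hz => by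
            rw [AlgHom.mem_equalizer] at hz ⊢
            rw [map_inv₀, map_inv₀, hz]) := by
          rw [hAq, IntermediateField.adjoin_le_iff]
          rintro _ ⟨b, rfl⟩
          change f1 _ = f2 _
          rw [map_pow, map_pow]
          congr 1
          exact (h b).symm
        exact this hα
      obtain ⟨i₀, hi₀⟩ := hne
      have := count_step (fun i => jQ (D i)) hDΩ U (fun a b => jQ (jE (A a b))) (fun b => jQ (x b)) (fun b => φ1 r (x b))
        hX0 (by rw [hx0, map_one]) YY (fun i => φ1 r (y i)) hYY0 e1 e2 hYX hYA
        (fun b => congrArg _ (hyx b)) (hwA _ hφE) i₀ hi₀ (fun T h1 h2 _ => hgenΩ T h1 h2) hcon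
      omega)
  obtain ⟨ι2, _, U2, hU2c, hU12, hU2i, hU2r⟩ := greedy (F := F) Y (fun r i => φ2 r (y i)) l2 (e - 1) ι1 (by omega)
    U1 hU1i (by
      intro r hr ιU _ U hUc hUi
      by_contra hcon
      push Not at hcon
      have hr0 := (hl2 r).1 hr
      obtain ⟨hφc, hφα⟩ := hφ2 r hr0
      have hφE : ∀ c, φ2 r (jE c) = jQ (jE c) := fun c => by
        rw [← hjE', hφc, hσt', hEΩ]
      have hT : Transcendental Q (φ2 r (x b₀)) := by
        refine generic_image (φ2 r) hφE ?_ _ hb₀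
        rw [hφc, hσX]; exact ht'
      have hne : jQ (x b₀) ≠ φ2 r (x b₀) := by
        intro h
        apply hT
        rw [← h]
        exact isAlgebraic_algebraMap _
      have hD2 : AlgebraicIndependent F (fun o : Option ι => o.elim (φ2 r (x b₀)) (fun i => jQ (D i))) := by
        refine (hDΩ.option_iff_transcendental _).2 ?_
        intro h
        apply hT
        refine clF_to_alg (F := F) (S := range fun i => jQ (D i)) ?_ h
        rintro _ ⟨i, rfl⟩
        exact ⟨_, rfl⟩
      have := count_step _ hD2 U (fun a b => jQ (jE (A a b))) (fun b => jQ (x b)) (fun b => φ2 r (x b))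
        hX0 (by rw [hx0, map_one]) YY (fun i => φ2 r (y i)) hYY0 e1 e2 hYX hYA
        (fun b => congrArg _ (hyx b)) (hwA _ hφE) b₀ hne (fun T h1 h2 h3 => by
          rintro (_ | i)
          · exact h3 b₀
          · exact hgenΩ T h1 h2 i) hcon
      rw [Fintype.card_option] at this
      omega)
  -- the constant field
  let κ := IntermediateField.adjoin F (range U2)
  have hUY : AlgebraicIndependent F (Sum.elim Y U2) := by
    have := (algebraicIndependent_equiv (R := F) (Equiv.sumComm (Fin n) ι2) (f := Sum.elim U2 Y)).2 hU2i
    convert this using 1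
    funext i
    rcases i with i | i <;> rfl
  have hU2ind : AlgebraicIndependent F U2 := hU2i.comp Sum.inl Sum.inl_injective
  have hYκ : AlgebraicIndependent κ Y := by
    open scoped IntermediateField.algebraAdjoinAdjoin in
    have h1 := (AlgebraicIndependent.sumElim_iff.1 hUY).2
    exact h1.extendScalars κ
  have hUκ : ∀ u, U2 u ∈ κ := fun u => IntermediateField.subset_adjoin _ _ ⟨u, rfl⟩
  have hU0 : ∀ u, U2 u ≠ 0 := fun u => hU2ind.ne_zero u
  have hU1' : ∀ u, U2 u ≠ 1 := by
    intro u h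
    have := hU2ind.transcendental u
    rw [h] at this
    exact this isAlgebraic_one
  have fin : ∀ (σ : RatFunc E →+* Ω) (φ : Q →+* Ω) r, (∀ c, φ (algebraMap _ Q c) = σ c) → φ α = r → ∀ i u, φ (y i) = U2 u →
      ∃ a, ∃ c : κ, c ≠ 0 ∧ ((G a).map σ).eval r = algebraMap κ Ω c := by
    rintro σ φ r hφ rfl i u hiu
    obtain ⟨a, rfl⟩ : ∃ a, i = Fin.succ a := by
      rcases Fin.eq_zero_or_eq_succ i with h | h
      · rw [h, hy0, map_one] at hiu
        exact absurd hiu.symm (hU1' u)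
      · exact h
    refine ⟨a, ⟨U2 u, hUκ u⟩ ^ q, pow_ne_zero _ ?_, ?_⟩
    · intro h; exact hU0 u (congrArg Subtype.val h)
    · rw [eval_root_hom σ φ hφ, hG, map_pow, hiu, map_pow]; rfl
  refine core (κ₀ := F) (κ := κ) ?_ ε hε halg α π hirr hπα y hy0 hy q hq0 G hG heq σt σt' hσt hσt' htt' α₀ hα₀ Y hYκ ?_ ?_ ?_
  · intro c
    refine ⟨algebraMap F κ c, ?_⟩
    rw [hEΩ, ← hFQ, ← IsScalarTower.algebraMap_apply, ← IsScalarTower.algebraMap_apply]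
  · intro a
    rw [eval_root_hom σt jQ (fun _ => rfl), hG, map_pow]
  · intro r hr hrα
    obtain ⟨i, u, hiu⟩ := hU1r r ((hl1 r).2 ⟨hr, hrα⟩)
    obtain ⟨u', hu'⟩ := hU12 ⟨u, rfl⟩
    exact fin σt (φ1 r) r (hφ1 r hr).1 (hφ1 r hr).2 i u' (hiu.trans hu'.symm)
  · intro r hr
    obtain ⟨i, u, hiu⟩ := hU2r r ((hl2 r).2 hr)
    exact fin σt' (φ2 r) r (hφ2 r hr).1 (hφ2 r hr).2 i u hiu

lemma ex_closure {Q : Type*} [Field Q] : ∃ (t : AlgebraicClosure (RatFunc Q)),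
    Transcendental Q t ∧ ∀ x : AlgebraicClosure (RatFunc Q), IsAlgebraic (IntermediateField.adjoin Q {t}) x := by
  let Ω := AlgebraicClosure (RatFunc Q)
  refine ⟨algebraMap (RatFunc Q) Ω RatFunc.X, ?_, ?_⟩
  · exact (transcendental_algebraMap_iff (algebraMap (RatFunc Q) Ω).injective).2 RatFunc.transcendental_X
  · intro x
    obtain ⟨p, hp, hpx⟩ := Algebra.IsAlgebraic.isAlgebraic (R := RatFunc Q) x
    refine alg_trans (algebraMap (RatFunc Q) Ω) (fun r => ?_) p
      ((Polynomial.map_ne_zero_iff (algebraMap (RatFunc Q) Ω).injective).2 hp) x hpx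
    have h : algebraMap (RatFunc Q) Ω r ∈ IntermediateField.adjoin Q {algebraMap (RatFunc Q) Ω RatFunc.X} := by
      have h1 : r ∈ IntermediateField.adjoin Q {(RatFunc.X : RatFunc Q)} := by rw [RatFunc.adjoin_X]; trivial
      have h2 := IntermediateField.adjoin_map Q {(RatFunc.X : RatFunc Q)} (IsScalarTower.toAlgHom Q (RatFunc Q) Ω)
      rw [Set.image_singleton] at h2
      change algebraMap (RatFunc Q) Ω r ∈ IntermediateField.adjoin Q {(IsScalarTower.toAlgHom Q (RatFunc Q) Ω) RatFunc.X}
      rw [← h2]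
      exact ⟨r, h1, rfl⟩
    exact isAlgebraic_algebraMap (⟨_, h⟩ : IntermediateField.adjoin Q {algebraMap (RatFunc Q) Ω RatFunc.X})

lemma ex_closure2.{w} (Q : Type w) [Field Q] : ∃ (Ω : Type w) (_ : Field Ω) (_ : IsAlgClosed Ω) (_ : Algebra Q Ω) (t : Ω),
    Transcendental Q t ∧ ∀ x : Ω, IsAlgebraic (IntermediateField.adjoin Q {t}) x :=
  ⟨AlgebraicClosure (RatFunc Q), inferInstance, inferInstance, inferInstance, ex_closure⟩

/-- Part IV: the contradiction -/
theorem final_contra {N j n e : ℕ} {F E Q ι : Type*} [Field F] [Field E] [Field Q] [Fintype ι]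
    [IsAlgClosed E] [Algebra F E] [Algebra F Q] [Algebra (RatFunc E) Q]
    [Algebra.IsAlgebraic (RatFunc E) Q]
    (hFQ : ∀ c, algebraMap F Q c = algebraMap (RatFunc E) Q (RatFunc.C (algebraMap F E c)))
    (hn : n = N + j) (hej : 2 * e = j + 2)
    (A : Fin j → Fin (N + 1) → E) (x : Fin (N + 1) → Q) (hx0 : x 0 = 1)
    (y : Fin (n + 1) → Q) (hy0 : y 0 = 1) (hy : ∀ i, y i ≠ 0)
    (e1 : Fin (N + 1) → Fin (n + 1)) (e2 : Fin j → Fin (n + 1)) (he : ∀ i, (∃ b, e1 b = i) ∨ ∃ a, e2 a = i)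
    (hyx : ∀ b, y (e1 b) = x b)
    (hyA : ∀ a, y (e2 a) = ∑ b, algebraMap (RatFunc E) Q (RatFunc.C (A a b)) * x b)
    (D : ι → Q) (hD : AlgebraicIndependent F D) (hcard : Fintype.card ι = n + j * N)
    (hgen : ∀ T : IntermediateField F Q, (∀ i, y i ∈ T) → (∀ a b, algebraMap (RatFunc E) Q (RatFunc.C (A a b)) ∈ T) →
      ∀ i, D i ∈ T)
    (Fx : IntermediateField (RatFunc E) Q) [FiniteDimensional (RatFunc E) Fx] (hFx : finrank (RatFunc E) Fx ≤ e)
    (hxF : ∀ b, x b ∈ Fx) (b₀ : Fin (N + 1)) (hb₀ : ∀ c : E, x b₀ ≠ algebraMap (RatFunc E) Q (RatFunc.C c))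
    (heq : ∀ i, ∃ (d : ℕ) (μ : Fin (n + 1) →₀ ℕ) (g : MvPolynomial (Fin (n + 1)) F) (s : E),
      μ.degree = d ∧ μ i ≠ 0 ∧ g.IsHomogeneous d ∧ (∀ l, g.coeff (Finsupp.single l d) ≠ 0) ∧ s ≠ 0 ∧
      ∏ l, y l ^ μ l + algebraMap (RatFunc E) Q (RatFunc.C s) *
        g.eval₂ ((algebraMap (RatFunc E) Q).comp (RatFunc.C.comp (algebraMap F E))) y = 0) : False := by
  obtain ⟨Ω, _, _, _, t', ht', -⟩ := ex_closure2 Q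
  obtain ⟨L, _, _, _, ε, hε, halg⟩ := ex_closure2 Ω
  letI : Algebra F Ω := ((algebraMap Q Ω).comp (algebraMap F Q)).toAlgebra
  haveI : IsScalarTower F Q Ω := IsScalarTower.of_algebraMap_eq fun _ => rfl
  letI : Algebra E Ω := ((algebraMap Q Ω).comp ((algebraMap (RatFunc E) Q).comp RatFunc.C)).toAlgebra
  exact asm1 hFQ (fun _ => rfl) t' ht' ε hε halg hn hej A x hx0 y hy0 hy e1 e2 he hyx hyA D hD hcard hgen Fx hFx hxF b₀ hb₀ heq

end AsmPart
end PartAsm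

section PartP3a
section P3aPart
open Set MvPolynomial

/-- exponent vectors of degree `d` -/
abbrev Mon (σ : Type) (d : ℕ) := {m : σ →₀ ℕ // m.degree = d}

instance Mon.finite (σ : Type) [Fintype σ] (d : ℕ) : Finite (Mon σ d) := by
  classical
  refine Finite.of_injective (fun m : Mon σ d => (fun i => (⟨m.1 i, by
    have := Finsupp.le_degree i m.1
    have h := m.2
    omega⟩ : Fin (d + 1)))) ?_
  intro m m' h
  refine Subtype.ext (Finsupp.ext fun i => ?_)
  exact congrArg Fin.val (congrFun h i)

lemma exists_mu {c M : ℕ} (d : Fin c → ℕ) (h : M ≤ ∑ a, d a) (hM : 0 < M) :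
    ∃ μ : Fin c → (Fin M →₀ ℕ), (∀ a, (μ a).degree = d a) ∧ ∀ i, ∃ a, μ a i ≠ 0 := by
  classical
  have hcard : Fintype.card (Fin M) ≤ Fintype.card (Σ a, Fin (d a)) := by simpa using h
  obtain ⟨g⟩ := Function.Embedding.nonempty_of_card_le hcard
  haveI : Nonempty (Fin M) := ⟨⟨0, hM⟩⟩
  let f : (Σ a, Fin (d a)) → Fin M := Function.invFun g
  have hf : ∀ i, f (g i) = i := Function.leftInverse_invFun g.injective
  refine ⟨fun a => ∑ t : Fin (d a), Finsupp.single (f ⟨a, t⟩) 1, fun a => ?_, fun i => ?_⟩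
  · rw [map_sum]; simp
  · refine ⟨(g i).1, ?_⟩
    rw [Finsupp.finset_sum_apply]
    intro h0
    have h1 := Finset.sum_eq_zero_iff.1 h0 (g i).2 (Finset.mem_univ _)
    change Finsupp.single (f (g i)) 1 i = 0 at h1
    rw [hf] at h1; simp at h1

lemma exists_indep {K k ι : Type*} [Field K] [Field k] [Algebra K k] [Countable K] [Uncountable k] [Countable ι] :
    ∃ f : ι → k, AlgebraicIndependent K f := by
  obtain ⟨s, hs⟩ := exists_isTranscendenceBasis' K k
  obtain ⟨s, x, hx⟩ : ∃ (s : Type _) (x : s → k), IsTranscendenceBasis K x := ⟨_, _, hs.choose_spec⟩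
  by_cases hc : Countable s
  · exfalso
    have hal := hx.isAlgebraic
    haveI : Countable (MvPolynomial s K) := by
      rw [← Cardinal.mk_le_aleph0_iff]
      refine MvPolynomial.cardinalMk_le_max_lift.trans ?_
      simp
    haveI : Countable (Algebra.adjoin K (range x)) := by
      rw [Algebra.adjoin_range_eq_range_aeval]
      exact Set.countable_coe_iff.2 (Set.countable_range _)
    haveI : Algebra.IsAlgebraic (Algebra.adjoin K (range x)) k := hal
    have h2 := Algebra.IsAlgebraic.lift_cardinalMk_le_max (Algebra.adjoin K (range x)) k
    have h3 : Cardinal.mk k ≤ Cardinal.aleph0 := by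
      have h4 := h2.trans (max_le (by simp) le_rfl)
      simpa using h4
    exact not_countable (α := k) (Cardinal.mk_le_aleph0_iff.1 h3)
  · haveI : Uncountable s := not_countable_iff.1 hc
    obtain ⟨g⟩ : Nonempty (ℕ ↪ s) := ⟨Infinite.natEmbedding s⟩
    obtain ⟨h, hh⟩ := exists_injective_nat ι
    exact ⟨x ∘ (g ∘ h), hx.1.comp _ (g.injective.comp hh)⟩

end P3aPart
end PartP3a

section PartP3b
section P3bPart
open Set MvPolynomial

variable {k0 k : Type*} [Field k0] [Field k] [Algebra k0 k] {N j n c : ℕ}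

/-- substitution of linear forms for the extra variables -/
noncomputable def psiHom (e : Fin (N + 1) ⊕ Fin j ≃ Fin (n + 1)) (A : Fin j → Fin (N + 1) → k) :
    MvPolynomial (Fin (n + 1)) k →ₐ[k] MvPolynomial (Fin (N + 1)) k :=
  aeval (fun i => Sum.elim X (fun a => ∑ b, C (A a b) * X b) (e.symm i))

lemma psiHom_coeff (e : Fin (N + 1) ⊕ Fin j ≃ Fin (n + 1)) (A : Fin j → Fin (N + 1) → k) (T : IntermediateField k0 k)
    (hA : ∀ a b, A a b ∈ T) (p : MvPolynomial (Fin (n + 1)) k) (hp : ∀ m, coeff m p ∈ T) (m) :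
    coeff m (psiHom e A p) ∈ T := by
  have hp' : ∃ p', MvPolynomial.map (algebraMap T k) p' = p := by
    have : p ∈ Set.range (MvPolynomial.map (σ := Fin (n + 1)) (algebraMap T k)) := by
      rw [MvPolynomial.mem_range_map_iff_coeffs_subset]
      intro z hz
      obtain ⟨m, -, rfl⟩ := MvPolynomial.mem_coeffs_iff.1 hz
      exact ⟨⟨_, hp m⟩, rfl⟩
    exact this
  clear hp
  obtain ⟨p', rfl⟩ := hp'
  have : psiHom e A (MvPolynomial.map (algebraMap T k) p') =
      MvPolynomial.map (algebraMap T k) (psiHom e (fun a b => (⟨A a b, hA a b⟩ : T)) p') := by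
    induction p' using MvPolynomial.induction_on with
    | C a => rw [map_C, psiHom, psiHom, algHom_C, algHom_C]; simp
    | add p q hp hq =>
      rw [map_add, map_add, hp, hq, map_add, map_add]
    | mul_X p i hp =>
      rw [map_mul, map_mul, hp, map_mul, map_mul]
      congr 1
      rw [map_X, psiHom, psiHom, aeval_X, aeval_X]
      rcases e.symm i with b | a
      · simp
      · simp only [Sum.elim_inr, map_sum, map_mul, map_C, map_X]; rfl
  rw [this, coeff_map]
  exact Subtype.prop _

lemma psiHom_rename (e : Fin (N + 1) ⊕ Fin j ≃ Fin (n + 1)) (A : Fin j → Fin (N + 1) → k) (p : MvPolynomial (Fin (N + 1)) k) :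
    psiHom e A (rename (e ∘ Sum.inl) p) = p := by
  rw [psiHom, aeval_rename]
  have : ((fun i => Sum.elim X (fun a => ∑ b, C (A a b) * X b) (e.symm i)) ∘ e ∘ Sum.inl) = (X : Fin (N + 1) → MvPolynomial (Fin (N + 1)) k) := by
    funext b; simp
  rw [this]; simp

lemma psiHom_homog (e : Fin (N + 1) ⊕ Fin j ≃ Fin (n + 1)) (A : Fin j → Fin (N + 1) → k) (p : MvPolynomial (Fin (n + 1)) k)
    {d : ℕ} (hp : p.IsHomogeneous d) : (psiHom e A p).IsHomogeneous d := by
  have := hp.aeval (fun i => Sum.elim X (fun a => ∑ b, C (A a b) * X b) (e.symm i)) (n := 1) (by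
    intro i
    rcases e.symm i with b | a
    · exact isHomogeneous_X _ _
    · refine IsHomogeneous.sum _ _ _ fun b _ => ?_
      have := (isHomogeneous_C (Fin (N + 1)) (A a b)).mul (isHomogeneous_X k b)
      simpa using this)
  rw [one_mul] at this
  exact this

/-- exponent vectors involving an extra variable -/
abbrev NewMon (e : Fin (N + 1) ⊕ Fin j ≃ Fin (n + 1)) (d : ℕ) :=
  {m : Mon (Fin (n + 1)) d // ∃ i, m.1 (e (Sum.inr i)) ≠ 0}

lemma card_newMon (e : Fin (N + 1) ⊕ Fin j ≃ Fin (n + 1)) (d : Fin c → ℕ) :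
    Nat.card (Σ a, Mon (Fin (n + 1)) (d a)) ≤ Nat.card (Σ a, NewMon e (d a)) + Nat.card (Σ a, Mon (Fin (N + 1)) (d a)) := by
  classical
  have hinj : Function.Injective (e ∘ Sum.inl) := e.injective.comp Sum.inl_injective
  let f : (Σ a, NewMon e (d a)) ⊕ (Σ a, Mon (Fin (N + 1)) (d a)) → Σ a, Mon (Fin (n + 1)) (d a) :=
    Sum.elim (fun p => ⟨p.1, p.2.1⟩) (fun p => ⟨p.1, ⟨p.2.1.mapDomain (e ∘ Sum.inl), by
      have := p.2.2
      rw [Finsupp.degree_mapDomain]; exact this⟩⟩)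
  have hf : Function.Surjective f := by
    rintro ⟨a, m⟩
    by_cases h : ∃ i, m.1 (e (Sum.inr i)) ≠ 0
    · exact ⟨Sum.inl ⟨a, ⟨m, h⟩⟩, rfl⟩
    · push Not at h
      have h1 : (m.1.comapDomain (e ∘ Sum.inl) hinj.injOn).mapDomain (e ∘ Sum.inl) = m.1 := by
        refine Finsupp.mapDomain_comapDomain _ hinj _ ?_
        intro i hi
        obtain ⟨s, rfl⟩ := e.surjective i
        rcases s with b | a
        · exact ⟨b, rfl⟩
        · exact absurd (h a) (Finsupp.mem_support_iff.1 hi)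
      refine ⟨Sum.inr ⟨a, ⟨m.1.comapDomain (e ∘ Sum.inl) hinj.injOn, ?_⟩⟩, ?_⟩
      · have := m.2
        rw [← h1, Finsupp.degree_mapDomain] at this
        exact this
      · simp only [f, Sum.elim_inr, h1]
  rw [← Nat.card_sum]
  exact Nat.card_le_card_of_surjective f hf

theorem deform (e : Fin (N + 1) ⊕ Fin j ≃ Fin (n + 1)) (d : Fin c → ℕ) (v : Fin c → MvPolynomial (Fin (N + 1)) k)
    (hv : ∀ a, (v a).IsHomogeneous (d a)) (A : Fin j → Fin (N + 1) → k) (Γ : (Σ a, NewMon e (d a)) → k)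
    (hall : AlgebraicIndependent k0 (Sum.elim (Sum.elim (fun p : Fin j × Fin (N + 1) => A p.1 p.2) Γ)
      (fun p : Σ a, Mon (Fin (N + 1)) (d a) => coeff p.2.1 (v p.1))))
    (μ m0 : ∀ a, Mon (Fin (n + 1)) (d a)) :
    ∃ G : Fin c → MvPolynomial (Fin (n + 1)) k, (∀ a, (G a).IsHomogeneous (d a)) ∧
      (∀ a, psiHom e A (monomial (μ a).1 1 + G a) = v a) ∧
      AlgebraicIndependent k0 (Sum.elim (fun p : Σ a, Mon (Fin (n + 1)) (d a) =>
        open Classical in if p.2 = m0 p.1 then coeff (m0 p.1).1 (G p.1) else coeff p.2.1 (G p.1) / coeff (m0 p.1).1 (G p.1))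
        (fun p : Fin j × Fin (N + 1) => A p.1 p.2)) := by
  classical
  haveI : ∀ a, Fintype (NewMon e (d a)) := fun a => Fintype.ofFinite _
  haveI : ∀ a, Fintype (Mon (Fin (n + 1)) (d a)) := fun a => Fintype.ofFinite _
  haveI : ∀ a, Fintype (Mon (Fin (N + 1)) (d a)) := fun a => Fintype.ofFinite _
  let Gn : Fin c → MvPolynomial (Fin (n + 1)) k := fun a => ∑ m : NewMon e (d a), monomial m.1.1 (Γ ⟨a, m⟩)
  have hGn : ∀ a, (Gn a).IsHomogeneous (d a) := fun a => IsHomogeneous.sum _ _ _ fun m _ => isHomogeneous_monomial _ m.1.2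
  have hμ : ∀ a, (monomial (μ a).1 (1 : k)).IsHomogeneous (d a) := fun a => isHomogeneous_monomial _ (μ a).2
  let G : Fin c → MvPolynomial (Fin (n + 1)) k := fun a =>
    rename (e ∘ Sum.inl) (v a - psiHom e A (monomial (μ a).1 1 + Gn a)) + Gn a
  have hG : ∀ a, (G a).IsHomogeneous (d a) := fun a =>
    (((hv a).sub (psiHom_homog e A _ ((hμ a).add (hGn a)))).rename_isHomogeneous).add (hGn a)
  have hGnew : ∀ a (m : NewMon e (d a)), coeff m.1.1 (G a) = Γ ⟨a, m⟩ := by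
    intro a m
    have h1 : coeff m.1.1 (rename (e ∘ Sum.inl) (v a - psiHom e A (monomial (μ a).1 1 + Gn a))) = 0 := by
      refine coeff_rename_eq_zero _ _ _ ?_
      intro u hu
      exfalso
      obtain ⟨i, hi⟩ := m.2
      apply hi
      rw [← hu]
      refine Finsupp.mapDomain_notin_range _ _ ?_
      rintro ⟨b, hb⟩
      exact Sum.inl_ne_inr (e.injective hb)
    simp only [G]
    rw [coeff_add, h1, zero_add]
    simp only [Gn]
    rw [coeff_sum, Finset.sum_eq_single m]
    · simp
    · intro m' _ hm'
      rw [coeff_monomial, if_neg]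
      intro h
      exact hm' (Subtype.ext (Subtype.ext h))
    · simp
  have hGψ : ∀ a, psiHom e A (monomial (μ a).1 1 + G a) = v a := by
    intro a
    simp only [G]
    rw [map_add, map_add, psiHom_rename, map_add]
    ring
  let B : (Σ a, Mon (Fin (n + 1)) (d a)) ⊕ (Fin j × Fin (N + 1)) → k :=
    Sum.elim (fun p => coeff p.2.1 (G p.1)) (fun p => A p.1 p.2)
  have hBI : AlgebraicIndependent k0 B := by
    have hBm : ∀ i, B i ∈ clF k0 (range B) := fun i => subset_clF _ ⟨i, rfl⟩
    have hAm : ∀ a b, A a b ∈ clF k0 (range B) := fun a b => hBm (Sum.inr (a, b))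
    have hGm : ∀ a m, coeff m (G a) ∈ clF k0 (range B) := by
      intro a m
      by_cases h : m.degree = d a
      · exact hBm (Sum.inl ⟨a, ⟨m, h⟩⟩)
      · rw [(hG a).coeff_eq_zero h]; exact zero_mem _
    refine CL2 _ B hall ?_ ?_
    · rintro ((p | p) | p)
      · exact hAm p.1 p.2
      · rw [Sum.elim_inl, Sum.elim_inr, ← hGnew]
        exact hGm _ _
      · rw [Sum.elim_inr, ← hGψ]
        refine psiHom_coeff e A _ hAm _ ?_ _
        intro m
        rw [coeff_add]
        refine add_mem ?_ (hGm _ _)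
        rw [coeff_monomial]
        split_ifs
        · exact one_mem _
        · exact zero_mem _
    · have := card_newMon e d
      simp only [Nat.card_eq_fintype_card] at this
      rw [Fintype.card_sum, Fintype.card_sum, Fintype.card_sum]
      omega
  refine ⟨G, hG, hGψ, ?_⟩
  have hs0 : ∀ a, coeff (m0 a).1 (G a) ≠ 0 := fun a => hBI.ne_zero (Sum.inl ⟨a, m0 a⟩)
  refine CL2 B _ hBI ?_ le_rfl
  set B2 := (Sum.elim (fun p : Σ a, Mon (Fin (n + 1)) (d a) =>
        if p.2 = m0 p.1 then coeff (m0 p.1).1 (G p.1) else coeff p.2.1 (G p.1) / coeff (m0 p.1).1 (G p.1))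
        (fun p : Fin j × Fin (N + 1) => A p.1 p.2)) with hB
  have hBm : ∀ i, B2 i ∈ clF k0 (range B2) := fun i => subset_clF _ ⟨i, rfl⟩
  have hs : ∀ a, coeff (m0 a).1 (G a) ∈ clF k0 (range B2) := by
    intro a
    have := hBm (Sum.inl ⟨a, m0 a⟩)
    simpa [hB] using this
  rintro (p | p)
  · have h1 := hBm (Sum.inl p)
    rw [hB, Sum.elim_inl, ← hB] at h1
    change coeff p.2.1 (G p.1) ∈ _
    split_ifs at h1 with h
    · rw [h]; exact h1
    · have := mul_mem h1 (hs p.1)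
      rwa [div_mul_cancel₀ _ (hs0 _)] at this
  · exact hBm (Sum.inr p)

end P3bPart
end PartP3b

section PartP3c
section P3cPart
open Set MvPolynomial Module

/-- Part III -/
theorem part3 {k0 k E Q : Type*} [Field k0] [Field k] [Algebra k0 k] [Countable k0] [Uncountable k] {N j c e : ℕ}
    [Field E] [Field Q] [IsAlgClosed E] [Algebra k E] [Algebra k Q] [Algebra (RatFunc E) Q]
    [Algebra.IsAlgebraic (RatFunc E) Q]
    (hkQ : ∀ z, algebraMap k Q z = algebraMap (RatFunc E) Q (RatFunc.C (algebraMap k E z)))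
    (hcN : c ≤ N) (d : Fin c → ℕ) (hej : 2 * e = j + 2) (hsum : N + j + 1 ≤ ∑ a, d a)
    (v : Fin c → MvPolynomial (Fin (N + 1)) k) (hv : ∀ a, (v a).IsHomogeneous (d a))
    (hV : AlgebraicIndependent k0 (fun p : Σ a, Mon (Fin (N + 1)) (d a) => coeff p.2.1 (v p.1)))
    (x : Fin (N + 1) → Q) (hx0 : x 0 = 1) (hx : ∀ b, x b ≠ 0) (hvx : ∀ a, aeval x (v a) = 0)
    (sub : Fin (N - c) → Fin (N + 1)) (hsub : AlgebraicIndependent k (fun i => x (sub i)))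
    (Fx : IntermediateField (RatFunc E) Q) [FiniteDimensional (RatFunc E) Fx] (hFx : finrank (RatFunc E) Fx ≤ e)
    (hxF : ∀ b, x b ∈ Fx) (b₀ : Fin (N + 1)) (hb₀ : ∀ z : E, x b₀ ≠ algebraMap (RatFunc E) Q (RatFunc.C z)) : False := by
  classical
  -- indices
  obtain ⟨n, hn⟩ : ∃ n, n = N + j := ⟨_, rfl⟩
  let ei : Fin (N + 1) ⊕ Fin j ≃ Fin (n + 1) := finSumFinEquiv.trans (finCongr (by omega))
  have hei0 : ei (Sum.inl 0) = 0 := by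
    apply Fin.ext
    simp [ei]
  -- exponents
  obtain ⟨μ', hμ', hμi⟩ := exists_mu (M := n + 1) d (by omega) (by omega)
  let μ : ∀ a, Mon (Fin (n + 1)) (d a) := fun a => ⟨μ' a, hμ' a⟩
  let m0 : ∀ a, Mon (Fin (n + 1)) (d a) := fun a => ⟨Finsupp.single 0 (d a), by simp⟩
  -- functional
  obtain ⟨φ, hφ⟩ : ∃ φ : Q →ₗ[k] k, φ 1 = 1 := by
    obtain ⟨φ, hφ⟩ := (Algebra.linearMap k Q).exists_leftInverse_of_injective
      (LinearMap.ker_eq_bot.2 (algebraMap k Q).injective)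
    refine ⟨φ, ?_⟩
    have := LinearMap.congr_fun hφ 1
    simpa using this
  let V : (Σ a, Mon (Fin (N + 1)) (d a)) → k := fun p => coeff p.2.1 (v p.1)
  let K1 := IntermediateField.adjoin k0 (range V ∪ range fun b => φ (x b))
  haveI : Countable K1 := by
    have h1 := IntermediateField.lift_cardinalMk_adjoin_le k0 (range V ∪ range fun b => φ (x b))
    have h2 : Countable ↥(range V ∪ range fun b => φ (x b)) :=
      ((countable_range V).union (countable_range _)).to_subtype
    rw [← Cardinal.mk_le_aleph0_iff]
    have h3 := h1.trans (max_le (max_le (by simp) (by simp)) le_rfl)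
    simpa using h3
  obtain ⟨θ, hθ⟩ := exists_indep (K := K1) (k := k) (ι := (Fin j × Fin (N + 1)) ⊕ (Σ a, NewMon ei (d a)))
  let A : Fin j → Fin (N + 1) → k := fun a b => θ (Sum.inl (a, b))
  let Γ : (Σ a, NewMon ei (d a)) → k := fun p => θ (Sum.inr p)
  have hθe : θ = Sum.elim (fun p : Fin j × Fin (N + 1) => A p.1 p.2) Γ := by
    funext i; rcases i with i | i <;> rfl
  have hall : AlgebraicIndependent k0 (Sum.elim θ V) := by
    refine AlgebraicIndependent.sumElim_of_tower (S := K1) hV ?_ hθ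
    rintro _ ⟨p, rfl⟩
    exact ⟨⟨V p, IntermediateField.subset_adjoin _ _ (Or.inl ⟨p, rfl⟩)⟩, rfl⟩
  rw [hθe] at hall
  obtain ⟨G, hG, hGψ, hB⟩ := deform ei d v hv A Γ hall μ m0
  set s : Fin c → k := fun a => coeff (m0 a).1 (G a) with hs
  -- separate ratios from the s
  let δ : (Σ a, {m : Mon (Fin (n + 1)) (d a) // m ≠ m0 a}) → k := fun p => coeff p.2.1.1 (G p.1) / s p.1
  have hB2 : AlgebraicIndependent k0 (Sum.elim (Sum.elim s (fun p : Fin j × Fin (N + 1) => A p.1 p.2)) δ) := by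
    let f : (Fin c ⊕ (Fin j × Fin (N + 1))) ⊕ (Σ a, {m : Mon (Fin (n + 1)) (d a) // m ≠ m0 a}) →
        (Σ a, Mon (Fin (n + 1)) (d a)) ⊕ (Fin j × Fin (N + 1)) :=
      Sum.elim (Sum.elim (fun a => Sum.inl ⟨a, m0 a⟩) Sum.inr) (fun p => Sum.inl ⟨p.1, p.2.1⟩)
    have hf : Function.Injective f := by
      rintro ((a | a) | ⟨a, m, hm⟩) ((b | b) | ⟨b, m', hm'⟩) h
      · have := congrArg Sigma.fst (Sum.inl.inj h)
        simp only at this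
        rw [this]
      · exact absurd h Sum.inl_ne_inr
      · exfalso
        obtain ⟨h1, h2⟩ := Sigma.mk.inj (Sum.inl.inj h)
        subst h1
        exact hm' (eq_of_heq h2).symm
      · exact absurd h Sum.inr_ne_inl
      · rw [Sum.inr.inj h]
      · exact absurd h Sum.inr_ne_inl
      · exfalso
        obtain ⟨h1, h2⟩ := Sigma.mk.inj (Sum.inl.inj h)
        subst h1
        exact hm (eq_of_heq h2)
      · exact absurd h Sum.inl_ne_inr
      · obtain ⟨h1, h2⟩ := Sigma.mk.inj (Sum.inl.inj h)
        subst h1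
        simp only [heq_eq_eq] at h2
        subst h2
        rfl
    have := hB.comp f hf
    convert this using 1
    funext i
    rcases i with (a | a) | ⟨a, m, hm⟩
    · simp [f, hs]
    · simp [f]
    · simp only [f, δ, hs, Sum.elim_inr, Function.comp, Sum.elim_inl]
      rw [if_neg hm]
  have hs0 : ∀ a, s a ≠ 0 := fun a => hB2.ne_zero (Sum.inl (Sum.inl a))
  have hδ0 : ∀ p, δ p ≠ 0 := fun p => hB2.ne_zero (Sum.inr p)
  let F := IntermediateField.adjoin k0 (range δ)
  have hsA : AlgebraicIndependent F (Sum.elim s (fun p : Fin j × Fin (N + 1) => A p.1 p.2)) := by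
    open scoped IntermediateField.algebraAdjoinAdjoin in
    have h1 := (AlgebraicIndependent.sumElim_iff.1 hB2).2
    exact h1.extendScalars F
  -- the polynomials g
  have hgF : ∀ a m, coeff m (G a) / s a ∈ F := by
    intro a m
    by_cases h : m.degree = d a
    · by_cases h' : (⟨m, h⟩ : Mon (Fin (n + 1)) (d a)) = m0 a
      · have h2 : m = (m0 a).1 := congrArg Subtype.val h'
        rw [h2, div_self (hs0 a)]; exact one_mem _
      · exact IntermediateField.subset_adjoin _ _ ⟨⟨a, ⟨⟨m, h⟩, h'⟩⟩, rfl⟩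
    · rw [(hG a).coeff_eq_zero h, zero_div]; exact zero_mem _
  have hgex : ∀ a, ∃ g : MvPolynomial (Fin (n + 1)) F, MvPolynomial.map (algebraMap F k) g = C (s a)⁻¹ * G a := by
    intro a
    have : C (s a)⁻¹ * G a ∈ Set.range (MvPolynomial.map (σ := Fin (n + 1)) (algebraMap F k)) := by
      rw [MvPolynomial.mem_range_map_iff_coeffs_subset]
      intro z hz
      obtain ⟨m, -, rfl⟩ := MvPolynomial.mem_coeffs_iff.1 hz
      rw [coeff_C_mul, mul_comm, ← div_eq_mul_inv]
      exact ⟨⟨_, hgF a m⟩, rfl⟩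
    exact this
  choose g hg using hgex
  have hgc : ∀ a m, (algebraMap F k) (coeff m (g a)) = coeff m (G a) / s a := by
    intro a m
    rw [← coeff_map, hg, coeff_C_mul, mul_comm, ← div_eq_mul_inv]
  -- the points
  let kE : E →+* Q := (algebraMap (RatFunc E) Q).comp RatFunc.C
  let y : Fin (n + 1) → Q := fun i => Sum.elim x (fun a => ∑ b, algebraMap k Q (A a b) * x b) (ei.symm i)
  have hye1 : ∀ b, y (ei (Sum.inl b)) = x b := fun b => by simp [y]
  have hye2 : ∀ a, y (ei (Sum.inr a)) = ∑ b, algebraMap k Q (A a b) * x b := fun a => by simp [y]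
  have hyψ : ∀ p : MvPolynomial (Fin (n + 1)) k, aeval y p = aeval x (psiHom ei A p) := by
    intro p
    rw [psiHom, ← AlgHom.comp_apply]
    congr 1
    ext i
    rw [aeval_X, AlgHom.comp_apply, aeval_X]
    simp only [y]
    rcases ei.symm i with b | a
    · simp
    · simp only [Sum.elim_inr, map_sum, map_mul, aeval_X, algHom_C]
  have hy : ∀ i, y i ≠ 0 := by
    intro i
    obtain ⟨i, rfl⟩ := ei.surjective i
    rcases i with b | a
    · rw [hye1]; exact hx b
    · rw [hye2]
      intro h0
      have h1 := congrArg φ h0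
      rw [map_zero, map_sum] at h1
      have hlam : ∀ b, φ (x b) ∈ K1 := fun b => IntermediateField.subset_adjoin _ _ (Or.inr ⟨b, rfl⟩)
      let P : MvPolynomial ((Fin j × Fin (N + 1)) ⊕ (Σ a, NewMon ei (d a))) K1 :=
        ∑ b, C (⟨φ (x b), hlam b⟩ : K1) * X (Sum.inl (a, b))
      have hP : aeval θ P = 0 := by
        rw [← h1]
        simp only [P, map_sum, map_mul, aeval_X, algHom_C]
        refine Finset.sum_congr rfl fun b _ => ?_
        rw [← Algebra.smul_def (A a b), map_smul, smul_eq_mul, mul_comm]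
        rfl
      have hP0 : P = 0 := by
        have := hθ
        rw [AlgebraicIndependent, injective_iff_map_eq_zero] at this
        exact this P hP
      have h2 := congrArg (coeff (Finsupp.single (Sum.inl (a, (0 : Fin (N + 1)))) 1)) hP0
      rw [coeff_zero] at h2
      simp only [P] at h2
      rw [coeff_sum, Finset.sum_eq_single 0] at h2
      · rw [coeff_C_mul, coeff_X, if_pos rfl, mul_one] at h2
        have h3 := congrArg Subtype.val h2
        simp only [hx0, hφ] at h3
        exact one_ne_zero h3
      · intro b _ hb
        rw [coeff_C_mul, coeff_X, if_neg, mul_zero]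
        intro h
        have := Finsupp.single_left_injective one_ne_zero h
        exact hb (congrArg Prod.snd (Sum.inl.inj this))
      · simp
  have hmain : ∀ a, ∏ l, y l ^ (μ a).1 l + algebraMap k Q (s a) *
        (g a).eval₂ (algebraMap F Q) y = 0 := by
    intro a
    have h1 : aeval y (monomial (μ a).1 (1 : k) + G a) = 0 := by rw [hyψ, hGψ, hvx]
    rw [map_add, aeval_monomial, map_one, one_mul, Finsupp.prod_fintype _ _ (fun i => pow_zero _)] at h1
    have h2 : algebraMap k Q (s a) * (g a).eval₂ (algebraMap F Q) y = aeval y (G a) := by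
      have h3 : (g a).eval₂ (algebraMap F Q) y = aeval y (MvPolynomial.map (algebraMap F k) (g a)) := by
        rw [aeval_def, eval₂_map]; rfl
      rw [h3, hg, map_mul, algHom_C, ← mul_assoc, ← map_mul, mul_inv_cancel₀ (hs0 a), map_one, one_mul]
    rw [h2]; exact h1
  let D : Fin (N - c) ⊕ (Fin c ⊕ (Fin j × Fin (N + 1))) → Q := Sum.elim (fun i => x (sub i))
    (fun i => algebraMap k Q (Sum.elim s (fun p : Fin j × Fin (N + 1) => A p.1 p.2) i))
  have hD : AlgebraicIndependent F D := by
    refine AlgebraicIndependent.sumElim_of_tower (S := k) ?_ ?_ hsub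
    · exact hsA.map' (f := IsScalarTower.toAlgHom F k Q) (algebraMap k Q).injective
    · rintro _ ⟨i, rfl⟩
      exact ⟨_, rfl⟩
  refine final_contra (N := N) (j := j) (n := n) (e := e) (F := F) (E := E) (Q := Q) (fun z => hkQ _) hn hej
    (fun a b => algebraMap k E (A a b)) x hx0 y (by rw [← hei0, hye1, hx0]) hy (fun b => ei (Sum.inl b))
    (fun a => ei (Sum.inr a)) ?_ hye1 ?_ D hD ?_ ?_ Fx hFx hxF b₀ hb₀ ?_
  · intro i
    obtain ⟨i, rfl⟩ := ei.surjective i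
    rcases i with b | a
    · exact Or.inl ⟨b, rfl⟩
    · exact Or.inr ⟨a, rfl⟩
  · intro a
    rw [hye2]
    simp only [hkQ]
  · simp only [Fintype.card_sum, Fintype.card_fin, Fintype.card_prod]
    rw [hn, Nat.mul_add]; omega
  · intro T hT1 hT2
    rintro (i | a | p)
    · change x (sub i) ∈ T
      rw [← hye1]; exact hT1 _
    · change algebraMap k Q (s a) ∈ T
      have h1 := hmain a
      have h2 : ∏ l, y l ^ (μ a).1 l ≠ 0 := Finset.prod_ne_zero_iff.2 fun l _ => pow_ne_zero _ (hy l)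
      have h3 : (g a).eval₂ (algebraMap F Q) y ≠ 0 := by
        intro h
        rw [h, mul_zero, add_zero] at h1
        exact h2 h1
      have h4 : algebraMap k Q (s a) = - (∏ l, y l ^ (μ a).1 l) / (g a).eval₂ (algebraMap F Q) y := by
        rw [eq_div_iff h3]
        exact (neg_eq_of_add_eq_zero_right h1).symm
      rw [h4]
      refine div_mem (neg_mem (prod_mem fun l _ => pow_mem (hT1 l) _)) ?_
      rw [eval₂_eq]
      refine sum_mem fun m _ => mul_mem (T.algebraMap_mem _) (prod_mem fun l _ => pow_mem (hT1 l) _)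
    · change algebraMap k Q (A p.1 p.2) ∈ T
      rw [hkQ]
      exact hT2 p.1 p.2
  · intro i
    obtain ⟨a, ha⟩ := hμi i
    refine ⟨d a, μ' a, g a, algebraMap k E (s a), hμ' a, ha, ?_, ?_, ?_, ?_⟩
    · intro m hm
      by_contra hne
      apply hm
      have h1 := hgc a m
      rw [(hG a).coeff_eq_zero (by
        intro h; apply hne; rw [← h, Finsupp.degree_eq_weight_one]; rfl), zero_div] at h1
      exact (map_eq_zero _).1 h1
    · intro l h
      have h1 := hgc a (Finsupp.single l (d a))
      rw [h, map_zero] at h1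
      by_cases h' : (⟨Finsupp.single l (d a), by simp⟩ : Mon (Fin (n + 1)) (d a)) = m0 a
      · have h2 : Finsupp.single l (d a) = (m0 a).1 := congrArg Subtype.val h'
        rw [h2] at h1
        rw [div_self (hs0 a)] at h1
        exact zero_ne_one h1
      · exact hδ0 ⟨a, ⟨_, h'⟩⟩ h1.symm
    · exact (map_ne_zero _).2 (hs0 a)
    · have h1 := hmain a
      rw [hkQ] at h1
      have h2 : algebraMap F Q = (algebraMap (RatFunc E) Q).comp (RatFunc.C.comp (algebraMap F E)) := by
        ext z
        exact hkQ _
      rw [h2] at h1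
      exact h1

end P3cPart
end PartP3c

section PartP2
section P2Part
open Set MvPolynomial Module

lemma ex_algClosure.{w} (K : Type w) [Field K] : ∃ (E : Type w) (_ : Field E) (_ : Algebra K E), IsAlgClosed E ∧ Algebra.IsAlgebraic K E :=
  ⟨AlgebraicClosure K, inferInstance, inferInstance, inferInstance, inferInstance⟩

theorem part2 {k0 k K : Type*} [Field k0] [Field k] [Algebra k0 k] [Countable k0] [Uncountable k] {N c e : ℕ}
    [Field K] [Algebra k K]
    (hcN : c ≤ N) (d : Fin c → ℕ) (he : 0 < e) (hsum : N + 2 * e ≤ ∑ a, d a + 1)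
    (v : Fin c → MvPolynomial (Fin (N + 1)) k) (hv : ∀ a, (v a).IsHomogeneous (d a))
    (hV : AlgebraicIndependent k0 (fun p : Σ a, Mon (Fin (N + 1)) (d a) => coeff p.2.1 (v p.1)))
    (ξ : Fin (N + 1) → K) (hξ0 : ξ 0 = 1) (hξ : ∀ b, ξ b ≠ 0) (hvξ : ∀ a, aeval ξ (v a) = 0)
    (hgen : IntermediateField.adjoin k (range ξ) = ⊤)
    (sub : Fin (N - c) → Fin (N + 1)) (hsub : AlgebraicIndependent k (fun i => ξ (sub i)))
    (hdiag : HasCvgDiagram k K e) : False := by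
  classical
  obtain ⟨KB, KC, _, _, _, _, -, -, f, π, hf, hfin⟩ := hdiag
  letI : Algebra (RatFunc KB) KC := π.toRingHom.toAlgebra
  have hfin' : finrank (RatFunc KB) KC = e := hfin
  haveI : FiniteDimensional (RatFunc KB) KC := FiniteDimensional.of_finrank_pos (by omega)
  obtain ⟨E, _, _, hE, hEalg⟩ := ex_algClosure KB
  obtain ⟨Q, _, _, hQ, hQalg⟩ := ex_algClosure (RatFunc E)
  obtain ⟨σ, hσC, hσX⟩ := ratfunc_hom ((RatFunc.C (K := E)).comp (algebraMap KB E)) (RatFunc.X) (by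
    intro p hp h0
    apply RatFunc.transcendental_X (K := E)
    refine ⟨p.map (algebraMap KB E), (Polynomial.map_ne_zero_iff (algebraMap KB E).injective).2 hp, ?_⟩
    rw [Polynomial.aeval_def, Polynomial.eval₂_map, ← h0]
    congr 1)
  letI : Algebra (RatFunc KB) (RatFunc E) := σ.toAlgebra
  letI : Algebra (RatFunc KB) Q := ((algebraMap (RatFunc E) Q).comp σ).toAlgebra
  haveI : IsScalarTower (RatFunc KB) (RatFunc E) Q := IsScalarTower.of_algebraMap_eq fun _ => rfl
  letI : Algebra k E := ((algebraMap KB E).comp (algebraMap k KB)).toAlgebra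
  letI : Algebra k Q := ((algebraMap (RatFunc E) Q).comp (RatFunc.C.comp (algebraMap k E))).toAlgebra
  let ι : KC →ₐ[RatFunc KB] Q := IsAlgClosed.lift
  let κ : K →ₐ[k] Q :=
    { ι.toRingHom.comp f.toRingHom with
      commutes' := by
        intro z
        have h1 : f (algebraMap k K z) = π (RatFunc.C (algebraMap k KB z)) := by
          rw [f.commutes, ← π.commutes]
          rfl
        change ι (f (algebraMap k K z)) = _
        rw [h1]
        change ι (algebraMap (RatFunc KB) KC _) = _
        rw [ι.commutes]
        change algebraMap (RatFunc E) Q (σ _) = _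
        rw [hσC]
        rfl }
  have hκ : ∀ z, κ z = ι (f z) := fun _ => rfl
  -- the field Fx
  let τ : TensorProduct (RatFunc KB) (RatFunc E) KC →ₐ[RatFunc E] Q :=
    Algebra.TensorProduct.lift (Algebra.ofId (RatFunc E) Q) ι (fun _ _ => Commute.all _ _)
  let S : Subalgebra (RatFunc E) Q := τ.range
  let Fx : IntermediateField (RatFunc E) Q := S.toIntermediateField (fun z hz =>
    S.inv_mem_of_algebraic (x := ⟨z, hz⟩) (Algebra.IsAlgebraic.isAlgebraic z))
  haveI hfd : FiniteDimensional (RatFunc E) S := by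
    change FiniteDimensional (RatFunc E) (LinearMap.range τ.toLinearMap)
    infer_instance
  haveI : FiniteDimensional (RatFunc E) Fx := hfd
  have hFx : finrank (RatFunc E) Fx ≤ e := by
    have h1 : finrank (RatFunc E) (LinearMap.range τ.toLinearMap) ≤ _ := LinearMap.finrank_range_le τ.toLinearMap
    rw [Module.finrank_baseChange, hfin'] at h1
    exact h1
  have hιF : ∀ z, ι z ∈ Fx := by
    intro z
    refine ⟨1 ⊗ₜ z, ?_⟩
    change τ _ = _
    simp [τ]
  -- nonconstant coordinate
  have hb : ∃ b₀, ∀ z : E, κ (ξ b₀) ≠ algebraMap (RatFunc E) Q (RatFunc.C z) := by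
    by_contra hcon
    push Not at hcon
    letI : Algebra E Q := ((algebraMap (RatFunc E) Q).comp RatFunc.C).toAlgebra
    haveI : IsScalarTower E (RatFunc E) Q := IsScalarTower.of_algebraMap_eq fun _ => rfl
    haveI : IsScalarTower k E Q := IsScalarTower.of_algebraMap_eq fun _ => rfl
    have hrange : ∀ z : K, κ z ∈ (IsScalarTower.toAlgHom k E Q).fieldRange := by
      intro z
      have hz : z ∈ IntermediateField.adjoin k (range ξ) := by rw [hgen]; trivial
      have hle : IntermediateField.adjoin k (range ξ) ≤ ((IsScalarTower.toAlgHom k E Q).fieldRange).comap κ := by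
        rw [IntermediateField.adjoin_le_iff]
        rintro _ ⟨b, rfl⟩
        obtain ⟨w, hw⟩ := hcon b
        exact ⟨w, hw.symm⟩
      exact hle hz
    have h_integ : f.toRingHom.IsIntegral := hf.to_isIntegral
    obtain ⟨p, hp, hpx⟩ := h_integ (π RatFunc.X)
    have h1 : IsAlgebraic E (ι (π RatFunc.X)) := by
      refine alg_trans κ.toRingHom ?_ p ?_ _ ?_
      · intro r
        obtain ⟨w, hw⟩ := hrange r
        change IsAlgebraic E (κ r)
        rw [← hw]
        exact isAlgebraic_algebraMap w
      · exact (hp.map _).ne_zero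
      · have h2 := congrArg ι hpx
        rw [map_zero] at h2
        rw [← h2]
        exact (Polynomial.hom_eval₂ p f.toRingHom ι.toRingHom _).symm
    have h2 : ι (π RatFunc.X) = algebraMap (RatFunc E) Q RatFunc.X := by
      change ι (algebraMap (RatFunc KB) KC _) = _
      rw [ι.commutes]
      change algebraMap (RatFunc E) Q (σ _) = _
      rw [hσX]
    rw [h2] at h1
    exact (transcendental_algebraMap_iff (algebraMap (RatFunc E) Q).injective).2 RatFunc.transcendental_X h1
  obtain ⟨b₀, hb₀⟩ := hb
  refine part3 (k0 := k0) (k := k) (E := E) (Q := Q) (j := 2 * e - 2) (e := e) (fun _ => rfl) hcN d (by omega) (by omega) v hv hV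
    (fun b => κ (ξ b)) (by rw [hξ0, map_one]) (fun b => (map_ne_zero κ).2 (hξ b)) ?_ sub ?_ Fx hFx (fun b => hιF _) b₀ hb₀
  · intro a
    have := congrArg κ (hvξ a)
    rw [map_zero] at this
    rw [← this]
    exact (MvPolynomial.comp_aeval_apply (φ := κ) (f := ξ) (p := v a)).symm
  · exact hsub.map' (f := κ) κ.toRingHom.injective

end P2Part
end PartP2

section PartG1
open MvPolynomial Module

namespace Gen

section red
variable {σ k : Type*} [Field k] (O : ValuationSubring k)

/-- base change to the fraction field -/
noncomputable abbrev up : MvPolynomial σ O →+* MvPolynomial σ k := MvPolynomial.map (algebraMap O k)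
/-- reduction -/
noncomputable abbrev dn : MvPolynomial σ O →+* MvPolynomial σ (IsLocalRing.ResidueField O) :=
  MvPolynomial.map (IsLocalRing.residue O)

theorem up_inj : Function.Injective (up O : MvPolynomial σ O →+* _) :=
  MvPolynomial.map_injective _ (FaithfulSMul.algebraMap_injective O k)

theorem exists_up (p : MvPolynomial σ k) (h : ∀ m, coeff m p ∈ O) :
    ∃ x : MvPolynomial σ O, up O x = p := by
  have : p ∈ Set.range (MvPolynomial.map (algebraMap O k) : MvPolynomial σ O →+* _) := by
    rw [mem_range_map_iff_coeffs_subset]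
    intro a ha
    rw [Finset.mem_coe, mem_coeffs_iff] at ha
    obtain ⟨m, -, rfl⟩ := ha
    exact ⟨⟨_, h m⟩, rfl⟩
  exact this

theorem exists_scale (p : MvPolynomial σ k) (hp : p ≠ 0) :
    ∃ j, coeff j p ≠ 0 ∧ ∃ x : MvPolynomial σ O, up O x = (coeff j p)⁻¹ • p ∧ coeff j x = 1 := by
  obtain ⟨j, hj, hmax⟩ := p.support.exists_max_image (fun m => O.valuation (coeff m p))
    (MvPolynomial.support_nonempty.2 hp)
  have hj0 : coeff j p ≠ 0 := by rwa [MvPolynomial.mem_support_iff] at hj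
  obtain ⟨x, hx⟩ := exists_up O ((coeff j p)⁻¹ • p) (by
    intro m
    rw [coeff_smul, smul_eq_mul]
    by_cases hm : coeff m p = 0
    · rw [hm, mul_zero]; exact O.zero_mem
    · rw [← O.valuation_le_one_iff, map_mul, map_inv₀]
      have := hmax m (MvPolynomial.mem_support_iff.2 hm)
      have h0 : O.valuation (coeff j p) ≠ 0 := by simpa using hj0
      rw [mul_comm, ← div_eq_mul_inv]
      exact div_le_one_of_le₀ this zero_le')
  refine ⟨j, hj0, x, hx, ?_⟩
  apply FaithfulSMul.algebraMap_injective O k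
  have := congrArg (coeff j) hx
  rw [coeff_map, coeff_smul, smul_eq_mul, inv_mul_cancel₀ hj0] at this
  rw [this, map_one]

/-- reduction of a subspace -/
def redS (W : Submodule k (MvPolynomial σ k)) :
    Submodule (IsLocalRing.ResidueField O) (MvPolynomial σ (IsLocalRing.ResidueField O)) where
  carrier := {y | ∃ x : MvPolynomial σ O, up O x ∈ W ∧ dn O x = y}
  zero_mem' := ⟨0, by simp, by simp⟩
  add_mem' := by
    rintro _ _ ⟨x, hx, rfl⟩ ⟨y, hy, rfl⟩
    exact ⟨x + y, by rw [map_add]; exact W.add_mem hx hy, by rw [map_add]⟩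
  smul_mem' := by
    rintro c _ ⟨x, hx, rfl⟩
    obtain ⟨c, rfl⟩ := IsLocalRing.residue_surjective c
    refine ⟨C c * x, ?_, ?_⟩
    · rw [map_mul, up, map_C, ← smul_eq_C_mul]; exact W.smul_mem _ hx
    · rw [map_mul, dn, map_C, ← smul_eq_C_mul]

theorem finrank_aux {F V : Type*} [Field F] [AddCommGroup V] [Module F V] (U : Submodule F V)
    [FiniteDimensional F U] (u : V) (hu : u ∉ U) :
    finrank F ↥(Submodule.span F {u} ⊔ U) = finrank F U + 1 := by
  have hu0 : u ≠ 0 := fun h => hu (h ▸ U.zero_mem)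
  have h1 : Submodule.span F {u} ⊓ U = ⊥ := by
    rw [← disjoint_iff]
    exact (Submodule.disjoint_span_singleton_of_notMem hu).symm
  have := Submodule.finrank_sup_add_finrank_inf_eq (Submodule.span F {u}) U
  rw [h1, finrank_bot, finrank_span_singleton hu0] at this
  omega

theorem finrank_redS (n : ℕ) (W : Submodule k (MvPolynomial σ k)) [FiniteDimensional k W]
    (hW : finrank k W = n) :
    FiniteDimensional (IsLocalRing.ResidueField O) (redS O W) ∧
      finrank (IsLocalRing.ResidueField O) (redS O W) = n := by
  induction n generalizing W with
  | zero =>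
    have : W = ⊥ := Submodule.finrank_eq_zero.1 hW
    have h2 : redS O W = ⊥ := by
      rw [eq_bot_iff]
      rintro _ ⟨x, hx, rfl⟩
      rw [this, Submodule.mem_bot] at hx
      have : x = 0 := up_inj O (by rw [hx, map_zero])
      simp [this]
    rw [h2]
    exact ⟨inferInstance, by simp⟩
  | succ n ih =>
    have hne : W ≠ ⊥ := by
      rintro rfl
      simp at hW
    obtain ⟨p, hpW, hp⟩ := Submodule.exists_mem_ne_zero_of_ne_bot hne
    obtain ⟨j, hj0, w, hw, hwj⟩ := exists_scale O p hp
    let U : Submodule k (MvPolynomial σ k) := W ⊓ LinearMap.ker (lcoeff k j)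
    haveI : FiniteDimensional k U := Submodule.finiteDimensional_of_le inf_le_left
    have hwW : up O w ∈ W := hw ▸ W.smul_mem _ hpW
    have hwj' : coeff j (up O w) = 1 := by rw [up, coeff_map, hwj, map_one]
    have hUW : W = Submodule.span k {up O w} ⊔ U := by
      apply le_antisymm
      · intro x hx
        rw [Submodule.mem_sup]
        refine ⟨coeff j x • up O w, Submodule.smul_mem _ _ (Submodule.mem_span_singleton_self _),
          x - coeff j x • up O w, ⟨W.sub_mem hx (W.smul_mem _ hwW), ?_⟩, by abel⟩
        simp [LinearMap.mem_ker, lcoeff, hwj', -coeff_map]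
      · exact sup_le ((Submodule.span_singleton_le_iff_mem _ _).2 hwW) inf_le_left
    have hwU : up O w ∉ U := by
      rintro ⟨-, h⟩
      have : coeff j (up O w) = 0 := h
      rw [hwj'] at this
      exact one_ne_zero this
    have hUn : finrank k U = n := by
      have := finrank_aux U _ hwU
      rw [← hUW, hW] at this
      omega
    obtain ⟨hf, hr⟩ := ih U hUn
    have hrj : ∀ y ∈ redS O U, coeff j y = 0 := by
      rintro _ ⟨x, ⟨-, hx⟩, rfl⟩
      have hx' : coeff j (up O x) = 0 := hx
      rw [up, coeff_map, map_eq_zero_iff _ (FaithfulSMul.algebraMap_injective O k)] at hx'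
      rw [dn, coeff_map, hx', map_zero]
    have hwr : dn O w ∉ redS O U := by
      intro h
      have := hrj _ h
      rw [dn, coeff_map, hwj, map_one] at this
      exact one_ne_zero this
    have hred : redS O W = Submodule.span _ {dn O w} ⊔ redS O U := by
      apply le_antisymm
      · rintro _ ⟨x, hx, rfl⟩
        rw [Submodule.mem_sup]
        refine ⟨IsLocalRing.residue O (coeff j x) • dn O w,
          Submodule.smul_mem _ _ (Submodule.mem_span_singleton_self _),
          dn O (x - C (coeff j x) * w), ⟨x - C (coeff j x) * w, ⟨?_, ?_⟩, rfl⟩, ?_⟩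
        · rw [map_sub, map_mul, up, map_C, ← smul_eq_C_mul]
          exact W.sub_mem hx (W.smul_mem _ hwW)
        · change coeff j (up O (x - C (coeff j x) * w)) = 0
          rw [up, coeff_map, coeff_sub, coeff_C_mul, hwj, mul_one, sub_self, map_zero]
        · rw [map_sub, map_mul, dn, map_C, ← smul_eq_C_mul]; abel
      · refine sup_le ((Submodule.span_singleton_le_iff_mem _ _).2 ⟨w, hwW, rfl⟩) ?_
        rintro _ ⟨x, hx, rfl⟩
        exact ⟨x, hx.1, rfl⟩
    rw [hred]
    refine ⟨inferInstance, ?_⟩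
    rw [finrank_aux _ _ hwr, hr]

/-- the ideal is stable under homogeneous components -/
def HomI {σ k : Type*} [Field k] (I : Ideal (MvPolynomial σ k)) : Prop :=
  ∀ p ∈ I, ∀ m, homogeneousComponent m p ∈ I

/-- liftability -/
def Lft (I : Ideal (MvPolynomial σ k)) (J : Ideal (MvPolynomial σ (IsLocalRing.ResidueField O))) :
    Prop := ∀ y ∈ J, ∃ x, up O x ∈ I ∧ dn O x = y

/-- saturation -/
def Sat (I : Ideal (MvPolynomial σ k)) (J : Ideal (MvPolynomial σ (IsLocalRing.ResidueField O))) :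
    Prop := ∀ x, up O x ∈ I → dn O x ∈ J

theorem map_trunc {A B : Type*} [CommRing A] [CommRing B] (f : A →+* B) (m : ℕ)
    (x : MvPolynomial σ A) : homogeneousComponent m (MvPolynomial.map f x) =
      MvPolynomial.map f (homogeneousComponent m x) := by
  ext i
  simp only [coeff_homogeneousComponent, coeff_map]
  split_ifs <;> simp

theorem prim [Finite σ] {I : Ideal (MvPolynomial σ k)}
    {J : Ideal (MvPolynomial σ (IsLocalRing.ResidueField O))}
    (hI : HomI I) (hL : Lft O I J) (hS : Sat O I J) (h : MvPolynomial σ k) (hh : h ∉ I) :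
    ∃ (μ : k) (x : MvPolynomial σ O), h - C μ * up O x ∈ I ∧ dn O x ∉ J := by
  classical
  set n := h.totalDegree
  let T : Submodule k (MvPolynomial σ k) := restrictTotalDegree σ k n
  let W : Submodule k (MvPolynomial σ k) := I.restrictScalars k ⊓ T
  haveI : FiniteDimensional k T := inferInstanceAs (Module.Finite k (restrictTotalDegree σ k n))
  haveI : FiniteDimensional k W := Submodule.finiteDimensional_of_le inf_le_right
  have hhW : h ∉ W := fun hm => hh hm.1
  have hhT : h ∈ T := (mem_restrictTotalDegree _ _ _).2 le_rfl
  obtain ⟨hf1, hr1⟩ := finrank_redS O _ W rfl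
  obtain ⟨hf2, hr2⟩ := finrank_redS O _ (Submodule.span k {h} ⊔ W) (finrank_aux W h hhW)
  have hnot : ¬ redS O (Submodule.span k {h} ⊔ W) ≤ redS O W := by
    intro hle
    have := Submodule.finrank_mono hle
    omega
  rw [SetLike.not_le_iff_exists] at hnot
  obtain ⟨_, ⟨x, hx, rfl⟩, hx2⟩ := hnot
  have hxT : up O x ∈ T := (sup_le ((Submodule.span_singleton_le_iff_mem _ _).2 hhT) inf_le_right :
    Submodule.span k {h} ⊔ W ≤ T) hx
  have hxJ : dn O x ∉ J := by
    intro hJ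
    obtain ⟨y, hy, hyx⟩ := hL _ hJ
    apply hx2
    refine ⟨∑ m ∈ Finset.range (n + 1), homogeneousComponent m y, ⟨?_, ?_⟩, ?_⟩
    · rw [map_sum]
      refine (I.restrictScalars k).sum_mem fun m _ => ?_
      rw [up, ← map_trunc]
      exact hI _ hy m
    · rw [map_sum]
      refine T.sum_mem fun m hm => ?_
      rw [up, ← map_trunc]
      rw [mem_restrictTotalDegree]
      exact ((homogeneousComponent_isHomogeneous m _).totalDegree_le).trans
        (by simpa [Nat.lt_succ_iff] using hm)
    · rw [map_sum, ← hyx]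
      have h1 : (dn O y).totalDegree ≤ n := by
        rw [hyx]
        refine (Finset.sup_mono ?_ : _ ≤ (up O x).totalDegree).trans
          ((mem_restrictTotalDegree _ _ _).1 hxT)
        intro i hi
        rw [MvPolynomial.mem_support_iff] at hi ⊢
        rw [dn, coeff_map] at hi
        rw [up, coeff_map]
        intro h0
        rw [map_eq_zero_iff _ (FaithfulSMul.algebraMap_injective O k)] at h0
        rw [h0, map_zero] at hi
        exact hi rfl
      conv_rhs => rw [← sum_homogeneousComponent (dn O y)]
      rw [← Finset.sum_subset (Finset.range_mono (Nat.succ_le_succ h1))]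
      · refine Finset.sum_congr rfl fun m _ => ?_
        rw [dn, map_trunc]
      · intro m _ hm
        rw [dn, ← map_trunc, homogeneousComponent_eq_zero]
        simpa using hm
  rw [Submodule.mem_sup] at hx
  obtain ⟨a, ha, w, hw, haw⟩ := hx
  obtain ⟨l, rfl⟩ := Submodule.mem_span_singleton.1 ha
  have hl : l ≠ 0 := by
    rintro rfl
    rw [zero_smul, zero_add] at haw
    exact hxJ (hS x (haw ▸ hw.1))
  refine ⟨l⁻¹, x, ?_, hxJ⟩
  have : h - C l⁻¹ * up O x = - (C l⁻¹ * w) := by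
    rw [← haw, smul_eq_C_mul, mul_add, ← mul_assoc, ← C_mul, inv_mul_cancel₀ hl, C_1]
    ring
  rw [this]
  exact I.neg_mem (I.mul_mem_left _ hw.1)

theorem sat_prime [Finite σ] {I : Ideal (MvPolynomial σ k)}
    {J : Ideal (MvPolynomial σ (IsLocalRing.ResidueField O))} (hJ : J.IsPrime)
    (hI : HomI I) (hL : Lft O I J) (hS : Sat O I J) : I.IsPrime := by
  rw [Ideal.isPrime_iff]
  constructor
  · rintro rfl
    apply hJ.ne_top
    rw [Ideal.eq_top_iff_one]
    simpa using hS 1 trivial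
  · intro a b hab
    by_contra! hcon
    obtain ⟨μ, x, hx, hxJ⟩ := prim O hI hL hS a hcon.1
    obtain ⟨ν, y, hy, hyJ⟩ := prim O hI hL hS b hcon.2
    have hμ : μ ≠ 0 := by rintro rfl; simp at hx; exact hcon.1 hx
    have hν : ν ≠ 0 := by rintro rfl; simp at hy; exact hcon.2 hy
    have h1 : up O (x * y) ∈ I := by
      have e : up O (x * y) = C (μ⁻¹ * ν⁻¹) * (a * b - (a - C μ * up O x) * b
          - C μ * up O x * (b - C ν * up O y)) := by
        have e1 : (C μ⁻¹ * C μ : MvPolynomial σ k) = 1 := by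
          rw [← C_mul, inv_mul_cancel₀ hμ, C_1]
        have e2 : (C ν⁻¹ * C ν : MvPolynomial σ k) = 1 := by
          rw [← C_mul, inv_mul_cancel₀ hν, C_1]
        rw [map_mul, C_mul]
        linear_combination (-(up O x * up O y) * C ν⁻¹ * C ν) * e1 - (up O x * up O y) * e2
      rw [e]
      exact I.mul_mem_left _ (I.sub_mem (I.sub_mem hab (I.mul_mem_right _ hx)) (I.mul_mem_left _ hy))
    have := hS _ h1
    rw [map_mul] at this
    exact (hJ.mem_or_mem this).elim hxJ hyJ

theorem sat_step [Finite σ] {I : Ideal (MvPolynomial σ k)}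
    {J : Ideal (MvPolynomial σ (IsLocalRing.ResidueField O))} (hJ : J.IsPrime)
    (hI : HomI I) (hL : Lft O I J) (hS : Sat O I J) (F : MvPolynomial σ O) (hF : dn O F ∉ J) :
    Sat O (I ⊔ Ideal.span {up O F}) (J ⊔ Ideal.span {dn O F}) := by
  intro g hg
  rw [Submodule.mem_sup] at hg
  obtain ⟨i, hi, b, hb, hib⟩ := hg
  obtain ⟨h, rfl⟩ := Ideal.mem_span_singleton'.1 hb
  by_cases hhI : h ∈ I
  · exact Ideal.mem_sup_left (hS g (hib ▸ I.add_mem hi (I.mul_mem_right _ hhI)))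
  obtain ⟨μ, x, hx, hxJ⟩ := prim O hI hL hS h hhI
  rcases O.mem_or_inv_mem μ with hμ | hμ
  · have h1 : up O (g - C (⟨μ, hμ⟩ : O) * x * F) ∈ I := by
      have : up O (g - C (⟨μ, hμ⟩ : O) * x * F) = i + (h - C μ * up O x) * up O F := by
        rw [map_sub, map_mul, map_mul, ← hib]
        rw [show up O (C (⟨μ, hμ⟩ : O) : MvPolynomial σ O) = C μ from map_C _ _]
        ring
      rw [this]
      exact I.add_mem hi (I.mul_mem_right _ hx)
    have h2 := hS _ h1
    rw [map_sub, map_mul] at h2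
    have := (J ⊔ Ideal.span {dn O F}).add_mem (Ideal.mem_sup_left h2)
      (Ideal.mem_sup_right (Ideal.mul_mem_left _ (dn O (C (⟨μ, hμ⟩ : O) * x))
        (Ideal.mem_span_singleton_self (dn O F))))
    simpa using this
  · by_cases hμ' : μ ∈ O
    · have h1 : up O (g - C (⟨μ, hμ'⟩ : O) * x * F) ∈ I := by
        have : up O (g - C (⟨μ, hμ'⟩ : O) * x * F) = i + (h - C μ * up O x) * up O F := by
          rw [map_sub, map_mul, map_mul, ← hib]
          rw [show up O (C (⟨μ, hμ'⟩ : O) : MvPolynomial σ O) = C μ from map_C _ _]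
          ring
        rw [this]
        exact I.add_mem hi (I.mul_mem_right _ hx)
      have h2 := hS _ h1
      rw [map_sub, map_mul] at h2
      have := (J ⊔ Ideal.span {dn O F}).add_mem (Ideal.mem_sup_left h2)
        (Ideal.mem_sup_right (Ideal.mul_mem_left _ (dn O (C (⟨μ, hμ'⟩ : O) * x))
          (Ideal.mem_span_singleton_self (dn O F))))
      simpa using this
    exfalso
    have hμ0 : μ ≠ 0 := fun h => hμ' (h ▸ O.zero_mem)
    have hres : IsLocalRing.residue O (⟨μ⁻¹, hμ⟩ : O) = 0 := by
      rw [IsLocalRing.residue_eq_zero_iff, IsLocalRing.mem_maximalIdeal, mem_nonunits_iff]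
      intro hu
      obtain ⟨⟨y, hy⟩, hy2⟩ := hu.exists_right_inv
      have : μ⁻¹ * y = 1 := congrArg Subtype.val hy2
      have : y = μ := by field_simp at this; exact this
      exact hμ' (this ▸ hy)
    have h1 : up O (C (⟨μ⁻¹, hμ⟩ : O) * g - x * F) ∈ I := by
      have : up O (C (⟨μ⁻¹, hμ⟩ : O) * g - x * F) =
          C μ⁻¹ * (i + (h - C μ * up O x) * up O F) := by
        rw [map_sub, map_mul, map_mul, ← hib]
        rw [show up O (C (⟨μ⁻¹, hμ⟩ : O) : MvPolynomial σ O) = C μ⁻¹ from map_C _ _]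
        have e1 : (C μ⁻¹ * C μ : MvPolynomial σ k) = 1 := by
          rw [← C_mul, inv_mul_cancel₀ hμ0, C_1]
        linear_combination (up O x * up O F) * e1
      rw [this]
      exact I.mul_mem_left _ (I.add_mem hi (I.mul_mem_right _ hx))
    have h2 := hS _ h1
    rw [map_sub, map_mul, map_mul, dn, map_C, hres, map_zero, zero_mul, zero_sub,
      Ideal.neg_mem_iff] at h2
    exact (hJ.mem_or_mem h2).elim hxJ hF

theorem lft_step {I : Ideal (MvPolynomial σ k)}
    {J : Ideal (MvPolynomial σ (IsLocalRing.ResidueField O))}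
    (hL : Lft O I J) (F : MvPolynomial σ O) :
    Lft O (I ⊔ Ideal.span {up O F}) (J ⊔ Ideal.span {dn O F}) := by
  intro y hy
  rw [Submodule.mem_sup] at hy
  obtain ⟨i, hi, b, hb, rfl⟩ := hy
  obtain ⟨h, rfl⟩ := Ideal.mem_span_singleton'.1 hb
  obtain ⟨x, hx, rfl⟩ := hL i hi
  obtain ⟨z, rfl⟩ := MvPolynomial.map_surjective _ (IsLocalRing.residue_surjective (R := O)) h
  refine ⟨x + z * F, ?_, by rw [map_add, map_mul]⟩
  rw [map_add, map_mul]
  exact Ideal.add_mem _ (Ideal.mem_sup_left hx)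
    (Ideal.mem_sup_right (Ideal.mul_mem_left _ _ (Ideal.mem_span_singleton_self _)))

end red

theorem homI_span {σ k : Type*} [Field k] (s : Set (MvPolynomial σ k))
    (hs : ∀ f ∈ s, ∃ d, f.IsHomogeneous d) : HomI (Ideal.span s) := by
  letI := MvPolynomial.gradedAlgebra (σ := σ) (R := k)
  have h := Ideal.homogeneous_span (homogeneousSubmodule σ k) s (by
    intro f hf
    obtain ⟨d, hd⟩ := hs f hf
    exact ⟨d, hd⟩)
  intro p hp m
  exact (MvPolynomial.mem_iff_homogeneousComponent_mem h p).1 hp m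

end Gen
end PartG1

section PartG2
open MvPolynomial

namespace Gen
section model
variable (F : Type*) [Field F] (d : ℕ → ℕ)

/-- the model polynomials -/
noncomputable def fb (a : ℕ) : MvPolynomial ℕ F := X (a + 2) ^ d a - X 0 ^ (d a - 1) * X (a + 1)

/-- the model ideal -/
noncomputable def Jm (c : ℕ) : Ideal (MvPolynomial ℕ F) := Ideal.span (fb F d '' {a | a < c})

/-- weights -/
def wt : ℕ → ℕ → ℕ
  | 0, i => if i = 1 then 1 else 0
  | c + 1, i => if i = c + 2 then 1 else d c * wt c i

theorem wt_zero (c : ℕ) : wt d c 0 = 0 := by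
  induction c with
  | zero => simp [wt]
  | succ c ih => simp [wt, ih]

theorem wt_last (c : ℕ) : wt d c (c + 1) = 1 := by
  cases c <;> simp [wt]

theorem wt_big (c i : ℕ) (h : c + 1 < i) : wt d c i = 0 := by
  induction c with
  | zero => simp [wt]; omega
  | succ c ih => simp only [wt]; rw [if_neg (by omega), ih (by omega), mul_zero]

theorem wt_rec (c a : ℕ) (h : a < c) : wt d c (a + 1) = d a * wt d c (a + 2) := by
  induction c with
  | zero => omega
  | succ c ih =>
    simp only [wt]
    rw [if_neg (by omega)]
    rcases Nat.lt_succ_iff_lt_or_eq.1 h with h | rfl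
    · rw [if_neg (by omega), ih h]; ring
    · rw [if_pos rfl, wt_last]

/-- image exponents -/
noncomputable def Ev (c i : ℕ) : ℕ →₀ ℕ :=
  if i ≤ c + 1 then Finsupp.single 0 1 + Finsupp.single 1 (wt d c i) else Finsupp.single i 1

/-- exponent map -/
noncomputable def Th (c : ℕ) : (ℕ →₀ ℕ) →ₗ[ℕ] (ℕ →₀ ℕ) := Finsupp.linearCombination ℕ (Ev d c)

/-- the monomial map -/
noncomputable def th (c : ℕ) : MvPolynomial ℕ F →ₐ[F] MvPolynomial ℕ F :=
  aeval fun i => monomial (Ev d c i) 1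

theorem th_monomial (c : ℕ) (m : ℕ →₀ ℕ) (a : F) :
    th F d c (monomial m a) = monomial (Th d c m) a := by
  rw [th, aeval_monomial, Th, Finsupp.linearCombination_apply]
  simp only [monomial_pow, one_pow]
  rw [Finsupp.prod, Finsupp.sum]
  have := monomial_sum_one (R := F) m.support (fun i => m i • Ev d c i)
  rw [← this, algebraMap_eq, C_mul_monomial, mul_one]

theorem Ev_one (c i : ℕ) : Ev d c i 1 = wt d c i := by
  unfold Ev
  split_ifs with h
  · simp
  · rw [wt_big d c i (by omega)]
    rw [Finsupp.single_apply, if_neg (by omega)]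

theorem Ev_big (c i j : ℕ) (hj : c + 2 ≤ j) : Ev d c i j = if i = j then 1 else 0 := by
  unfold Ev
  split_ifs with h h2 h2
  · omega
  · rw [Finsupp.add_apply, Finsupp.single_apply, Finsupp.single_apply, if_neg (by omega),
      if_neg (by omega), add_zero]
  · rw [Finsupp.single_apply, if_pos h2]
  · rw [Finsupp.single_apply, if_neg h2]

theorem Th_apply (c : ℕ) (m : ℕ →₀ ℕ) (j : ℕ) : Th d c m j = m.sum fun i n => n * Ev d c i j := by
  rw [Th, Finsupp.linearCombination_apply, Finsupp.sum, Finsupp.sum, Finsupp.finsetSum_apply]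
  rfl

theorem Th_big (c : ℕ) (m : ℕ →₀ ℕ) (j : ℕ) (hj : c + 2 ≤ j) : Th d c m j = m j := by
  rw [Th_apply, Finsupp.sum]
  simp only [Ev_big d c _ j hj]
  simp
  exact fun h => h.symm

theorem Th_one (c : ℕ) (m : ℕ →₀ ℕ) : Th d c m 1 = m.sum fun i n => n * wt d c i := by
  rw [Th_apply]; simp only [Ev_one]

theorem Th_one_zero (m : ℕ →₀ ℕ) : Th d 0 m 1 = m 1 := by
  rw [Th_one, Finsupp.sum]; simp [wt]; exact fun h => h.symm

theorem Th_one_succ (c : ℕ) (m : ℕ →₀ ℕ) : Th d (c + 1) m 1 = m (c + 2) + d c * Th d c m 1 := by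
  rw [Th_one, Th_one, Finsupp.sum, Finsupp.sum, Finset.mul_sum]
  have h1 : m (c + 2) = ∑ i ∈ m.support, if i = c + 2 then m i else 0 := by simp
  rw [h1, ← Finset.sum_add_distrib]
  refine Finset.sum_congr rfl fun i _ => ?_
  simp only [wt]
  split_ifs with h
  · subst h; rw [wt_big d c _ (by omega)]; ring
  · ring

theorem Th_zero_inj (c : ℕ) (m n : ℕ →₀ ℕ) (h : ∀ i, i ≠ 0 → m i = n i) (hT : Th d c m = Th d c n) :
    m = n := by
  have he : m.erase 0 = n.erase 0 := by
    ext i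
    by_cases hi : i = 0
    · subst hi; simp
    · rw [Finsupp.erase_ne hi, Finsupp.erase_ne hi, h i hi]
  have hE : Ev d c 0 = Finsupp.single 0 1 := by simp [Ev, wt_zero]
  have h2 := DFunLike.congr_fun hT 0
  rw [← Finsupp.erase_add_single 0 m, ← Finsupp.erase_add_single 0 n, map_add, map_add, he] at h2
  simp only [Th, Finsupp.linearCombination_single, hE, Finsupp.add_apply, Finsupp.smul_apply,
    Finsupp.single_eq_same, smul_eq_mul, mul_one, add_right_inj] at h2
  rw [← Finsupp.erase_add_single 0 m, ← Finsupp.erase_add_single 0 n, he, h2]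

theorem digits (c : ℕ) (m n : ℕ →₀ ℕ) (hm : ∀ a < c, m (a + 2) < d a) (hn : ∀ a < c, n (a + 2) < d a)
    (h : Th d c m 1 = Th d c n 1) : ∀ i, 1 ≤ i → i ≤ c + 1 → m i = n i := by
  induction c with
  | zero =>
    intro i h1 h2
    obtain rfl : i = 1 := by omega
    rwa [Th_one_zero, Th_one_zero] at h
  | succ c ih =>
    rw [Th_one_succ, Th_one_succ] at h
    have h1 := hm c (by omega)
    have h2 := hn c (by omega)
    have h3 : m (c + 2) = n (c + 2) := by
      have := congrArg (· % d c) h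
      simpa [Nat.add_mul_mod_self_left, Nat.mod_eq_of_lt h1, Nat.mod_eq_of_lt h2] using this
    have h4 : Th d c m 1 = Th d c n 1 := by
      rw [h3] at h
      exact Nat.eq_of_mul_eq_mul_left (by omega) (Nat.add_left_cancel h)
    intro i hi1 hi2
    rcases Nat.lt_or_ge i (c + 2) with hi | hi
    · exact ih (fun a ha => hm a (by omega)) (fun a ha => hn a (by omega)) h4 i hi1 (by omega)
    · obtain rfl : i = c + 2 := by omega
      exact h3

/-- normal exponents -/
def NF (c : ℕ) : Set (ℕ →₀ ℕ) := {m | ∀ a < c, m (a + 2) < d a}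

theorem Th_injOn_NF (c : ℕ) : Set.InjOn (Th d c) (NF d c) := by
  intro m hm n hn h
  refine Th_zero_inj d c m n (fun i hi => ?_) h
  rcases Nat.lt_or_ge i (c + 2) with h1 | h1
  · exact digits d c m n hm hn (DFunLike.congr_fun h 1) i (by omega) (by omega)
  · have := DFunLike.congr_fun h i
    rwa [Th_big d c m i h1, Th_big d c n i h1] at this

theorem Th_one_last (c : ℕ) (m : ℕ →₀ ℕ) (h : ∀ i, 1 ≤ i → i ≤ c → m i = 0) :
    Th d c m 1 = m (c + 1) := by
  induction c with
  | zero => exact Th_one_zero d m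
  | succ c ih =>
    rw [Th_one_succ, ih (fun i h1 h2 => h i h1 (by omega)), h (c + 1) (by omega) le_rfl]
    simp

theorem Th_injOn_y (c : ℕ) : Set.InjOn (Th d c) {m | ∀ i, 1 ≤ i → i ≤ c → m i = 0} := by
  intro m hm n hn h
  refine Th_zero_inj d c m n (fun i hi => ?_) h
  rcases Nat.lt_or_ge i (c + 2) with h1 | h1
  · rcases Nat.lt_or_ge i (c + 1) with h2 | h2
    · rw [hm i (by omega) (by omega), hn i (by omega) (by omega)]
    · obtain rfl : i = c + 1 := by omega
      have := DFunLike.congr_fun h 1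
      rwa [Th_one_last d c m hm, Th_one_last d c n hn] at this
  · have := DFunLike.congr_fun h i
    rwa [Th_big d c m i h1, Th_big d c n i h1] at this

theorem th_inj (c : ℕ) (q : MvPolynomial ℕ F) (hq : Set.InjOn (Th d c) q.support)
    (h : th F d c q = 0) : q = 0 := by
  ext n
  rw [coeff_zero]
  by_contra hn
  have hn' : n ∈ q.support := MvPolynomial.mem_support_iff.2 hn
  have h2 : th F d c q = ∑ m ∈ q.support, monomial (Th d c m) (coeff m q) := by
    conv_lhs => rw [q.as_sum]
    rw [map_sum]
    exact Finset.sum_congr rfl fun m _ => th_monomial F d c m _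
  have h3 : coeff (Th d c n) (th F d c q) = coeff n q := by
    rw [h2, coeff_sum, Finset.sum_eq_single n]
    · rw [coeff_monomial, if_pos rfl]
    · intro m hm hmn
      rw [coeff_monomial, if_neg]
      exact fun he => hmn (hq hm hn' he)
    · exact fun h => absurd hn' h
  rw [h, coeff_zero] at h3
  exact hn h3.symm

theorem th_fb (hd : ∀ a, 0 < d a) (c a : ℕ) (ha : a < c) : th F d c (fb F d a) = 0 := by
  have h0 : Ev d c 0 = Finsupp.single 0 1 := by simp [Ev, wt_zero]
  rw [fb, map_sub, map_mul, map_pow, map_pow, th, aeval_X, aeval_X, aeval_X, monomial_pow,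
    monomial_pow, monomial_mul, sub_eq_zero, h0]
  simp only [one_pow, mul_one]
  congr 2
  simp only [Ev]
  rw [if_pos (by omega), if_pos (by omega), wt_rec d c a ha]
  obtain ⟨e, he⟩ : ∃ e, d a = e + 1 := ⟨d a - 1, by have := hd a; omega⟩
  rw [he]
  ext i
  simp only [smul_add, Finsupp.smul_single, smul_eq_mul, mul_one, Finsupp.add_apply,
    Nat.add_sub_cancel]
  simp only [Finsupp.single_apply]
  split_ifs <;> omega

theorem nf_exists (hd : ∀ a, 0 < d a) (c : ℕ) (n : ℕ) : ∀ m : ℕ →₀ ℕ,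
    Finsupp.linearCombination ℕ (fun i : ℕ => i) m = n →
    ∃ m' ∈ NF d c, monomial m (1 : F) - monomial m' 1 ∈ Jm F d c := by
  induction n using Nat.strong_induction_on with
  | _ n ih =>
    intro m hm
    by_cases h : m ∈ NF d c
    · exact ⟨m, h, by simp⟩
    simp only [NF, Set.mem_setOf_eq, not_forall, not_lt] at h
    obtain ⟨a, hac, hda⟩ := h
    have hle : Finsupp.single (a + 2) (d a) ≤ m := Finsupp.single_le_iff.2 hda
    obtain ⟨r, rfl⟩ := exists_add_of_le hle
    have e1 := hd a
    obtain ⟨m', hm', hJ⟩ := ih _ (by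
      rw [← hm]
      simp only [map_add, Finsupp.linearCombination_single, smul_eq_mul]
      have : (a + 1) < d a * (a + 2) := by nlinarith
      simpa using this)
      (Finsupp.single 0 (d a - 1) + Finsupp.single (a + 1) 1 + r) rfl
    refine ⟨m', hm', ?_⟩
    have h2 : monomial (Finsupp.single (a + 2) (d a) + r) (1 : F) -
        monomial (Finsupp.single 0 (d a - 1) + Finsupp.single (a + 1) 1 + r) 1 =
        fb F d a * monomial r 1 := by
      rw [fb, X_pow_eq_monomial, X_pow_eq_monomial, X, monomial_mul, sub_mul, monomial_mul,
        monomial_mul]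
      simp
    have h3 : fb F d a * monomial r 1 ∈ Jm F d c :=
      Ideal.mul_mem_right _ _ (Ideal.subset_span ⟨a, hac, rfl⟩)
    have := Ideal.add_mem _ h3 hJ
    rw [← h2] at this
    simpa using this

theorem Jm_eq_ker (hd : ∀ a, 0 < d a) (c : ℕ) : Jm F d c = RingHom.ker (th F d c) := by
  apply le_antisymm
  · rw [Jm, Ideal.span_le]
    rintro _ ⟨a, ha, rfl⟩
    exact th_fb F d hd c a ha
  · intro p hp
    choose nf hnf hJ using fun m => nf_exists F d hd c _ m rfl
    let q : MvPolynomial ℕ F := ∑ m ∈ p.support, monomial (nf m) (coeff m p)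
    have hpq : p - q ∈ Jm F d c := by
      have : p - q = ∑ m ∈ p.support, C (coeff m p) * (monomial m (1 : F) - monomial (nf m) 1) := by
        conv_lhs => rw [p.as_sum]
        rw [← Finset.sum_sub_distrib]
        refine Finset.sum_congr rfl fun m _ => ?_
        rw [mul_sub, C_mul_monomial, C_mul_monomial, mul_one]
      rw [this]
      exact Ideal.sum_mem _ fun m _ => Ideal.mul_mem_left _ _ (hJ m)
    have hle : Jm F d c ≤ RingHom.ker (th F d c) := by
      rw [Jm, Ideal.span_le]
      rintro _ ⟨a, ha, rfl⟩
      exact th_fb F d hd c a ha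
    have hq : th F d c q = 0 := by
      have := hle hpq
      rw [RingHom.mem_ker, map_sub, sub_eq_zero] at this
      rw [← this]; exact hp
    have hsupp : ∀ n ∈ q.support, n ∈ NF d c := by
      intro n hn
      rw [MvPolynomial.mem_support_iff, coeff_sum] at hn
      obtain ⟨m, -, hm⟩ := Finset.exists_ne_zero_of_sum_ne_zero hn
      rw [coeff_monomial] at hm
      split_ifs at hm with h
      · exact h ▸ hnf m
      · exact absurd rfl hm
    have : q = 0 := th_inj F d c q ((Th_injOn_NF d c).mono hsupp) hq
    rwa [this, sub_zero] at hpq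

theorem Jm_prime (hd : ∀ a, 0 < d a) (c : ℕ) : (Jm F d c).IsPrime := by
  rw [Jm_eq_ker F d hd]; exact RingHom.ker_isPrime _

theorem X_notMem_Jm (hd : ∀ a, 0 < d a) (c b : ℕ) : X b ∉ Jm F d c := by
  rw [Jm_eq_ker F d hd, RingHom.mem_ker, th, aeval_X, monomial_eq_zero]
  exact one_ne_zero

theorem fb_notMem_Jm (hd : ∀ a, 0 < d a) (c : ℕ) : fb F d c ∉ Jm F d c := by
  rw [Jm_eq_ker F d hd, RingHom.mem_ker]
  intro h
  have := th_inj F d c _ ((Th_injOn_y d c).mono ?_) h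
  · have h2 := congrArg (coeff (Finsupp.single (c + 2) (d c))) this
    rw [fb, X_pow_eq_monomial, X_pow_eq_monomial, X, monomial_mul, coeff_sub, coeff_monomial,
      coeff_monomial, if_pos rfl, if_neg, coeff_zero, sub_zero] at h2
    · exact one_ne_zero h2
    · intro h3
      have := DFunLike.congr_fun h3 (c + 2)
      have hdc := hd c
      simp at this
      omega
  · intro m hm i h1 h2
    rw [Finset.mem_coe, MvPolynomial.mem_support_iff] at hm
    rw [fb, X_pow_eq_monomial, X_pow_eq_monomial, X, monomial_mul, coeff_sub, coeff_monomial,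
      coeff_monomial] at hm
    split_ifs at hm with h3 h4 h4
    · rw [← h3, Finsupp.single_apply, if_neg (by omega)]
    · rw [← h3, Finsupp.single_apply, if_neg (by omega)]
    · rw [← h4, Finsupp.add_apply, Finsupp.single_apply, Finsupp.single_apply, if_neg (by omega),
        if_neg (by omega), add_zero]
    · simp at hm

theorem y_Jm (hd : ∀ a, 0 < d a) (c : ℕ) (q : MvPolynomial ℕ F)
    (hq : ∀ m ∈ q.support, ∀ i, 1 ≤ i → i ≤ c → m i = 0) (h : q ∈ Jm F d c) : q = 0 := by
  rw [Jm_eq_ker F d hd, RingHom.mem_ker] at h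
  exact th_inj F d c q ((Th_injOn_y d c).mono hq) h

end model
end Gen
end PartG2

section PartG3
open MvPolynomial

namespace Gen
section modelFin
variable (F : Type*) [Field F] (d : ℕ → ℕ) (N : ℕ)

/-- the model polynomials in finitely many variables -/
noncomputable def fbF (a : ℕ) : MvPolynomial (Fin (N + 1)) F :=
  X (Fin.ofNat (N + 1) (a + 2)) ^ d a - X 0 ^ (d a - 1) * X (Fin.ofNat (N + 1) (a + 1))

/-- the model ideal -/
noncomputable def JF (c : ℕ) : Ideal (MvPolynomial (Fin (N + 1)) F) :=
  Ideal.span (fbF F d N '' {a | a < c})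

theorem rename_fbF (a : ℕ) (h : a + 2 ≤ N) : rename Fin.val (fbF F d N a) = fb F d a := by
  rw [fbF, fb]
  simp only [map_sub, map_mul, map_pow, rename_X, Fin.val_ofNat, Fin.val_zero]
  rw [Nat.mod_eq_of_lt (by omega), Nat.mod_eq_of_lt (by omega)]

theorem JF_eq_comap (c : ℕ) (h : c + 1 ≤ N) :
    JF F d N c = (Jm F d c).comap (rename (R := F) (Fin.val : Fin (N + 1) → ℕ)) := by
  apply le_antisymm
  · rw [JF, Ideal.span_le]
    rintro _ ⟨a, ha, rfl⟩
    have ha' : a < c := ha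
    change rename Fin.val (fbF F d N a) ∈ Jm F d c
    rw [rename_fbF F d N a (by omega)]
    exact Ideal.subset_span ⟨a, ha, rfl⟩
  · intro p hp
    let r : MvPolynomial ℕ F →ₐ[F] MvPolynomial (Fin (N + 1)) F :=
      aeval fun i => if h : i < N + 1 then X ⟨i, h⟩ else 0
    have hr : ∀ q, r (rename Fin.val q) = q := by
      intro q
      have : (r.comp (rename Fin.val)) = AlgHom.id F _ := by
        ext i : 1
        simp only [AlgHom.comp_apply, rename_X, r, aeval_X, AlgHom.id_apply]
        rw [dif_pos i.2]
      exact DFunLike.congr_fun this q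
    have h2 : (Jm F d c).map r ≤ JF F d N c := by
      rw [Jm, Ideal.map_span, Ideal.span_le]
      rintro _ ⟨_, ⟨a, ha, rfl⟩, rfl⟩
      have ha' : a < c := ha
      change r (fb F d a) ∈ JF F d N c
      rw [← rename_fbF F d N a (by omega), hr]
      exact Ideal.subset_span ⟨a, ha, rfl⟩
    rw [← hr p]
    exact h2 (Ideal.mem_map_of_mem _ hp)

theorem JF_prime (hd : ∀ a, 0 < d a) (c : ℕ) (h : c + 1 ≤ N) : (JF F d N c).IsPrime := by
  rw [JF_eq_comap F d N c h]
  haveI := Jm_prime F d hd c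
  exact Ideal.comap_isPrime _ _

theorem X_notMem_JF (hd : ∀ a, 0 < d a) (c : ℕ) (h : c + 1 ≤ N) (b : Fin (N + 1)) :
    X b ∉ JF F d N c := by
  rw [JF_eq_comap F d N c h, Ideal.mem_comap, rename_X]
  exact X_notMem_Jm F d hd c b

theorem fbF_notMem_JF (hd : ∀ a, 0 < d a) (c : ℕ) (h : c + 2 ≤ N) :
    fbF F d N c ∉ JF F d N c := by
  rw [JF_eq_comap F d N c (by omega), Ideal.mem_comap, rename_fbF F d N c h]
  exact fb_notMem_Jm F d hd c

theorem y_JF (hd : ∀ a, 0 < d a) (c : ℕ) (h : c + 1 ≤ N) (q : MvPolynomial (Fin (N + 1)) F)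
    (hq : ∀ m ∈ q.support, ∀ i : Fin (N + 1), 1 ≤ i.val → i.val ≤ c → m i = 0)
    (hJ : q ∈ JF F d N c) : q = 0 := by
  classical
  rw [JF_eq_comap F d N c h, Ideal.mem_comap] at hJ
  have := y_Jm F d hd c _ ?_ hJ
  · exact rename_injective _ Fin.val_injective (by rw [this, map_zero])
  · intro m hm i h1 h2
    rw [support_rename_of_injective Fin.val_injective, Finset.mem_image] at hm
    obtain ⟨n, hn, rfl⟩ := hm
    have := Finsupp.mapDomain_apply (M := ℕ) (Fin.val_injective) n (⟨i, by omega⟩ : Fin (N + 1))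
    rw [show i = Fin.val (⟨i, by omega⟩ : Fin (N + 1)) from rfl, this]
    exact hq n hn _ h1 h2

theorem fbF_hom (hd : ∀ a, 0 < d a) (a : ℕ) : (fbF F d N a).IsHomogeneous (d a) := by
  rw [fbF]
  apply IsHomogeneous.sub
  · simpa using (isHomogeneous_X F _).pow (d a)
  · have := ((isHomogeneous_X F (0 : Fin (N + 1))).pow (d a - 1)).mul
      (isHomogeneous_X F (Fin.ofNat (N + 1) (a + 1)))
    have h := hd a
    rwa [one_mul, Nat.sub_add_cancel h] at this

theorem map_fbF {G : Type*} [Field G] (j : F →+* G) (a : ℕ) :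
    MvPolynomial.map j (fbF F d N a) = fbF G d N a := by
  simp [fbF]

end modelFin

section
variable {k : Type*} [Field k] (O : ValuationSubring k) {N c : ℕ}

theorem sat_all (hcN : c + 1 ≤ N) (VO : ℕ → MvPolynomial (Fin (N + 1)) O) (d : ℕ → ℕ)
    (hd : ∀ a, 0 < d a) (hdn : ∀ a < c, dn O (VO a) = fbF _ d N a)
    (hom : ∀ a < c, ∃ e, (up O (VO a)).IsHomogeneous e) (c' : ℕ) (hc' : c' ≤ c) :
    HomI (Ideal.span ((fun a => up O (VO a)) '' {a | a < c'})) ∧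
    Lft O (Ideal.span ((fun a => up O (VO a)) '' {a | a < c'})) (JF _ d N c') ∧
    Sat O (Ideal.span ((fun a => up O (VO a)) '' {a | a < c'})) (JF _ d N c') := by
  have hH : ∀ c' ≤ c, HomI (Ideal.span ((fun a => up O (VO a)) '' {a | a < c'})) := by
    intro c' hc'
    apply homI_span
    rintro _ ⟨a, ha, rfl⟩
    have ha' : a < c' := ha
    exact hom a (by omega)
  refine ⟨hH c' hc', ?_⟩
  induction c' with
  | zero =>
    have h1 : {a : ℕ | a < 0} = ∅ := by ext; simp
    rw [JF, h1, Set.image_empty, Set.image_empty, Ideal.span_empty, Ideal.span_empty]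
    constructor
    · intro y hy
      exact ⟨0, by simp, by rw [map_zero, (Submodule.mem_bot _).1 hy]⟩
    · intro x hx
      have : x = 0 := up_inj O (by rw [(Submodule.mem_bot _).1 hx, map_zero])
      rw [this, map_zero]; exact Ideal.zero_mem _
  | succ b ih =>
    obtain ⟨hL, hS⟩ := ih (by omega)
    have h1 : {a : ℕ | a < b + 1} = insert b {a | a < b} := by
      ext x; simp only [Set.mem_setOf_eq, Set.mem_insert_iff]; omega
    have e1 : Ideal.span ((fun a => up O (VO a)) '' {a | a < b + 1}) =
        Ideal.span ((fun a => up O (VO a)) '' {a | a < b}) ⊔ Ideal.span {up O (VO b)} := by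
      rw [h1, Set.image_insert_eq, Ideal.span_insert, sup_comm]
    have e2 : JF (IsLocalRing.ResidueField O) d N (b + 1) =
        JF _ d N b ⊔ Ideal.span {dn O (VO b)} := by
      rw [JF, h1, Set.image_insert_eq, Ideal.span_insert, sup_comm, hdn b (by omega), JF]
    rw [e1, e2]
    refine ⟨lft_step O hL _, sat_step O (JF_prime _ d N hd b (by omega)) (hH b (by omega)) hL hS _ ?_⟩
    rw [hdn b (by omega)]
    exact fbF_notMem_JF _ d N hd b (by omega)
end

theorem gen_main {k0 k : Type*} [Field k0] [Field k] [Algebra k0 k] {N c : ℕ} (hcN : c + 1 ≤ N)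
    (d : Fin c → ℕ) (hd : ∀ a, 0 < d a)
    (v : Fin c → MvPolynomial (Fin (N + 1)) k) (hv : ∀ a, (v a).IsHomogeneous (d a))
    (hV : AlgebraicIndependent k0 (fun p : Σ a, Mon (Fin (N + 1)) (d a) => coeff p.2.1 (v p.1))) :
    (∀ c' ≤ c, (Ideal.span (v '' {a | a.val < c'})).IsPrime) ∧
    (∀ a : Fin c, v a ∉ Ideal.span (v '' {b | b < a})) ∧
    (∀ b, X b ∉ Ideal.span (Set.range v)) ∧
    (∀ q ∈ Ideal.span (Set.range v),
      (∀ m ∈ q.support, ∀ i : Fin (N + 1), 1 ≤ i.val → i.val ≤ c → m i = 0) → q = 0) := by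
  classical
  let d' : ℕ → ℕ := fun a => if h : a < c then d ⟨a, h⟩ else 1
  have hd'a : ∀ a : Fin c, d' a = d a := fun a => by simp [d']
  have hd' : ∀ a, 0 < d' a := by
    intro a; simp only [d']; split_ifs
    · exact hd _
    · exact one_pos
  let ix := Σ a, Mon (Fin (N + 1)) (d a)
  let co : ix → k := fun p => coeff p.2.1 (v p.1)
  let t : ix → k0 := fun p => coeff p.2.1 (fbF k0 d' N p.1)
  obtain ⟨O, hO1, hO2⟩ := chevalley (aeval (R := k0) co).toRingHom (RingHom.ker (aeval t : MvPolynomial ix k0 →ₐ[k0] k0))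
    (RingHom.ker_ne_top _) (by
      rw [(RingHom.injective_iff_ker_eq_bot _).1 (show Function.Injective (aeval (R := k0) co).toRingHom from hV)]
      exact bot_le)
  have hk0 : ∀ r : k0, algebraMap k0 k r ∈ O := by
    intro r
    have := hO1 (C r)
    simpa using this
  have hco : ∀ p, co p ∈ O := by
    intro p
    have := hO1 (X p)
    simpa using this
  let j : k0 →+* O := (algebraMap k0 k).codRestrict O.toSubring hk0
  have hres : ∀ p, IsLocalRing.residue O ⟨co p, hco p⟩ = IsLocalRing.residue O (j (t p)) := by
    intro p
    rw [← sub_eq_zero, ← map_sub, IsLocalRing.residue_eq_zero_iff, O.valuation_lt_one_iff]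
    have := hO2 (X p - C (t p)) (by simp [RingHom.mem_ker])
    simpa [j] using this
  have hvO : ∀ (a : Fin c) m, coeff m (v a) ∈ O := by
    intro a m
    by_cases hm : m.degree = d a
    · exact hco ⟨a, m, hm⟩
    · rw [(hv a).coeff_eq_zero hm]; exact O.zero_mem
  choose VO' hVO' using fun a => exists_up O (v a) (hvO a)
  let VO : ℕ → MvPolynomial (Fin (N + 1)) O := fun a => if h : a < c then VO' ⟨a, h⟩ else 0
  have hVO : ∀ a : Fin c, up O (VO a) = v a := by
    intro a; simp only [VO, dif_pos a.2]; exact hVO' a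
  have hdn : ∀ a < c, dn O (VO a) = fbF _ d' N a := by
    intro a ha
    rw [← map_fbF k0 d' N ((IsLocalRing.residue O).comp j)]
    ext m
    rw [dn, coeff_map, coeff_map]
    have hc : algebraMap O k (coeff m (VO a)) = coeff m (v ⟨a, ha⟩) := by
      rw [← hVO ⟨a, ha⟩, up, coeff_map]
    by_cases hm : m.degree = d ⟨a, ha⟩
    · have := hres ⟨⟨a, ha⟩, m, hm⟩
      rw [RingHom.comp_apply]
      rw [show coeff m (VO a) = ⟨co ⟨⟨a, ha⟩, m, hm⟩, hco _⟩ from Subtype.ext hc]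
      exact this
    · rw [(hv ⟨a, ha⟩).coeff_eq_zero hm,
        map_eq_zero_iff _ (FaithfulSMul.algebraMap_injective O k)] at hc
      rw [hc, (fbF_hom k0 d' N hd' a).coeff_eq_zero (by rw [hd'a ⟨a, ha⟩]; exact hm)]
      simp
  have key := sat_all O hcN VO d' hd' hdn (fun a ha => ⟨d ⟨a, ha⟩, by rw [hVO ⟨a, ha⟩]; exact hv _⟩)
  have hspan : ∀ c' ≤ c, (fun a => up O (VO a)) '' {a | a < c'} = v '' {a | a.val < c'} := by
    intro c' hc'
    ext p
    constructor
    · rintro ⟨a, ha, rfl⟩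
      have ha' : a < c' := ha
      exact ⟨⟨a, by omega⟩, ha, (hVO _).symm⟩
    · rintro ⟨a, ha, rfl⟩
      exact ⟨a, ha, hVO a⟩
  have hrange : Set.range v = v '' {a | a.val < c} := by
    ext p; simp
  have hSc : Sat O (Ideal.span (Set.range v)) (JF _ d' N c) := by
    have := (key c le_rfl).2.2
    rwa [hspan c le_rfl, ← hrange] at this
  refine ⟨?_, ?_, ?_, ?_⟩
  · intro c' hc'
    obtain ⟨h1, h2, h3⟩ := key c' hc'
    rw [← hspan c' hc']
    exact sat_prime O (JF_prime _ d' N hd' c' (by omega)) h1 h2 h3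
  · intro a ha
    have h3 := (key a a.2.le).2.2
    rw [hspan a a.2.le] at h3
    have := h3 (VO a) (by rw [hVO]; exact ha)
    rw [hdn a a.2] at this
    exact fbF_notMem_JF _ d' N hd' a (by omega) this
  · intro b hb
    have := hSc (X b) (by rwa [up, map_X])
    rw [dn, map_X] at this
    exact X_notMem_JF _ d' N hd' c hcN b this
  · intro q hq hsupp
    by_contra h0
    obtain ⟨i, hi, x, hx, hxi⟩ := exists_scale O q h0
    have h1 : up O x ∈ Ideal.span (Set.range v) := by
      rw [hx, smul_eq_C_mul]; exact Ideal.mul_mem_left _ _ hq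
    have h2 := y_JF _ d' N hd' c hcN (dn O x) (by
      intro m hm i' h1 h2
      apply hsupp m _ i' h1 h2
      rw [MvPolynomial.mem_support_iff] at hm ⊢
      intro hm0
      apply hm
      have := congrArg (coeff m) hx
      rw [coeff_smul, hm0, smul_zero, up, coeff_map,
        map_eq_zero_iff _ (FaithfulSMul.algebraMap_injective O k)] at this
      rw [dn, coeff_map, this, map_zero]) (hSc x h1)
    have := congrArg (coeff i) h2
    rw [dn, coeff_map, hxi, map_one, coeff_zero] at this
    exact one_ne_zero this

end Gen
end PartG3

section PartG4
open MvPolynomial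

namespace Gen

theorem height_irr (k : Type*) [Field k] (n : ℕ) :
    (n : ℕ∞) ≤ (RingHom.ker (aeval (fun _ => 0) : MvPolynomial (Fin n) k →ₐ[k] k)).height := by
  let φ : ℕ → (MvPolynomial (Fin n) k →ₐ[k] MvPolynomial (Fin n) k) := fun j =>
    aeval fun i => if i.val < j then 0 else X i
  have hp : ∀ j, (RingHom.ker (φ j)).IsPrime := fun j => RingHom.ker_isPrime _
  have hcomp : ∀ j, (φ (j + 1)).comp (φ j) = φ (j + 1) := by
    intro j
    ext i : 1
    simp only [AlgHom.comp_apply, φ, aeval_X]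
    split_ifs with h1 h2 h2
    · simp
    · omega
    · simp; omega
    · simp; intro h3; omega
  have hle : ∀ j, RingHom.ker (φ j) ≤ RingHom.ker (φ (j + 1)) := by
    intro j x hx
    rw [RingHom.mem_ker] at hx ⊢
    rw [← hcomp j, AlgHom.comp_apply, hx, map_zero]
  have hh : ∀ j ≤ n, (j : ℕ∞) ≤ (RingHom.ker (φ j)).height := by
    intro j
    induction j with
    | zero => simp
    | succ j ih =>
      intro hj
      have hlt : RingHom.ker (φ j) < RingHom.ker (φ (j + 1)) := by
        refine lt_of_le_of_ne (hle j) fun he => ?_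
        have h1 : (X ⟨j, by omega⟩ : MvPolynomial (Fin n) k) ∈ RingHom.ker (φ (j + 1)) := by
          simp [RingHom.mem_ker, φ]
        rw [← he] at h1
        simp [RingHom.mem_ker, φ] at h1
      have := hp j
      have := hp (j + 1)
      have h3 := Ideal.height_add_one_le_of_lt_of_isPrime hlt
      refine le_trans ?_ h3
      push_cast
      gcongr
      exact ih (by omega)
  refine (hh n le_rfl).trans (Ideal.height_mono ?_)
  intro x hx
  rw [RingHom.mem_ker] at hx ⊢
  have : (aeval (fun _ => 0) : MvPolynomial (Fin n) k →ₐ[k] k) =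
      (aeval (fun _ => 0) : MvPolynomial (Fin n) k →ₐ[k] k).comp (φ n) := by
    ext i : 1
    simp [φ]
  rw [this, AlgHom.comp_apply, hx, map_zero]

theorem krull {k : Type*} [Field k] {N c : ℕ} (hcN : c + 1 ≤ N)
    (d : Fin c → ℕ) (hd : ∀ a, 0 < d a)
    (v : Fin c → MvPolynomial (Fin (N + 1)) k) (hv : ∀ a, (v a).IsHomogeneous (d a))
    (h1 : ∀ c' ≤ c, (Ideal.span (v '' {a | a.val < c'})).IsPrime)
    (h2 : ∀ a : Fin c, v a ∉ Ideal.span (v '' {b | b < a})) :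
    ringKrullDim (MvPolynomial (Fin (N + 1)) k ⧸ Ideal.span (Set.range v)) =
      ((N - c + 1 : ℕ) : WithBot ℕ∞) := by
  have hup : ∀ c' ≤ c, ringKrullDim (MvPolynomial (Fin (N + 1)) k ⧸
      Ideal.span (v '' {a | a.val < c'})) + (c' : WithBot ℕ∞) ≤ ((N + 1 : ℕ) : WithBot ℕ∞) := by
    intro c'
    induction c' with
    | zero =>
      intro _
      refine le_trans ?_ (le_of_eq ?_ : ringKrullDim (MvPolynomial (Fin (N + 1)) k) ≤ _)
      · simpa using ringKrullDim_quotient_le (R := MvPolynomial (Fin (N + 1)) k) _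
      · rw [MvPolynomial.ringKrullDim_of_isNoetherianRing, ringKrullDim_eq_zero_of_field]
        simp
    | succ b ih =>
      intro hb
      refine le_trans ?_ (ih (by omega))
      have hle : Ideal.span (v '' {a | a.val < b}) ≤ Ideal.span (v '' {a | a.val < b + 1}) := by
        apply Ideal.span_mono
        apply Set.image_mono
        intro a ha
        have : a.val < b := ha
        change a.val < b + 1
        omega
      haveI := h1 b (by omega)
      have := ringKrullDim_succ_le_of_surjective (Ideal.Quotient.factor hle)
        (Ideal.Quotient.factor_surjective hle)
        (r := Ideal.Quotient.mk _ (v ⟨b, by omega⟩)) (mem_nonZeroDivisors_of_ne_zero (by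
          rw [Ne, Ideal.Quotient.eq_zero_iff_mem]
          exact h2 ⟨b, by omega⟩))
        (by
          rw [Ideal.Quotient.factor_mk, Ideal.Quotient.eq_zero_iff_mem]
          exact Ideal.subset_span ⟨⟨b, by omega⟩, Nat.lt_succ_self b, rfl⟩)
      calc _ = ringKrullDim (MvPolynomial (Fin (N + 1)) k ⧸
            Ideal.span (v '' {a | a.val < b + 1})) + 1 + (b : WithBot ℕ∞) := by
            push_cast; rw [add_assoc, add_comm (b : WithBot ℕ∞) 1]
        _ ≤ _ := by gcongr
  have hrange : Set.range v = v '' {a | a.val < c} := by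
    ext p; simp
  have hu := hup c le_rfl
  rw [← hrange] at hu
  haveI : (RingHom.ker (aeval (fun _ => 0) : MvPolynomial (Fin (N + 1)) k →ₐ[k] k)).IsPrime :=
    RingHom.ker_isPrime _
  have hl := Ideal.height_le_ringKrullDim_quotient_add_encard
    (p := RingHom.ker (aeval (fun _ => 0) : MvPolynomial (Fin (N + 1)) k →ₐ[k] k)) (Set.range v) (by
      rintro _ ⟨a, rfl⟩
      change aeval (fun _ => (0 : k)) (v a) = 0
      have h0 : coeff 0 (v a) = 0 := (hv a).coeff_eq_zero (by simpa using (hd a).ne)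
      rw [show (fun _ : Fin (N + 1) => (0 : k)) = 0 from rfl, aeval_zero, constantCoeff_eq, h0, map_zero])
  have hcard : (Set.range v).encard ≤ c := by
    rw [← Set.image_univ]
    refine (Set.encard_image_le _ _).trans ?_
    rw [Set.encard_univ]; simp
  have hl2 : ((N + 1 : ℕ) : WithBot ℕ∞) ≤ ringKrullDim (MvPolynomial (Fin (N + 1)) k ⧸
      Ideal.span (Set.range v)) + (c : WithBot ℕ∞) := by
    have h3 := height_irr k (N + 1)
    refine le_trans (by exact_mod_cast h3) (hl.trans ?_)
    gcongr
    exact_mod_cast hcard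
  have heq := le_antisymm hu hl2
  have hNc : N + 1 = (N - c + 1) + c := by omega
  generalize ringKrullDim (MvPolynomial (Fin (N + 1)) k ⧸ Ideal.span (Set.range v)) = D at heq ⊢
  rw [hNc, Nat.cast_add] at heq
  induction D with
  | bot =>
    rw [WithBot.bot_add] at heq
    exact absurd heq.symm (by exact_mod_cast WithBot.coe_ne_bot)
  | coe D =>
    have : D + (c : ℕ∞) = ((N - c + 1 : ℕ) : ℕ∞) + c := by
      apply WithBot.coe_injective
      rw [WithBot.coe_add, WithBot.coe_add]
      exact heq
    have := (ENat.add_left_injective_of_ne_top (ENat.coe_ne_top c)) this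
    rw [this]; rfl

end Gen
end PartG4

section PartG5
section G5
open IntermediateField

set_option maxHeartbeats 1000000 in
theorem diag_nonempty {k K : Type u} [Field k] [Field K] [Algebra k K]
    (hfg : (⊤ : IntermediateField k K).FG) (x : K) (hx : Transcendental k x) :
    ∃ e : ℕ, 0 < e ∧ HasCvgDiagram k K e := by
  classical
  obtain ⟨s, hs⟩ := hfg
  have hess : Algebra.EssFiniteType k K := fg_top_iff.mp ⟨s, hs⟩
  have htop : ∀ T : Set K, (s : Set K) ⊆ T → IntermediateField.adjoin k T = ⊤ := fun T hT =>
    top_le_iff.mp (hs ▸ IntermediateField.adjoin.mono k _ _ hT)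
  have halg : Algebra.IsAlgebraic (Algebra.adjoin k (insert x (s : Set K))) K := by
    rw [← isAlgebraic_adjoin_iff_top, htop _ (Set.subset_insert _ _)]
    exact ⟨fun y => isAlgebraic_algebraMap (⟨y, trivial⟩ : (⊤ : IntermediateField k K))⟩
  obtain ⟨B, hxB, hBt, hB⟩ := exists_isTranscendenceBasis_between (R := k) {x} (insert x (s : Set K))
    (by simp) ((algebraicIndependent_singleton_iff (⟨x, rfl⟩ : ({x} : Set K))).mpr hx)
  have hBfin : B.Finite := (s.finite_toSet.insert x).subset hBt
  have hxB : x ∈ B := hxB rfl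
  let KB : IntermediateField k K := IntermediateField.adjoin k (B \ {x})
  have hKBfg : KB.FG := ⟨(hBfin.diff (t := {x})).toFinset, by simp [KB]⟩
  have hKBess : Algebra.EssFiniteType k KB := essFiniteType_iff.mpr hKBfg
  have hxT : Transcendental KB x := by
    rw [transcendental_adjoin_iff]
    have h := hB.1.transcendental_adjoin (s := {b | b.1 ≠ x}) (i := ⟨x, hxB⟩) (by simp)
    have h2 : ((↑) : B → K) '' {b | b.1 ≠ x} = B \ {x} := by
      ext y; simp; tauto
    rwa [h2] at h
  let M : IntermediateField KB K := IntermediateField.adjoin KB {x}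
  have hM : IntermediateField.adjoin k B ≤ M.restrictScalars k := by
    rw [IntermediateField.adjoin_le_iff]
    intro y hy
    by_cases hyx : y = x
    · have h3 : x ∈ M := IntermediateField.mem_adjoin_simple_self KB x
      rw [hyx]; exact h3
    · have h4 : y ∈ KB := IntermediateField.subset_adjoin k (B \ {x}) ⟨hy, hyx⟩
      have h3 : y ∈ M := M.algebraMap_mem ⟨y, h4⟩
      exact h3
  have hKM : Algebra.IsAlgebraic M K := by
    have h1 := hB.isAlgebraic_field
    rw [Subtype.range_coe] at h1
    letI : Algebra (IntermediateField.adjoin k B) M := (IntermediateField.inclusion hM).toRingHom.toAlgebra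
    haveI : IsScalarTower (IntermediateField.adjoin k B) M K := IsScalarTower.of_algebraMap_eq fun _ => rfl
    exact Algebra.IsAlgebraic.tower_top (K := IntermediateField.adjoin k B) M
  have hKess : Algebra.EssFiniteType KB K := Algebra.EssFiniteType.of_comp k KB K
  have hMess : Algebra.EssFiniteType M K := Algebra.EssFiniteType.of_comp KB M K
  have hfin : Module.Finite M K := Algebra.finite_of_essFiniteType_of_isAlgebraic
  refine ⟨Module.finrank M K, Module.finrank_pos, KB, K, inferInstance, inferInstance, inferInstance,
    inferInstance, fg_top k KB, ⟨s, hs⟩, AlgHom.id k K,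
    ((M.val.comp (RatFunc.algEquivOfTranscendental x hxT).toAlgHom).restrictScalars k), ?_, ?_⟩
  · exact RingHom.Finite.id K
  · letI := ((M.val.comp (RatFunc.algEquivOfTranscendental x hxT).toAlgHom).restrictScalars k).toRingHom.toAlgebra
    refine Algebra.finrank_eq_of_equiv_equiv (RatFunc.algEquivOfTranscendental x hxT).toRingEquiv (RingEquiv.refl K) ?_
    ext y
    rfl
end G5
end PartG5

section PartG6
section G6
open MvPolynomial

theorem aeval_homog_scale {k L : Type*} {σ : Type*} [Field k] [Field L] [Algebra k L] (x : σ → L) (t : L)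
    (p : MvPolynomial σ k) (m : ℕ) (hp : p.IsHomogeneous m) :
    aeval (fun b => t * x b) p = t ^ m * aeval x p := by
  rw [aeval_def, aeval_def, eval₂_eq, eval₂_eq, Finset.mul_sum]
  refine Finset.sum_congr rfl fun e he => ?_
  have h1 : ∑ i ∈ e.support, e i = m := by
    have := hp (mem_support_iff.mp he)
    rw [← this, Finsupp.weight_apply]
    simp [Finsupp.sum]
  simp only [mul_pow, Finset.prod_mul_distrib]
  rw [Finset.prod_pow_eq_pow_sum, h1]
  ring

theorem proj_facts {k : Type u} [Field k] {n : ℕ} (I : Ideal (MvPolynomial (Fin (n + 1)) k)) [I.IsPrime]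
    (hX : ∀ b, (X b : MvPolynomial (Fin (n + 1)) k) ∉ I) :
    ∃ ξ : Fin (n + 1) → projFunctionField k (n + 1) I, ξ 0 = 1 ∧ (∀ b, ξ b ≠ 0) ∧
      (∀ p m, p.IsHomogeneous m → (aeval ξ p = 0 ↔ p ∈ I)) ∧
      IntermediateField.adjoin k (Set.range ξ) = ⊤ := by
  classical
  set R := MvPolynomial (Fin (n + 1)) k ⧸ I with hR
  set L := FractionRing R with hL
  let φ : MvPolynomial (Fin (n + 1)) k →ₐ[k] L := (IsScalarTower.toAlgHom k R L).comp (Ideal.Quotient.mkₐ k I)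
  have hφ : ∀ p, φ p = algebraMap R L (Ideal.Quotient.mk I p) := fun p => rfl
  have hφ0 : ∀ p, φ p = 0 ↔ p ∈ I := by
    intro p
    rw [hφ, ← Ideal.Quotient.eq_zero_iff_mem]
    exact map_eq_zero_iff _ (IsFractionRing.injective R L)
  let x : Fin (n + 1) → L := fun b => φ (X b)
  have hx : ∀ b, x b ≠ 0 := fun b h => hX b ((hφ0 _).mp h)
  have hφx : ∀ p, φ p = aeval x p := by
    intro p
    have : φ = aeval x := by ext i; simp [x]
    rw [this]
  have hmem : ∀ b, x b / x 0 ∈ projFunctionField k (n + 1) I := by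
    intro b
    exact IntermediateField.subset_adjoin _ _ ⟨X b, X 0, 1, isHomogeneous_X _ _, isHomogeneous_X _ _, hx 0, rfl⟩
  let ξ : Fin (n + 1) → projFunctionField k (n + 1) I := fun b => ⟨x b / x 0, hmem b⟩
  let η : Fin (n + 1) → L := fun b => x b / x 0
  have hξη : ∀ p : MvPolynomial (Fin (n + 1)) k, ((aeval ξ p : projFunctionField k (n + 1) I) : L) = aeval η p := by
    intro p
    have h := aeval_algebraMap_apply L ξ p
    exact h.symm
  have hsc : ∀ (p : MvPolynomial (Fin (n + 1)) k) m, p.IsHomogeneous m → φ p = x 0 ^ m * aeval η p := by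
    intro p m hp
    rw [hφx, ← aeval_homog_scale η (x 0) p m hp]
    congr 2
    funext b
    simp only [η]
    exact (mul_div_cancel₀ (x b) (hx 0)).symm
  refine ⟨ξ, ?_, ?_, ?_, ?_⟩
  · apply Subtype.ext
    exact div_self (hx 0)
  · intro b h
    exact div_ne_zero (hx b) (hx 0) (congrArg Subtype.val h)
  · intro p m hp
    rw [← hφ0, hsc p m hp, ← hξη]
    simp [hx 0]
  · apply IntermediateField.lift_injective
    rw [IntermediateField.lift_top, IntermediateField.lift_adjoin, ← Set.range_comp]
    apply le_antisymm
    · rw [IntermediateField.adjoin_le_iff]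
      rintro _ ⟨b, rfl⟩
      exact hmem b
    · change IntermediateField.adjoin k _ ≤ _
      rw [IntermediateField.adjoin_le_iff]
      rintro _ ⟨p, q, m, hp, hq, hq0, rfl⟩
      have hη : ∀ p : MvPolynomial (Fin (n + 1)) k, aeval η p ∈ IntermediateField.adjoin k (Set.range (Subtype.val ∘ ξ)) := by
        intro p
        have : aeval η p ∈ Algebra.adjoin k (Set.range η) := by
          rw [Algebra.adjoin_range_eq_range_aeval]; exact ⟨p, rfl⟩
        exact IntermediateField.algebra_adjoin_le_adjoin _ _ this
      have h1 := hsc p m hp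
      have h2 := hsc q m hq
      rw [hφ] at h1 h2
      rw [SetLike.mem_coe, h1, h2, mul_div_mul_left _ _ (pow_ne_zero _ (hx 0))]
      exact div_mem (hη _) (hη _)

theorem algInd_of_homog {k K : Type*} [Field k] [Field K] [Algebra k K] {n c : ℕ} (hcn : c + 1 ≤ n)
    (I : Ideal (MvPolynomial (Fin (n + 1)) k)) (ξ : Fin (n + 1) → K) (hξ0 : ξ 0 = 1)
    (hI : ∀ p m, p.IsHomogeneous m → (aeval ξ p = 0 ↔ p ∈ I))
    (hker : ∀ q ∈ I, (∀ m ∈ q.support, ∀ i : Fin (n+1), 1 ≤ i.val → i.val ≤ c → m i = 0) → q = 0) :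
    AlgebraicIndependent k (fun i : Fin (n - c) => ξ ⟨c + 1 + i.val, by omega⟩) := by
  classical
  rw [algebraicIndependent_iff]
  intro P hP
  let τ : Fin (n - c) → Fin (n + 1) := fun i => ⟨c + 1 + i.val, by omega⟩
  have hτ : Function.Injective τ := fun a b h => by
    have := congrArg Fin.val h
    simp only [τ] at this
    exact Fin.ext (by omega)
  let D := P.totalDegree
  let E : (Fin (n - c) →₀ ℕ) → (Fin (n + 1) →₀ ℕ) := fun m => Finsupp.mapDomain τ m + Finsupp.single 0 (D - m.degree)
  have hE0 : ∀ m i, i ≠ 0 → E m i = Finsupp.mapDomain τ m i := by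
    intro m i hi
    simp [E, Finsupp.single_apply, hi.symm]
  have hEτ : ∀ m i, E m (τ i) = m i := by
    intro m i
    rw [hE0 _ _ (by intro h; have := congrArg Fin.val h; simp [τ] at this), Finsupp.mapDomain_apply hτ]
  have hEinj : Function.Injective E := fun a b h => by
    ext i; rw [← hEτ a, ← hEτ b, h]
  have hEz : ∀ m (i : Fin (n + 1)), 1 ≤ i.val → i.val ≤ c → E m i = 0 := by
    intro m i h1 h2
    rw [hE0 _ _ (by intro h; rw [h] at h1; simp at h1)]
    apply Finsupp.mapDomain_notin_range
    rintro ⟨j, hj⟩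
    have := congrArg Fin.val hj
    simp only [τ] at this
    omega
  let q : MvPolynomial (Fin (n + 1)) k := ∑ m ∈ P.support, monomial (E m) (coeff m P)
  have hq : q.IsHomogeneous D := by
    apply IsHomogeneous.sum
    intro m hm
    apply isHomogeneous_monomial
    have hle : m.degree ≤ D := by
      have := le_totalDegree hm
      exact this
    have h5 : (Finsupp.mapDomain τ m).degree = m.degree := by
      rw [Finsupp.degree_eq_weight_one, Finsupp.degree_eq_weight_one]
      simp [Finsupp.weight_apply, Finsupp.sum_mapDomain_index]
    simp only [E, map_add, Finsupp.degree_single, h5]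
    omega
  have hqc : ∀ m, coeff (E m) q = coeff m P := by
    intro m
    simp only [q, coeff_sum, coeff_monomial, hEinj.eq_iff]
    simp
    exact fun h => h.symm
  have hqξ : aeval ξ q = 0 := by
    rw [← hP]
    conv_rhs => rw [P.as_sum]
    simp only [q, map_sum]
    refine Finset.sum_congr rfl fun m hm => ?_
    rw [aeval_monomial, aeval_monomial]
    congr 1
    simp only [E]
    rw [Finsupp.prod_add_index' (by simp) (by intros; rw [pow_add]), Finsupp.prod_mapDomain_index (by simp) (by intros; rw [pow_add])]
    rw [Finsupp.prod_single_index (h := fun i k => ξ i ^ k) (pow_zero _), hξ0, one_pow, mul_one]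
  have hq0 : q = 0 := by
    apply hker q ((hI q D hq).mp hqξ)
    intro m hm i h1 h2
    have : m ∈ P.support.image E := by
      by_contra hcon
      rw [mem_support_iff] at hm
      apply hm
      simp only [q, coeff_sum, coeff_monomial]
      refine Finset.sum_eq_zero fun m' hm' => if_neg ?_
      rintro rfl
      exact hcon (Finset.mem_image_of_mem _ hm')
    obtain ⟨m', -, rfl⟩ := Finset.mem_image.mp this
    exact hEz _ _ h1 h2
  ext m
  rw [← hqc, hq0]
  simp
end G6
end PartG6

section PartG7
section G7
open MvPolynomial

theorem countable_prime (k : Type u) [Field k] : Countable (⊥ : Subfield k) := by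
  rw [← Subfield.closure_empty]
  rw [← Cardinal.mk_le_aleph0_iff]
  exact (Subfield.cardinalMk_closure_le_max _).trans (by simp)

theorem exists_zariski (k : Type u) [Field k] [Infinite k] {σ : Type} [Fintype σ] (c : ℕ) (d : Fin c → ℕ)
    (k0 : Type*) [Field k0] [Algebra k0 k] [Countable k0] :
    ∃ Z : ℕ → Set (∀ i : Fin c, ↥(MvPolynomial.homogeneousSubmodule σ k (d i))),
      (∀ j, IsProperZariskiClosed k _ (Z j)) ∧
      ∀ v : ∀ i : Fin c, ↥(MvPolynomial.homogeneousSubmodule σ k (d i)),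
        v ∉ ⋃ j, Z j →
        AlgebraicIndependent k0 (fun p : Σ a, Mon σ (d a) => coeff p.2.1 (v p.1 : MvPolynomial σ k)) := by
  classical
  haveI : Fintype (Σ a, Mon σ (d a)) := Fintype.ofFinite _
  let V := ∀ i : Fin c, ↥(MvPolynomial.homogeneousSubmodule σ k (d i))
  let ev : V → (Σ a, Mon σ (d a)) → k := fun v p => coeff p.2.1 (v p.1 : MvPolynomial σ k)
  have hsurj : Function.Surjective ev := by
    intro w
    refine ⟨fun a => ⟨∑ᶠ m : Mon σ (d a), monomial m.1 (w ⟨a, m⟩), ?_⟩, ?_⟩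
    · haveI := Fintype.ofFinite (Mon σ (d a))
      rw [finsum_eq_sum_of_fintype]
      refine Submodule.sum_mem _ fun m _ => ?_
      exact isHomogeneous_monomial _ m.2
    · funext ⟨a, m⟩
      haveI := Fintype.ofFinite (Mon σ (d a))
      simp only [ev]
      rw [finsum_eq_sum_of_fintype, coeff_sum]
      simp only [coeff_monomial]
      rw [Finset.sum_eq_single m]
      · simp
      · intro b _ hb
        exact if_neg fun h => hb (Subtype.ext h)
      · simp
  haveI : Countable (MvPolynomial (Σ a, Mon σ (d a)) k0) := by
    rw [← Cardinal.mk_le_aleph0_iff]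
    refine MvPolynomial.cardinalMk_le_max_lift.trans ?_
    simp
  obtain ⟨F, hF⟩ := exists_surjective_nat (MvPolynomial (Σ a, Mon σ (d a)) k0)
  let G : ℕ → MvPolynomial (Σ a, Mon σ (d a)) k0 := fun j => if F j = 0 then 1 else F j
  have hG0 : ∀ j, G j ≠ 0 := fun j => by
    simp only [G]; split_ifs with h
    · exact one_ne_zero
    · exact h
  refine ⟨fun j => {v | aeval (ev v) (G j) = 0}, ?_, ?_⟩
  · intro j
    refine ⟨?_, {fun v => aeval (ev v) (G j)}, ?_, ?_⟩
    · intro huniv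
      apply hG0 j
      apply map_injective (algebraMap k0 k) (algebraMap k0 k).injective
      rw [map_zero]
      apply MvPolynomial.funext
      intro w
      obtain ⟨v, rfl⟩ := hsurj w
      have : v ∈ {v : V | aeval (ev v) (G j) = 0} := Set.eq_univ_iff_forall.mp huniv v
      rw [eval_map, map_zero]
      exact this
    · rw [Set.singleton_subset_iff]
      have h1 : ∀ p : Σ a, Mon σ (d a), (fun v : V => ev v p) ∈ polyFun k V := by
        intro p
        apply Algebra.subset_adjoin
        refine ⟨((lcoeff k p.2.1).comp (Submodule.subtype _)).comp (LinearMap.proj p.1), ?_⟩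
        funext v
        rfl
      have h2 : (fun v : V => aeval (ev v) (G j)) = aeval (fun p => (fun v : V => ev v p)) (map (algebraMap k0 k) (G j)) := by
        funext v
        have := (MvPolynomial.map_aeval (fun p => (fun v : V => ev v p)) (Pi.evalRingHom (fun _ : V => k) v) (map (algebraMap k0 k) (G j)))
        rw [Pi.evalRingHom_apply] at this
        rw [this, eval₂Hom_map_hom]
        rfl
      rw [h2]
      have := (aeval (fun p => (⟨_, h1 p⟩ : polyFun k V)) (map (algebraMap k0 k) (G j))).2
      have h3 := aeval_algebraMap_apply (V → k) (fun p => (⟨_, h1 p⟩ : polyFun k V)) (map (algebraMap k0 k) (G j))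
      rw [SetLike.mem_coe]
      exact (congrArg (· ∈ polyFun k V) h3).mpr this
    · ext v; simp
  · intro v hv
    rw [algebraicIndependent_iff]
    intro P hP
    by_contra hP0
    obtain ⟨j, rfl⟩ := hF P
    apply hv
    rw [Set.mem_iUnion]
    refine ⟨j, ?_⟩
    simp only [Set.mem_setOf_eq, G, if_neg hP0]
    exact hP
end G7
end PartG7

/-- Over an uncountable algebraically closed field, a very general complete intersection of
multidegree `(d_1, …, d_c)` in `ℙ^N` is integral of dimension `N - c` and its function field
has covering gonality at least `(d_1 + ⋯ + d_c - N + 2) / 2`. -/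
theorem stmt1 (k : Type u) [Field k] [IsAlgClosed k] [Uncountable k]
    (N c : ℕ) (hN : 0 < N) (hc : 0 < c) (hcN : c ≤ N - 1)
    (d : Fin c → ℕ) (hd : ∀ i, 0 < d i) :
    ∃ Z : ℕ → Set (∀ i : Fin c, ↥(MvPolynomial.homogeneousSubmodule (Fin (N + 1)) k (d i))),
      (∀ j, IsProperZariskiClosed k _ (Z j)) ∧
      ∀ v : ∀ i : Fin c, ↥(MvPolynomial.homogeneousSubmodule (Fin (N + 1)) k (d i)),
        v ∉ ⋃ j, Z j →
        ∃ hP : (Ideal.span (Set.range fun i => ((v i : MvPolynomial (Fin (N + 1)) k)))).IsPrime,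
          ringKrullDim (MvPolynomial (Fin (N + 1)) k ⧸
              Ideal.span (Set.range fun i => ((v i : MvPolynomial (Fin (N + 1)) k))))
            = ((N - c + 1 : ℕ) : WithBot ℕ∞) ∧
          (haveI := hP
           ((∑ i, d i : ℤ) - N + 2) ≤ 2 * (cvg k ↥(projFunctionField k (N + 1)
              (Ideal.span (Set.range fun i => ((v i : MvPolynomial (Fin (N + 1)) k))))) : ℤ)) := by
  haveI : Countable (⊥ : Subfield k) := countable_prime k
  obtain ⟨Z, hZ, hZv⟩ := exists_zariski k (σ := Fin (N + 1)) c d (⊥ : Subfield k)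
  refine ⟨Z, hZ, fun v hv => ?_⟩
  have hcN' : c + 1 ≤ N := by omega
  have hV := hZv v hv
  have hom : ∀ a, (v a : MvPolynomial (Fin (N + 1)) k).IsHomogeneous (d a) := fun a => (v a).2
  obtain ⟨h1, h2, h3, h4⟩ := Gen.gen_main hcN' d hd (fun a => (v a : MvPolynomial (Fin (N + 1)) k)) hom hV
  have hP : (Ideal.span (Set.range fun i => ((v i : MvPolynomial (Fin (N + 1)) k)))).IsPrime := by
    have h := h1 c le_rfl
    have h5 : (fun a => (v a : MvPolynomial (Fin (N + 1)) k)) '' {a | a.val < c} = Set.range fun i => ((v i : MvPolynomial (Fin (N + 1)) k)) := by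
      ext p; simp
    rwa [h5] at h
  refine ⟨hP, Gen.krull hcN' d hd _ hom h1 h2, ?_⟩
  obtain ⟨ξ, hξ0, hξ, hξI, hgen⟩ := proj_facts (Ideal.span (Set.range fun i => ((v i : MvPolynomial (Fin (N + 1)) k)))) h3
  have hind := algInd_of_homog hcN' _ ξ hξ0 hξI h4
  have hfg : (⊤ : IntermediateField k (projFunctionField k (N + 1)
      (Ideal.span (Set.range fun i => ((v i : MvPolynomial (Fin (N + 1)) k)))))).FG :=
    ⟨(Set.finite_range ξ).toFinset, by rw [Set.Finite.coe_toFinset]; exact hgen⟩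
  have hne := diag_nonempty hfg _ (hind.transcendental ⟨0, by omega⟩)
  obtain ⟨he, hdiag⟩ := Nat.sInf_mem hne
  change 0 < cvg k _ at he
  change HasCvgDiagram k _ (cvg k _) at hdiag
  by_contra hlt
  rw [not_le] at hlt
  refine part2 (by omega) d he ?_ (fun a => (v a : MvPolynomial (Fin (N + 1)) k)) hom hV ξ hξ0 hξ
    (fun a => (hξI _ _ (hom a)).mpr (Ideal.subset_span ⟨a, rfl⟩)) hgen _ hind hdiag
  have h6 : ((∑ i, d i : ℕ) : ℤ) = ∑ i, (d i : ℤ) := by push_cast; rfl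
  omega
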